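/- arXiv:1410.8144 — 2 statements merged into one kernel-verified Lean document; each statement's English description precedes it below -/
import Mathlib

section
/- Let 1 < a ≤ b and set c = ab. Let (H,z), with H = (H_A,H_B,H_{AB}) traceless (H_{AB} ∈ ℝ^{ab}), be a non-trivial facet normal of C(a,b,ab) such that (H_A,H_B) ≠ 0. Then: (1) (H_A,H_B) satisfies the extremal-edge condition; (2) there exists a bijection φ : {1,…,ab} → {1,…,a} × {1,…,b} such that H_{AB,m} = −H_{A,φ(m)₁} − H_{B,φ(m)₂} for all m; and (3) z = 0. -/
open scoped BigOperators

noncomputable section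

/-- The reduced density matrix on the first subsystem. -/
def rhoA {a b c : ℕ} (ψ : Fin a × Fin b × Fin c → ℂ) : Matrix (Fin a) (Fin a) ℂ :=
  Matrix.of fun i i' => ∑ j : Fin b, ∑ k : Fin c, ψ (i, j, k) * (starRingEnd ℂ) (ψ (i', j, k))

/-- The reduced density matrix on the second subsystem. -/
def rhoB {a b c : ℕ} (ψ : Fin a × Fin b × Fin c → ℂ) : Matrix (Fin b) (Fin b) ℂ :=
  Matrix.of fun j j' => ∑ i : Fin a, ∑ k : Fin c, ψ (i, j, k) * (starRingEnd ℂ) (ψ (i, j', k))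

/-- The reduced density matrix on the third subsystem. -/
def rhoC {a b c : ℕ} (ψ : Fin a × Fin b × Fin c → ℂ) : Matrix (Fin c) (Fin c) ℂ :=
  Matrix.of fun k k' => ∑ i : Fin a, ∑ j : Fin b, ψ (i, j, k) * (starRingEnd ℂ) (ψ (i, j, k'))

/-- `lam` is the vector of eigenvalues of `ρ`, listed in nonincreasing order
with multiplicity. -/
def IsSpecDown {n : ℕ} (ρ : Matrix (Fin n) (Fin n) ℂ) (lam : Fin n → ℝ) : Prop :=
  Antitone lam ∧ ∃ (hρ : ρ.IsHermitian) (σ : Equiv.Perm (Fin n)), lam = hρ.eigenvalues ∘ σ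

/-- The Kronecker cone `C(a,b,c)`. -/
def KronCone (a b c : ℕ) : Set ((Fin a → ℝ) × (Fin b → ℝ) × (Fin c → ℝ)) :=
  { lam | ∃ ψ : Fin a × Fin b × Fin c → ℂ,
      IsSpecDown (rhoA ψ) lam.1 ∧ IsSpecDown (rhoB ψ) lam.2.1 ∧ IsSpecDown (rhoC ψ) lam.2.2 }

/-- The pairing `⟨(H,z), λ⟩`. -/
def wtPair {a b c : ℕ} (HA : Fin a → ℝ) (HB : Fin b → ℝ) (HC : Fin c → ℝ) (z : ℝ)
    (lam : (Fin a → ℝ) × (Fin b → ℝ) × (Fin c → ℝ)) : ℝ :=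
  (∑ i, HA i * lam.1 i) + (∑ j, HB j * lam.2.1 j) + (∑ k, HC k * lam.2.2 k)
    + z * ∑ i, lam.1 i

/-- `H = (H_A, H_B, H_C)` is traceless. -/
def Traceless {a b c : ℕ} (HA : Fin a → ℝ) (HB : Fin b → ℝ) (HC : Fin c → ℝ) : Prop :=
  (∑ i, HA i) = 0 ∧ (∑ j, HB j) = 0 ∧ (∑ k, HC k) = 0

/-- `(H, z)` is a facet normal of the Kronecker cone `C(a,b,c)`. -/
def IsFacetNormal (a b c : ℕ) (HA : Fin a → ℝ) (HB : Fin b → ℝ) (HC : Fin c → ℝ)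
    (z : ℝ) : Prop :=
  Traceless HA HB HC ∧ ¬(HA = 0 ∧ HB = 0 ∧ HC = 0 ∧ z = 0) ∧
  (∀ lam ∈ KronCone a b c, 0 ≤ wtPair HA HB HC z lam) ∧
  Module.finrank ℝ
    (affineSpan ℝ {lam ∈ KronCone a b c | wtPair HA HB HC z lam = 0}).direction
    = a + b + c - 3

/-- `(H, z)` is a trivial (Weyl chamber) normal. -/
def IsTrivialNormal {a b c : ℕ} (HA : Fin a → ℝ) (HB : Fin b → ℝ) (HC : Fin c → ℝ)
    (z : ℝ) : Prop :=
  ∃ t : ℝ, 0 < t ∧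
    ((∃ i i' : Fin a, i < i' ∧ HA = t • (Pi.single i 1 - Pi.single i' 1) ∧
        HB = 0 ∧ HC = 0 ∧ z = 0) ∨
     (∃ j j' : Fin b, j < j' ∧ HB = t • (Pi.single j 1 - Pi.single j' 1) ∧
        HA = 0 ∧ HC = 0 ∧ z = 0) ∨
     (∃ k k' : Fin c, k < k' ∧ HC = t • (Pi.single k 1 - Pi.single k' 1) ∧
        HA = 0 ∧ HB = 0 ∧ z = 0))

/-- The subspace of vectors supported on coordinates satisfying `P`. -/
def suppSubmodule {ι : Type*} (P : ι → Prop) : Submodule ℂ (ι → ℂ) where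
  carrier := {ψ | ∀ p, ¬ P p → ψ p = 0}
  add_mem' := by
    intro x y hx hy p hp
    simp only [Pi.add_apply, hx p hp, hy p hp, add_zero]
  zero_mem' := by intro p _; rfl
  smul_mem' := by
    intro r x hx p hp
    simp only [Pi.smul_apply, hx p hp, smul_zero]

/-- The zero-weight space `ℋ₀(H,z)`. -/
def weight0Space {a b c : ℕ} (HA : Fin a → ℝ) (HB : Fin b → ℝ) (HC : Fin c → ℝ)
    (z : ℝ) : Submodule ℂ (Fin a × Fin b × Fin c → ℂ) :=
  suppSubmodule fun p => HA p.1 + HB p.2.1 + HC p.2.2 + z = 0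

/-- The negative-weight space `ℋ₋(H,z)`. -/
def weightNegSpace {a b c : ℕ} (HA : Fin a → ℝ) (HB : Fin b → ℝ) (HC : Fin c → ℝ)
    (z : ℝ) : Submodule ℂ (Fin a × Fin b × Fin c → ℂ) :=
  suppSubmodule fun p => HA p.1 + HB p.2.1 + HC p.2.2 + z < 0

/-- Strictly lower triangular matrices `X` with `X i' i = 0` unless
`i < i'` and `Hv i' < Hv i`. -/
def lowerMod {d : ℕ} (Hv : Fin d → ℝ) : Submodule ℂ (Matrix (Fin d) (Fin d) ℂ) where
  carrier := {X | ∀ i' i, ¬ (i < i' ∧ Hv i' < Hv i) → X i' i = 0}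
  add_mem' := by
    intro X Y hX hY i' i h
    simp only [Matrix.add_apply, hX i' i h, hY i' i h, add_zero]
  zero_mem' := by intro i' i h; rfl
  smul_mem' := by
    intro r X hX i' i h
    simp only [Matrix.smul_apply, hX i' i h, smul_zero]

/-- The nilpotent algebra `𝔫₋(H)`. -/
def nMinusMod {a b c : ℕ} (HA : Fin a → ℝ) (HB : Fin b → ℝ) (HC : Fin c → ℝ) :
    Submodule ℂ (Matrix (Fin a) (Fin a) ℂ × Matrix (Fin b) (Fin b) ℂ ×
      Matrix (Fin c) (Fin c) ℂ) :=
  (lowerMod HA).prod ((lowerMod HB).prod (lowerMod HC))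

/-- The infinitesimal action `(X,Y,Z) ↦ (X⊗I⊗I + I⊗Y⊗I + I⊗I⊗Z)ψ`. -/
def act {a b c : ℕ}
    (t : Matrix (Fin a) (Fin a) ℂ × Matrix (Fin b) (Fin b) ℂ × Matrix (Fin c) (Fin c) ℂ)
    (ψ : Fin a × Fin b × Fin c → ℂ) : Fin a × Fin b × Fin c → ℂ := fun p =>
  (∑ i', t.1 p.1 i' * ψ (i', p.2.1, p.2.2)) +
  (∑ j', t.2.1 p.2.1 j' * ψ (p.1, j', p.2.2)) +
  (∑ k', t.2.2 p.2.2 k' * ψ (p.1, p.2.1, k'))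

/-- The action as a linear map in `(X,Y,Z)`. -/
def actL {a b c : ℕ} (ψ : Fin a × Fin b × Fin c → ℂ) :
    (Matrix (Fin a) (Fin a) ℂ × Matrix (Fin b) (Fin b) ℂ × Matrix (Fin c) (Fin c) ℂ)
      →ₗ[ℂ] (Fin a × Fin b × Fin c → ℂ) where
  toFun t := act t ψ
  map_add' t s := by
    funext p
    simp only [act, Prod.fst_add, Prod.snd_add, Matrix.add_apply, add_mul,
      Finset.sum_add_distrib, Pi.add_apply]
    ring
  map_smul' r t := by
    funext p
    simp only [act, Prod.smul_fst, Prod.smul_snd, Matrix.smul_apply, smul_eq_mul,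
      Pi.smul_apply, RingHom.id_apply, Finset.mul_sum, mul_assoc, mul_add]

/-- The tangent map `T_ψ : 𝔫₋(H) → ℋ₋(H,z)` is a linear isomorphism. -/
def TangentIso {a b c : ℕ} (HA : Fin a → ℝ) (HB : Fin b → ℝ) (HC : Fin c → ℝ)
    (z : ℝ) (ψ : Fin a × Fin b × Fin c → ℂ) : Prop :=
  ∃ h : ∀ t ∈ nMinusMod HA HB HC, actL ψ t ∈ weightNegSpace HA HB HC z,
    Function.Bijective ((actL ψ).restrict h)

/-- The tangent map `T_ψ : 𝔫₋(H) → ℋ₋(H,z)` is surjective. -/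
def TangentSurj {a b c : ℕ} (HA : Fin a → ℝ) (HB : Fin b → ℝ) (HC : Fin c → ℝ)
    (z : ℝ) (ψ : Fin a × Fin b × Fin c → ℂ) : Prop :=
  ∃ h : ∀ t ∈ nMinusMod HA HB HC, actL ψ t ∈ weightNegSpace HA HB HC z,
    Function.Surjective ((actL ψ).restrict h)

/-- `(H,z)` is admissible: the hyperplane `⟨(H,z), ·⟩ = 0` in `V` is spanned by
the weights of zero `(H,z)`-weight. -/
def Admissible {a b c : ℕ} (HA : Fin a → ℝ) (HB : Fin b → ℝ) (HC : Fin c → ℝ)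
    (z : ℝ) : Prop :=
  (Submodule.span ℝ
    { w : (Fin a → ℝ) × (Fin b → ℝ) × (Fin c → ℝ) |
      ∃ i j k, HA i + HB j + HC k + z = 0 ∧
        w = (Pi.single i 1, Pi.single j 1, Pi.single k 1) } : Set _)
  = { lam | (∑ i, lam.1 i) = (∑ j, lam.2.1 j) ∧ (∑ i, lam.1 i) = (∑ k, lam.2.2 k) ∧
        wtPair HA HB HC z lam = 0 }

/-- `(H,z)` is a Ressayre element. -/
def IsRessayre {a b c : ℕ} (HA : Fin a → ℝ) (HB : Fin b → ℝ) (HC : Fin c → ℝ)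
    (z : ℝ) : Prop :=
  Traceless HA HB HC ∧ ¬(HA = 0 ∧ HB = 0 ∧ HC = 0 ∧ z = 0) ∧
  Admissible HA HB HC z ∧
  ∃ ψ ∈ weight0Space HA HB HC z, TangentIso HA HB HC z ψ

/-- `(H_A, H_B)` satisfies the extremal-edge condition. -/
def ExtremalEdge {a b : ℕ} (HA : Fin a → ℝ) (HB : Fin b → ℝ) : Prop :=
  (∑ i, HA i) = 0 ∧ (∑ j, HB j) = 0 ∧ ¬(HA = 0 ∧ HB = 0) ∧
  ∀ (x : Fin a → ℝ) (y : Fin b → ℝ), (∑ i, x i) = 0 → (∑ j, y j) = 0 →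
    (∀ i j k l, HA i + HB j = HA k + HB l → x i + y j = x k + y l) →
    ∃ t : ℝ, x = t • HA ∧ y = t • HB

section Basics

open Matrix Kronecker

/-- The squared `ℓ²` norm of a finitely supported vector. -/
def sqN {X : Type*} [Fintype X] (ψ : X → ℂ) : ℝ := ∑ p, ‖ψ p‖ ^ 2

/-- The Kronecker product of three matrices, acting on tensors. -/
def tri {a b c : ℕ} (A : Matrix (Fin a) (Fin a) ℂ) (B : Matrix (Fin b) (Fin b) ℂ)
    (C : Matrix (Fin c) (Fin c) ℂ) :
    Matrix (Fin a × Fin b × Fin c) (Fin a × Fin b × Fin c) ℂ :=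
  A ⊗ₖ (B ⊗ₖ C)

lemma ofReal_sqN {X : Type*} [Fintype X] (ψ : X → ℂ) : ((sqN ψ : ℝ) : ℂ) = star ψ ⬝ᵥ ψ := by
  simp only [sqN, dotProduct, Pi.star_apply, RCLike.star_def, Complex.ofReal_sum]
  refine Finset.sum_congr rfl fun p _ => ?_
  rw [Complex.conj_mul']; simp

lemma sqN_nonneg {X : Type*} [Fintype X] (ψ : X → ℂ) : 0 ≤ sqN ψ :=
  Finset.sum_nonneg fun _ _ => by positivity

lemma sqN_eq_zero {X : Type*} [Fintype X] {ψ : X → ℂ} : sqN ψ = 0 ↔ ψ = 0 := by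
  constructor
  · intro h
    rw [sqN, Finset.sum_eq_zero_iff_of_nonneg (fun _ _ => by positivity)] at h
    funext p
    simpa using h p (Finset.mem_univ p)
  · rintro rfl; simp [sqN]

lemma sqN_pos {X : Type*} [Fintype X] {ψ : X → ℂ} (h : ψ ≠ 0) : 0 < sqN ψ :=
  lt_of_le_of_ne (sqN_nonneg ψ) fun h' => h (sqN_eq_zero.1 h'.symm)

lemma sqN_smul {X : Type*} [Fintype X] (r : ℂ) (ψ : X → ℂ) :
    sqN (r • ψ) = ‖r‖ ^ 2 * sqN ψ := by
  simp [sqN, Finset.mul_sum, mul_pow]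

lemma continuous_sqN {X : Type*} [Fintype X] : Continuous (sqN : (X → ℂ) → ℝ) := by
  unfold sqN; fun_prop

lemma norm_sq_star_dotProduct_le {X : Type*} [Fintype X] (u v : X → ℂ) :
    ‖star u ⬝ᵥ v‖ ^ 2 ≤ sqN u * sqN v := by
  have h1 : ‖star u ⬝ᵥ v‖ ≤ ∑ x, ‖u x‖ * ‖v x‖ := by
    refine (norm_sum_le _ _).trans (le_of_eq ?_)
    simp
  calc ‖star u ⬝ᵥ v‖ ^ 2 ≤ (∑ x, ‖u x‖ * ‖v x‖) ^ 2 := by gcongr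
    _ ≤ sqN u * sqN v := Finset.sum_mul_sq_le_sq_mul_sq _ _ _

lemma sqN_mulVec_of_unitary {X : Type*} [Fintype X] [DecidableEq X] {k : Matrix X X ℂ}
    (hk : kᴴ * k = 1) (v : X → ℂ) : sqN (k *ᵥ v) = sqN v := by
  have : ((sqN (k *ᵥ v) : ℝ) : ℂ) = ((sqN v : ℝ) : ℂ) := by
    rw [ofReal_sqN, ofReal_sqN, star_mulVec, ← dotProduct_mulVec, mulVec_mulVec, hk, one_mulVec]
  exact_mod_cast this

variable {a b c : ℕ}

lemma tri_mul (A A' : Matrix (Fin a) (Fin a) ℂ) (B B' : Matrix (Fin b) (Fin b) ℂ)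
    (C C' : Matrix (Fin c) (Fin c) ℂ) :
    tri A B C * tri A' B' C' = tri (A * A') (B * B') (C * C') := by
  simp only [tri, ← mul_kronecker_mul]

lemma tri_one : tri (1 : Matrix (Fin a) (Fin a) ℂ) (1 : Matrix (Fin b) (Fin b) ℂ)
    (1 : Matrix (Fin c) (Fin c) ℂ) = 1 := by
  simp [tri]

lemma tri_conjTranspose (A : Matrix (Fin a) (Fin a) ℂ) (B : Matrix (Fin b) (Fin b) ℂ)
    (C : Matrix (Fin c) (Fin c) ℂ) : (tri A B C)ᴴ = tri Aᴴ Bᴴ Cᴴ := by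
  simp only [tri, conjTranspose_kronecker]

lemma tri_apply (A : Matrix (Fin a) (Fin a) ℂ) (B : Matrix (Fin b) (Fin b) ℂ)
    (C : Matrix (Fin c) (Fin c) ℂ) (p q : Fin a × Fin b × Fin c) :
    tri A B C p q = A p.1 q.1 * (B p.2.1 q.2.1 * C p.2.2 q.2.2) := rfl

lemma expect_fst (X : Matrix (Fin a) (Fin a) ℂ) (ψ : Fin a × Fin b × Fin c → ℂ) :
    star ψ ⬝ᵥ (tri X 1 1 *ᵥ ψ) = (X * rhoA ψ).trace := by
  simp only [dotProduct, mulVec, tri_apply, Fintype.sum_prod_type, trace, diag, mul_apply, rhoA,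
    of_apply, one_apply, Pi.star_apply, Finset.mul_sum]
  refine Finset.sum_congr rfl fun i _ => ?_
  have : ∀ j k, ∑ i', ∑ j', ∑ k', star (ψ (i, j, k)) *
      (X i i' * ((if j = j' then 1 else 0) * if k = k' then 1 else 0) * ψ (i', j', k'))
      = ∑ i', X i i' * (ψ (i', j, k) * (starRingEnd ℂ) (ψ (i, j, k))) := by
    intro j k
    refine Finset.sum_congr rfl fun i' _ => ?_
    rw [Finset.sum_eq_single j (fun j' _ h => by simp [Ne.symm h]) (by simp),
      Finset.sum_eq_single k (fun j' _ h => by simp [Ne.symm h]) (by simp)]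
    simp; ring
  simp only [this]
  rw [Finset.sum_congr rfl fun j _ => Finset.sum_comm, Finset.sum_comm]

lemma expect_snd (X : Matrix (Fin b) (Fin b) ℂ) (ψ : Fin a × Fin b × Fin c → ℂ) :
    star ψ ⬝ᵥ (tri 1 X 1 *ᵥ ψ) = (X * rhoB ψ).trace := by
  simp only [dotProduct, mulVec, tri_apply, Fintype.sum_prod_type, trace, diag, mul_apply, rhoB,
    of_apply, one_apply, Pi.star_apply, Finset.mul_sum]
  have : ∀ i j k, ∑ i', ∑ j', ∑ k', star (ψ (i, j, k)) *
      ((if i = i' then 1 else 0) * (X j j' * if k = k' then 1 else 0) * ψ (i', j', k'))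
      = ∑ j', X j j' * (ψ (i, j', k) * (starRingEnd ℂ) (ψ (i, j, k))) := by
    intro i j k
    rw [Finset.sum_eq_single i (fun j' _ h => by simp [Ne.symm h]) (by simp)]
    refine Finset.sum_congr rfl fun i' _ => ?_
    rw [Finset.sum_eq_single k (fun j' _ h => by simp [Ne.symm h]) (by simp)]
    simp; ring
  simp only [this]
  rw [Finset.sum_comm]
  refine Finset.sum_congr rfl fun j _ => ?_
  rw [Finset.sum_congr rfl fun j _ => Finset.sum_comm, Finset.sum_comm]

lemma expect_trd (X : Matrix (Fin c) (Fin c) ℂ) (ψ : Fin a × Fin b × Fin c → ℂ) :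
    star ψ ⬝ᵥ (tri 1 1 X *ᵥ ψ) = (X * rhoC ψ).trace := by
  simp only [dotProduct, mulVec, tri_apply, Fintype.sum_prod_type, trace, diag, mul_apply, rhoC,
    of_apply, one_apply, Pi.star_apply, Finset.mul_sum]
  have : ∀ i j k, ∑ i', ∑ j', ∑ k', star (ψ (i, j, k)) *
      ((if i = i' then 1 else 0) * ((if j = j' then 1 else 0) * X k k') * ψ (i', j', k'))
      = ∑ k', X k k' * (ψ (i, j, k') * (starRingEnd ℂ) (ψ (i, j, k))) := by
    intro i j k
    rw [Finset.sum_eq_single i (fun j' _ h => by simp [Ne.symm h]) (by simp),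
      Finset.sum_eq_single j (fun j' _ h => by simp [Ne.symm h]) (by simp)]
    refine Finset.sum_congr rfl fun i' _ => ?_
    simp; ring
  simp only [this]
  rw [Finset.sum_congr rfl fun j _ => Finset.sum_comm, Finset.sum_comm]
  refine Finset.sum_congr rfl fun j _ => ?_
  rw [Finset.sum_congr rfl fun j _ => Finset.sum_comm, Finset.sum_comm]

lemma expect_conj {X : Type*} [Fintype X] (M k : Matrix X X ℂ) (ψ : X → ℂ) :
    star (k *ᵥ ψ) ⬝ᵥ (M *ᵥ (k *ᵥ ψ)) = star ψ ⬝ᵥ ((kᴴ * M * k) *ᵥ ψ) := by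
  rw [star_mulVec, ← dotProduct_mulVec, mulVec_mulVec, mulVec_mulVec, Matrix.mul_assoc]

variable {U : Matrix (Fin a) (Fin a) ℂ} {V : Matrix (Fin b) (Fin b) ℂ}
  {W : Matrix (Fin c) (Fin c) ℂ}

lemma rhoA_tri (hV : Vᴴ * V = 1) (hW : Wᴴ * W = 1)
    (ψ : Fin a × Fin b × Fin c → ℂ) : rhoA (tri U V W *ᵥ ψ) = U * rhoA ψ * Uᴴ := by
  refine ext_iff_trace_mul_left.2 fun X => ?_
  rw [← expect_fst, expect_conj, tri_conjTranspose, tri_mul, tri_mul, Matrix.mul_one,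
    Matrix.mul_one, hV, hW, expect_fst, ← Matrix.mul_assoc, ← Matrix.mul_assoc,
    trace_mul_comm _ Uᴴ]
  simp only [Matrix.mul_assoc]

lemma rhoB_tri (hU : Uᴴ * U = 1) (hW : Wᴴ * W = 1)
    (ψ : Fin a × Fin b × Fin c → ℂ) : rhoB (tri U V W *ᵥ ψ) = V * rhoB ψ * Vᴴ := by
  refine ext_iff_trace_mul_left.2 fun X => ?_
  rw [← expect_snd, expect_conj, tri_conjTranspose, tri_mul, tri_mul, Matrix.mul_one,
    Matrix.mul_one, hU, hW, expect_snd, ← Matrix.mul_assoc, ← Matrix.mul_assoc,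
    trace_mul_comm _ Vᴴ]
  simp only [Matrix.mul_assoc]

lemma rhoC_tri (hU : Uᴴ * U = 1) (hV : Vᴴ * V = 1)
    (ψ : Fin a × Fin b × Fin c → ℂ) : rhoC (tri U V W *ᵥ ψ) = W * rhoC ψ * Wᴴ := by
  refine ext_iff_trace_mul_left.2 fun X => ?_
  rw [← expect_trd, expect_conj, tri_conjTranspose, tri_mul, tri_mul, Matrix.mul_one,
    Matrix.mul_one, hU, hV, expect_trd, ← Matrix.mul_assoc, ← Matrix.mul_assoc,
    trace_mul_comm _ Wᴴ]
  simp only [Matrix.mul_assoc]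

lemma rhoA_isHermitian (ψ : Fin a × Fin b × Fin c → ℂ) : (rhoA ψ).IsHermitian := by
  ext i i'
  simp [rhoA, conjTranspose_apply, mul_comm]

lemma rhoB_isHermitian (ψ : Fin a × Fin b × Fin c → ℂ) : (rhoB ψ).IsHermitian := by
  ext i i'
  simp [rhoB, conjTranspose_apply, mul_comm]

lemma rhoC_isHermitian (ψ : Fin a × Fin b × Fin c → ℂ) : (rhoC ψ).IsHermitian := by
  ext i i'
  simp [rhoC, conjTranspose_apply, mul_comm]

lemma trace_rhoA (ψ : Fin a × Fin b × Fin c → ℂ) : (rhoA ψ).trace = sqN ψ := by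
  rw [ofReal_sqN, ← Matrix.one_mul (rhoA ψ), ← expect_fst, tri_one, one_mulVec]

lemma trace_rhoB (ψ : Fin a × Fin b × Fin c → ℂ) : (rhoB ψ).trace = sqN ψ := by
  rw [ofReal_sqN, ← Matrix.one_mul (rhoB ψ), ← expect_snd, tri_one, one_mulVec]

lemma trace_rhoC (ψ : Fin a × Fin b × Fin c → ℂ) : (rhoC ψ).trace = sqN ψ := by
  rw [ofReal_sqN, ← Matrix.one_mul (rhoC ψ), ← expect_trd, tri_one, one_mulVec]

/-- Real diagonal matrices with complex entries. -/
def rdiag {d : ℕ} (l : Fin d → ℝ) : Matrix (Fin d) (Fin d) ℂ := diagonal fun i => (l i : ℂ)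

lemma exists_perm_of_map_univ_eq {d : ℕ} {l m : Fin d → ℝ}
    (h : Multiset.map l Finset.univ.val = Multiset.map m Finset.univ.val) :
    ∃ σ : Equiv.Perm (Fin d), l = m ∘ σ := by
  have key : ∀ y, Nonempty ({i // l i = y} ≃ {i // m i = y}) := fun y => by
    refine ⟨Fintype.equivOfCardEq ?_⟩
    have := congrArg (Multiset.count y) h
    simp only [Multiset.count_map] at this
    rw [Fintype.card_subtype, Fintype.card_subtype]
    convert this using 2 <;> simp [Finset.filter, eq_comm]
  let e := fun y => (key y).some
  refine ⟨Equiv.ofFiberEquiv e, ?_⟩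
  funext i
  exact (Equiv.ofFiberEquiv_map e i).symm

lemma antitone_comp_perm_eq {d : ℕ} {l m : Fin d → ℝ} (hl : Antitone l) (hm : Antitone m)
    (h : Multiset.map l Finset.univ.val = Multiset.map m Finset.univ.val) : l = m := by
  obtain ⟨σ, hσ⟩ := exists_perm_of_map_univ_eq h
  have h1 : Antitone (m ∘ (σ : Equiv.Perm (Fin d))) := hσ ▸ hl
  have h3 : m ∘ σ = m ∘ (1 : Equiv.Perm (Fin d)) := by
    have := Tuple.unique_monotone (f := fun i => -m i) (σ := σ) (τ := 1)
      (fun i j hij => neg_le_neg (h1 hij)) (fun i j hij => neg_le_neg (hm hij))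
    funext i
    simpa using congrFun this i
  rw [hσ, h3]; rfl

lemma multiset_eigenvalues_of_conj {d : ℕ} {ρ U : Matrix (Fin d) (Fin d) ℂ} {l : Fin d → ℝ}
    (hU : Uᴴ * U = 1) (hρ : ρ.IsHermitian) (h : U * ρ * Uᴴ = rdiag l) :
    Multiset.map hρ.eigenvalues Finset.univ.val = Multiset.map l Finset.univ.val := by
  have h1 : ρ.charpoly = (rdiag l).charpoly := by
    rw [← h, Matrix.mul_assoc, charpoly_mul_comm, Matrix.mul_assoc, hU, Matrix.mul_one]
  have h2 := hρ.roots_charpoly_eq_eigenvalues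
  rw [h1, rdiag, charpoly_diagonal] at h2
  rw [Polynomial.roots_prod _ _ (Finset.prod_ne_zero_iff.2 fun i _ => Polynomial.X_sub_C_ne_zero _)]
    at h2
  simp only [Polynomial.roots_X_sub_C, Multiset.bind_singleton] at h2
  have h3 := congrArg (Multiset.map Complex.re) h2
  simpa [Multiset.map_map, Function.comp_def] using h3.symm

lemma isSpecDown_of_conj {d : ℕ} {ρ U : Matrix (Fin d) (Fin d) ℂ} {l : Fin d → ℝ}
    (hU : Uᴴ * U = 1) (hρ : ρ.IsHermitian) (h : U * ρ * Uᴴ = rdiag l) (hl : Antitone l) :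
    IsSpecDown ρ l := by
  obtain ⟨σ, hσ⟩ := exists_perm_of_map_univ_eq (multiset_eigenvalues_of_conj hU hρ h).symm
  exact ⟨hl, hρ, σ, hσ⟩

lemma IsSpecDown.exists_conj {d : ℕ} {ρ : Matrix (Fin d) (Fin d) ℂ} {l : Fin d → ℝ}
    (h : IsSpecDown ρ l) : ∃ U : Matrix (Fin d) (Fin d) ℂ, Uᴴ * U = 1 ∧ U * ρ * Uᴴ = rdiag l := by
  obtain ⟨-, hρ, σ, rfl⟩ := h
  let E : Matrix (Fin d) (Fin d) ℂ := hρ.eigenvectorUnitary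
  have hE : Eᴴ * E = 1 := Unitary.coe_star_mul_self hρ.eigenvectorUnitary
  have hE' : E * Eᴴ = 1 := Unitary.coe_mul_star_self hρ.eigenvectorUnitary
  have hs : ρ = E * rdiag hρ.eigenvalues * Eᴴ := by
    conv_lhs => rw [hρ.spectral_theorem, Unitary.conjStarAlgAut_apply]
    rfl
  have hs' : Eᴴ * ρ * E = rdiag hρ.eigenvalues := by
    refine (congrArg (fun M => Eᴴ * M * E) hs).trans ?_
    simp only [Matrix.mul_assoc]
    rw [hE, Matrix.mul_one, ← Matrix.mul_assoc, hE, Matrix.one_mul]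
  refine ⟨Eᴴ.submatrix σ id, ?_, ?_⟩
  · rw [conjTranspose_submatrix, submatrix_mul_equiv, conjTranspose_conjTranspose, hE']; simp
  · rw [conjTranspose_submatrix, conjTranspose_conjTranspose]
    have : Eᴴ.submatrix σ id * ρ * E.submatrix id σ = (Eᴴ * ρ * E).submatrix σ σ := by
      ext i j; simp [mul_apply]
    rw [this, hs']
    ext i j
    by_cases hij : i = j <;> simp [rdiag, hij]

/-- The three reduced density matrices of `ψ` are diagonal with prescribed real diagonals. -/
def DiagMarg (ψ : Fin a × Fin b × Fin c → ℂ)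
    (lam : (Fin a → ℝ) × (Fin b → ℝ) × (Fin c → ℝ)) : Prop :=
  rhoA ψ = rdiag lam.1 ∧ rhoB ψ = rdiag lam.2.1 ∧ rhoC ψ = rdiag lam.2.2

lemma mem_kronCone_of_diagMarg {ψ : Fin a × Fin b × Fin c → ℂ}
    {lam : (Fin a → ℝ) × (Fin b → ℝ) × (Fin c → ℝ)} (h : DiagMarg ψ lam)
    (hA : Antitone lam.1) (hB : Antitone lam.2.1) (hC : Antitone lam.2.2) :
    lam ∈ KronCone a b c :=
  ⟨ψ, isSpecDown_of_conj (U := 1) (by simp) (rhoA_isHermitian ψ) (by simp [h.1]) hA,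
    isSpecDown_of_conj (U := 1) (by simp) (rhoB_isHermitian ψ) (by simp [h.2.1]) hB,
    isSpecDown_of_conj (U := 1) (by simp) (rhoC_isHermitian ψ) (by simp [h.2.2]) hC⟩

lemma exists_diagMarg_of_mem_kronCone {lam : (Fin a → ℝ) × (Fin b → ℝ) × (Fin c → ℝ)}
    (h : lam ∈ KronCone a b c) : ∃ ψ : Fin a × Fin b × Fin c → ℂ, DiagMarg ψ lam := by
  obtain ⟨ψ, hA, hB, hC⟩ := h
  obtain ⟨U, hU, hU'⟩ := hA.exists_conj
  obtain ⟨V, hV, hV'⟩ := hB.exists_conj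
  obtain ⟨W, hW, hW'⟩ := hC.exists_conj
  exact ⟨tri U V W *ᵥ ψ, by rw [rhoA_tri hV hW, hU'], by rw [rhoB_tri hU hW, hV'],
    by rw [rhoC_tri hU hV, hW']⟩

end Basics

section LowerTriangular

open Matrix Kronecker

/-- Lower triangular matrices with diagonal entries `exp (r i)`. -/
def Low {d : ℕ} (r : Fin d → ℝ) (A : Matrix (Fin d) (Fin d) ℂ) : Prop :=
  (∀ i j, i < j → A i j = 0) ∧ ∀ i, A i i = (Real.exp (r i) : ℂ)

lemma Low.mul {d : ℕ} {r s : Fin d → ℝ} {A B : Matrix (Fin d) (Fin d) ℂ} (hA : Low r A)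
    (hB : Low s B) : Low (r + s) (A * B) := by
  refine ⟨fun i j hij => ?_, fun i => ?_⟩
  · rw [mul_apply]
    refine Finset.sum_eq_zero fun k _ => ?_
    rcases lt_or_ge i k with h | h
    · rw [hA.1 i k h, zero_mul]
    · rw [hB.1 k j (h.trans_lt hij), mul_zero]
  · rw [mul_apply, Finset.sum_eq_single i, hA.2, hB.2, Pi.add_apply, Real.exp_add]
    · push_cast; rfl
    · intro k _ hk
      rcases lt_or_gt_of_ne hk with h | h
      · rw [hB.1 k i h, mul_zero]
      · rw [hA.1 i k h, zero_mul]
    · simp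

lemma low_one {d : ℕ} : Low (0 : Fin d → ℝ) 1 :=
  ⟨fun i j h => one_apply_ne h.ne, fun i => by simp⟩

lemma low_transvection {d : ℕ} {i j : Fin d} (h : j < i) (τ : ℂ) :
    Low (0 : Fin d → ℝ) (1 + τ • single i j (1 : ℂ)) := by
  refine ⟨fun k l hkl => ?_, fun k => ?_⟩
  · have : ¬ (i = k ∧ j = l) := by rintro ⟨rfl, rfl⟩; exact lt_asymm h hkl
    simp [one_apply_ne hkl.ne, this]
  · have : ¬ (i = k ∧ j = k) := by rintro ⟨rfl, rfl⟩; exact lt_irrefl _ h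
    simp [this]

lemma low_scaling {d : ℕ} (i : Fin d) (s : ℝ) :
    Low (Pi.single i s) (1 + (((Real.exp s - 1 : ℝ)) : ℂ) • single i i (1 : ℂ)) := by
  refine ⟨fun k l hkl => ?_, fun k => ?_⟩
  · have : ¬ (i = k ∧ i = l) := by rintro ⟨rfl, rfl⟩; exact lt_irrefl _ hkl
    simp [one_apply_ne hkl.ne, this]
  · by_cases h : i = k
    · subst h; simp
    · simp [h]

lemma sqN_add {X : Type*} [Fintype X] (u v : X → ℂ) :
    sqN (u + v) = sqN u + sqN v + 2 * (star u ⬝ᵥ v).re := by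
  simp only [sqN, dotProduct, Complex.re_sum, Finset.mul_sum, ← Finset.sum_add_distrib]
  refine Finset.sum_congr rfl fun p _ => ?_
  simp only [Complex.sq_norm, Complex.normSq_apply, Pi.add_apply, Pi.star_apply, RCLike.star_def,
    Complex.mul_re, Complex.conj_re, Complex.conj_im, Complex.add_re, Complex.add_im]
  ring

lemma star_dotProduct_eq_zero_of_min {X : Type*} [Fintype X] {u v : X → ℂ}
    (h : ∀ τ : ℂ, sqN u ≤ sqN (u + τ • v)) : star u ⬝ᵥ v = 0 := by
  set q := star u ⬝ᵥ v with hq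
  have hv := sqN_nonneg v
  have h1 := h (((-(1 / (sqN v + 1)) : ℝ) : ℂ) * star q)
  rw [sqN_add, sqN_smul, dotProduct_smul, ← hq, smul_eq_mul, mul_assoc, RCLike.star_def,
    Complex.conj_mul', norm_mul, Complex.norm_conj, Complex.norm_real, ← Complex.ofReal_pow,
    ← Complex.ofReal_mul, Complex.ofReal_re, mul_pow, Real.norm_eq_abs, sq_abs] at h1
  set ε := 1 / (sqN v + 1) with hε
  have hε0 : 0 < ε := by positivity
  have hεN : ε * sqN v < 1 := by rw [hε, one_div, inv_mul_lt_iff₀ (by positivity)]; linarith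
  have h2 : 0 ≤ ε * ‖q‖ ^ 2 * (ε * sqN v - 2) := by nlinarith
  have h3 : ‖q‖ ^ 2 ≤ 0 := by
    by_contra hc
    push Not at hc
    have : 0 < ε * ‖q‖ ^ 2 := by positivity
    nlinarith
  have h4 : ‖q‖ = 0 := by nlinarith [norm_nonneg q]
  exact norm_eq_zero.1 h4

lemma eq_of_exp_le_sqN {X : Type*} [Fintype X] {u v : X → ℂ} {α : ℝ} (hu : sqN u = 1)
    (huv : star u ⬝ᵥ v = (sqN v : ℂ))
    (h : ∀ s : ℝ, Real.exp (2 * (α * s)) ≤ sqN (u + ((Real.exp s - 1 : ℝ) : ℂ) • v)) :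
    sqN v = α := by
  have hf : ∀ s : ℝ, 0 ≤ 1 + (Real.exp (2 * s) - 1) * sqN v - Real.exp (2 * (α * s)) := by
    intro s
    have := h s
    rw [sqN_add, sqN_smul, dotProduct_smul, huv, smul_eq_mul, ← Complex.ofReal_mul,
      Complex.ofReal_re, Complex.norm_real, Real.norm_eq_abs, sq_abs, hu] at this
    have e : Real.exp (2 * s) = Real.exp s ^ 2 := by rw [← Real.exp_nat_mul]; norm_num
    rw [e]
    nlinarith
  have hd : HasDerivAt (fun s : ℝ => 1 + (Real.exp (2 * s) - 1) * sqN v - Real.exp (2 * (α * s)))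
      (2 * sqN v - 2 * α) 0 := by
    have h1 : HasDerivAt (fun s : ℝ => Real.exp (2 * s)) (2 : ℝ) 0 := by
      simpa using ((hasDerivAt_id (0 : ℝ)).const_mul 2).exp
    have h2 : HasDerivAt (fun s : ℝ => Real.exp (2 * (α * s))) (2 * α) 0 := by
      simpa using (((hasDerivAt_id (0 : ℝ)).const_mul α).const_mul 2).exp
    exact (((h1.sub_const 1).mul_const (sqN v)).const_add 1).sub h2
  have hm : IsLocalMin
      (fun s : ℝ => 1 + (Real.exp (2 * s) - 1) * sqN v - Real.exp (2 * (α * s))) 0 :=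
    Filter.Eventually.of_forall fun s => by simpa using hf s
  have := hm.hasDerivAt_eq_zero hd
  linarith

variable {a b c : ℕ}

/-- The pairing of a weight with the logarithms of the diagonal entries. -/
def pair3 (ω : (Fin a → ℝ) × (Fin b → ℝ) × (Fin c → ℝ)) (r : Fin a → ℝ) (s : Fin b → ℝ)
    (t : Fin c → ℝ) : ℝ := ω.1 ⬝ᵥ r + ω.2.1 ⬝ᵥ s + ω.2.2 ⬝ᵥ t

lemma pair3_add (ω : (Fin a → ℝ) × (Fin b → ℝ) × (Fin c → ℝ)) (r r' : Fin a → ℝ)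
    (s s' : Fin b → ℝ) (t t' : Fin c → ℝ) :
    pair3 ω (r + r') (s + s') (t + t') = pair3 ω r s t + pair3 ω r' s' t' := by
  simp only [pair3, dotProduct_add]; ring

/-- The norm of `ψ` along its orbit under the lower triangular group is bounded below by the
character of weight `ω`. -/
def Semi (ω : (Fin a → ℝ) × (Fin b → ℝ) × (Fin c → ℝ)) (κ : ℝ)
    (ψ : Fin a × Fin b × Fin c → ℂ) : Prop :=
  ∀ r s t A B C, Low r A → Low s B → Low t C →
    Real.exp (κ + 2 * pair3 ω r s t) ≤ sqN (tri A B C *ᵥ ψ)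

lemma continuous_pair3 (r : Fin a → ℝ) (s : Fin b → ℝ) (t : Fin c → ℝ) :
    Continuous fun ω : (Fin a → ℝ) × (Fin b → ℝ) × (Fin c → ℝ) => pair3 ω r s t := by
  unfold pair3 dotProduct; fun_prop

lemma continuous_mulVec_const {X : Type*} [Fintype X] (M : Matrix X X ℂ) :
    Continuous fun ψ : X → ℂ => M *ᵥ ψ := by
  fun_prop

lemma Semi.of_tendsto {ω : ℕ → (Fin a → ℝ) × (Fin b → ℝ) × (Fin c → ℝ)} {κ : ℕ → ℝ}
    {ψ : ℕ → Fin a × Fin b × Fin c → ℂ} {ω' κ' ψ'} (h : ∀ j, Semi (ω j) (κ j) (ψ j))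
    (hω : Filter.Tendsto ω Filter.atTop (nhds ω')) (hκ : Filter.Tendsto κ Filter.atTop (nhds κ'))
    (hψ : Filter.Tendsto ψ Filter.atTop (nhds ψ')) : Semi ω' κ' ψ' := by
  intro r s t A B C hA hB hC
  refine le_of_tendsto_of_tendsto' (b := Filter.atTop) ?_ ?_ fun j => h j r s t A B C hA hB hC
  · exact (Real.continuous_exp.tendsto _).comp
      (hκ.add ((((continuous_pair3 r s t).tendsto _).comp hω).const_mul 2))
  · exact (continuous_sqN.tendsto _).comp (((continuous_mulVec_const _).tendsto _).comp hψ)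

lemma isCompact_sqN_eq_one {X : Type*} [Fintype X] : IsCompact {ψ : X → ℂ | sqN ψ = 1} := by
  refine Metric.isCompact_of_isClosed_isBounded (isClosed_eq continuous_sqN continuous_const) ?_
  refine (Metric.isBounded_closedBall (x := (0 : X → ℂ)) (r := 1)).subset fun ψ hψ => ?_
  rw [mem_closedBall_zero_iff, pi_norm_le_iff_of_nonneg zero_le_one]
  intro p
  have h1 : ‖ψ p‖ ^ 2 ≤ sqN ψ :=
    Finset.single_le_sum (f := fun p => ‖ψ p‖ ^ 2) (fun _ _ => by positivity) (Finset.mem_univ p)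
  change sqN ψ = 1 at hψ
  nlinarith [norm_nonneg (ψ p)]

lemma Semi.exists_unit {ω : (Fin a → ℝ) × (Fin b → ℝ) × (Fin c → ℝ)} {κ : ℝ}
    {ψ : Fin a × Fin b × Fin c → ℂ} (h : Semi ω κ ψ) : ∃ ψ', sqN ψ' = 1 ∧ Semi ω 0 ψ' := by
  let S : Set ℝ := {x | ∃ r s t A B C, Low r A ∧ Low s B ∧ Low t C ∧
    x = sqN (tri A B C *ᵥ ψ) * Real.exp (-(2 * pair3 ω r s t))}
  have hlow : ∀ x ∈ S, Real.exp κ ≤ x := by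
    rintro _ ⟨r, s, t, A, B, C, hA, hB, hC, rfl⟩
    have := h r s t A B C hA hB hC
    rw [Real.exp_neg, ← div_eq_mul_inv, le_div_iff₀ (Real.exp_pos _), ← Real.exp_add]
    exact this
  have hbdd : BddBelow S := ⟨_, hlow⟩
  have hne : S.Nonempty := ⟨_, 0, 0, 0, 1, 1, 1, low_one, low_one, low_one, rfl⟩
  set m := sInf S with hm
  have hm0 : 0 < m := (Real.exp_pos κ).trans_le (le_csInf hne hlow)
  have hex : ∀ j : ℕ, ∃ ψ', sqN ψ' = 1 ∧ Semi ω (-(1 / ((j : ℝ) + 1))) ψ' := by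
    intro j
    have hj : (0 : ℝ) < 1 / ((j : ℝ) + 1) := by positivity
    obtain ⟨x, ⟨r, s, t, A, B, C, hA, hB, hC, rfl⟩, hx⟩ :=
      exists_lt_of_csInf_lt hne (show sInf S < m * Real.exp (1 / ((j : ℝ) + 1)) from
        (lt_mul_iff_one_lt_right hm0).2 (Real.one_lt_exp_iff.2 hj))
    set N := sqN (tri A B C *ᵥ ψ) with hN
    have hN0 : 0 < N := (Real.exp_pos _).trans_le (h r s t A B C hA hB hC)
    have hsc : ∀ φ : Fin a × Fin b × Fin c → ℂ,
        sqN ((((Real.sqrt N)⁻¹ : ℝ) : ℂ) • φ) = sqN φ / N := by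
      intro φ
      rw [sqN_smul, Complex.norm_real, Real.norm_eq_abs, sq_abs, inv_pow, Real.sq_sqrt hN0.le]
      field_simp
    refine ⟨(((Real.sqrt N)⁻¹ : ℝ) : ℂ) • (tri A B C *ᵥ ψ), ?_, ?_⟩
    · rw [hsc, div_self hN0.ne']
    · intro r' s' t' A' B' C' hA' hB' hC'
      rw [mulVec_smul, hsc, le_div_iff₀ hN0, mulVec_mulVec, tri_mul]
      have h1 : m ≤ sqN (tri (A' * A) (B' * B) (C' * C) *ᵥ ψ) *
          Real.exp (-(2 * pair3 ω (r' + r) (s' + s) (t' + t))) :=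
        csInf_le hbdd ⟨_, _, _, _, _, _, hA'.mul hA, hB'.mul hB, hC'.mul hC, rfl⟩
      rw [Real.exp_neg, ← div_eq_mul_inv, le_div_iff₀ (Real.exp_pos _), pair3_add] at h1
      refine le_trans ?_ h1
      rw [Real.exp_neg, ← div_eq_mul_inv, div_lt_iff₀ (Real.exp_pos _)] at hx
      calc _ ≤ Real.exp (-(1 / ((j : ℝ) + 1)) + 2 * pair3 ω r' s' t') *
            (m * Real.exp (1 / ((j : ℝ) + 1)) * Real.exp (2 * pair3 ω r s t)) := by gcongr
        _ = m * Real.exp (2 * (pair3 ω r' s' t' + pair3 ω r s t)) := by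
          rw [mul_assoc, mul_left_comm, ← Real.exp_add, ← Real.exp_add]
          congr 2; ring
  choose φ hφ1 hφ2 using hex
  obtain ⟨ψ', hψ', σ, hσ, hlim⟩ := isCompact_sqN_eq_one.tendsto_subseq (x := φ) hφ1
  refine ⟨ψ', hψ', Semi.of_tendsto (fun j => hφ2 (σ j)) tendsto_const_nhds ?_ hlim⟩
  have := (tendsto_one_div_add_atTop_nhds_zero_nat (𝕜 := ℝ)).neg.comp hσ.tendsto_atTop
  simpa [Function.comp_def] using this

lemma eq_rdiag_of_entries {d : ℕ} {ρ : Matrix (Fin d) (Fin d) ℂ} (hρ : ρ.IsHermitian)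
    {l : Fin d → ℝ} (h : ∀ i j, j < i → ρ j i = 0) (h' : ∀ i, ρ i i = l i) : ρ = rdiag l := by
  ext i j
  rcases lt_trichotomy i j with hij | rfl | hij
  · rw [h j i hij, rdiag, diagonal_apply_ne _ hij.ne]
  · rw [h', rdiag, diagonal_apply_eq]
  · rw [← hρ.apply, h i j hij, star_zero, rdiag, diagonal_apply_ne _ hij.ne']

lemma sqN_mulVec_of_proj {X : Type*} [Fintype X] {P : Matrix X X ℂ} (hP : Pᴴ * P = P) (u : X → ℂ) :
    star u ⬝ᵥ (P *ᵥ u) = (sqN (P *ᵥ u) : ℂ) := by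
  rw [ofReal_sqN, star_mulVec, ← dotProduct_mulVec, mulVec_mulVec, hP]

lemma Semi.diagMarg {ω : (Fin a → ℝ) × (Fin b → ℝ) × (Fin c → ℝ)}
    {ψ : Fin a × Fin b × Fin c → ℂ} (h : Semi ω 0 ψ) (h1 : sqN ψ = 1) : DiagMarg ψ ω := by
  have tA : ∀ (τ : ℂ) (E : Matrix (Fin a) (Fin a) ℂ),
      tri (1 + τ • E) (1 : Matrix (Fin b) (Fin b) ℂ) (1 : Matrix (Fin c) (Fin c) ℂ) *ᵥ ψ
      = ψ + τ • (tri E 1 1 *ᵥ ψ) := by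
    intro τ E
    have : tri (1 + τ • E) (1 : Matrix (Fin b) (Fin b) ℂ) (1 : Matrix (Fin c) (Fin c) ℂ)
        = tri 1 1 1 + τ • tri E 1 1 := by
      ext p q; simp only [tri_apply, Matrix.add_apply, Matrix.smul_apply, smul_eq_mul]; ring
    rw [this, tri_one, add_mulVec, one_mulVec, smul_mulVec]
  have tB : ∀ (τ : ℂ) (E : Matrix (Fin b) (Fin b) ℂ),
      tri (1 : Matrix (Fin a) (Fin a) ℂ) (1 + τ • E) (1 : Matrix (Fin c) (Fin c) ℂ) *ᵥ ψ
      = ψ + τ • (tri 1 E 1 *ᵥ ψ) := by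
    intro τ E
    have : tri (1 : Matrix (Fin a) (Fin a) ℂ) (1 + τ • E) (1 : Matrix (Fin c) (Fin c) ℂ)
        = tri 1 1 1 + τ • tri 1 E 1 := by
      ext p q; simp only [tri_apply, Matrix.add_apply, Matrix.smul_apply, smul_eq_mul]; ring
    rw [this, tri_one, add_mulVec, one_mulVec, smul_mulVec]
  have tC : ∀ (τ : ℂ) (E : Matrix (Fin c) (Fin c) ℂ),
      tri (1 : Matrix (Fin a) (Fin a) ℂ) (1 : Matrix (Fin b) (Fin b) ℂ) (1 + τ • E) *ᵥ ψ
      = ψ + τ • (tri 1 1 E *ᵥ ψ) := by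
    intro τ E
    have : tri (1 : Matrix (Fin a) (Fin a) ℂ) (1 : Matrix (Fin b) (Fin b) ℂ) (1 + τ • E)
        = tri 1 1 1 + τ • tri 1 1 E := by
      ext p q; simp only [tri_apply, Matrix.add_apply, Matrix.smul_apply, smul_eq_mul]; ring
    rw [this, tri_one, add_mulVec, one_mulVec, smul_mulVec]
  have pr : ∀ {d : ℕ} (i : Fin d), (single i i (1 : ℂ))ᴴ * single i i (1 : ℂ) = single i i 1 := by
    intro d i; simp [conjTranspose_single]
  refine ⟨eq_rdiag_of_entries (rhoA_isHermitian ψ) (fun i j hij => ?_) fun i => ?_,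
    eq_rdiag_of_entries (rhoB_isHermitian ψ) (fun i j hij => ?_) fun i => ?_,
    eq_rdiag_of_entries (rhoC_isHermitian ψ) (fun i j hij => ?_) fun i => ?_⟩
  · have := star_dotProduct_eq_zero_of_min (u := ψ) (v := tri (single i j 1) 1 1 *ᵥ ψ) fun τ => by
      have := h 0 0 0 _ _ _ (low_transvection hij τ) low_one low_one
      rw [tA] at this
      simpa [h1, pair3] using this
    rw [expect_fst, trace_single_mul] at this
    simpa using this
  · have hP : (tri (single i i (1 : ℂ)) (1 : Matrix (Fin b) (Fin b) ℂ)
        (1 : Matrix (Fin c) (Fin c) ℂ))ᴴ * tri (single i i 1) 1 1 = tri (single i i 1) 1 1 := by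
      rw [tri_conjTranspose, tri_mul, pr]; simp
    have e := sqN_mulVec_of_proj hP ψ
    have := eq_of_exp_le_sqN (α := ω.1 i) h1 e fun s => by
      have := h _ _ _ _ _ _ (low_scaling i s) low_one low_one
      rw [tA] at this
      simpa [pair3] using this
    rw [expect_fst, trace_single_mul, this] at e
    simpa using e
  · have := star_dotProduct_eq_zero_of_min (u := ψ) (v := tri 1 (single i j 1) 1 *ᵥ ψ) fun τ => by
      have := h 0 0 0 _ _ _ low_one (low_transvection hij τ) low_one
      rw [tB] at this
      simpa [h1, pair3] using this
    rw [expect_snd, trace_single_mul] at this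
    simpa using this
  · have hP : (tri (1 : Matrix (Fin a) (Fin a) ℂ) (single i i (1 : ℂ))
        (1 : Matrix (Fin c) (Fin c) ℂ))ᴴ * tri 1 (single i i 1) 1 = tri 1 (single i i 1) 1 := by
      rw [tri_conjTranspose, tri_mul, pr]; simp
    have e := sqN_mulVec_of_proj hP ψ
    have := eq_of_exp_le_sqN (α := ω.2.1 i) h1 e fun s => by
      have := h _ _ _ _ _ _ low_one (low_scaling i s) low_one
      rw [tB] at this
      simpa [pair3] using this
    rw [expect_snd, trace_single_mul, this] at e
    simpa using e
  · have := star_dotProduct_eq_zero_of_min (u := ψ) (v := tri 1 1 (single i j 1) *ᵥ ψ) fun τ => by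
      have := h 0 0 0 _ _ _ low_one low_one (low_transvection hij τ)
      rw [tC] at this
      simpa [h1, pair3] using this
    rw [expect_trd, trace_single_mul] at this
    simpa using this
  · have hP : (tri (1 : Matrix (Fin a) (Fin a) ℂ) (1 : Matrix (Fin b) (Fin b) ℂ)
        (single i i (1 : ℂ)))ᴴ * tri 1 1 (single i i 1) = tri 1 1 (single i i 1) := by
      rw [tri_conjTranspose, tri_mul, pr]; simp
    have e := sqN_mulVec_of_proj hP ψ
    have := eq_of_exp_le_sqN (α := ω.2.2 i) h1 e fun s => by
      have := h _ _ _ _ _ _ low_one low_one (low_scaling i s)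
      rw [tC] at this
      simpa [pair3] using this
    rw [expect_trd, trace_single_mul, this] at e
    simpa using e

end LowerTriangular

section InvariantSubspace

open Matrix

lemma ofReal_sqN_uncurry {X : Type*} [Fintype X] (T : Matrix X X ℂ) :
    ((sqN (fun p : X × X => T p.1 p.2) : ℝ) : ℂ) = (Tᴴ * T).trace := by
  rw [ofReal_sqN, trace, dotProduct, Fintype.sum_prod_type, Finset.sum_comm]
  simp [mul_apply]

lemma sqN_uncurry_conj {X : Type*} [Fintype X] [DecidableEq X] {k : Matrix X X ℂ} (hk : kᴴ * k = 1) (T : Matrix X X ℂ) :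
    sqN (fun p : X × X => (k * T * kᴴ) p.1 p.2) = sqN (fun p : X × X => T p.1 p.2) := by
  have : ((sqN (fun p : X × X => (k * T * kᴴ) p.1 p.2) : ℝ) : ℂ)
      = ((sqN (fun p : X × X => T p.1 p.2) : ℝ) : ℂ) := by
    rw [ofReal_sqN_uncurry, ofReal_sqN_uncurry]
    have e : (k * T * kᴴ)ᴴ * (k * T * kᴴ) = k * (Tᴴ * T * kᴴ) := by
      simp only [conjTranspose_mul, conjTranspose_conjTranspose, Matrix.mul_assoc]
      rw [← Matrix.mul_assoc kᴴ k, hk, Matrix.one_mul]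
    rw [e, trace_mul_comm, Matrix.mul_assoc, hk, Matrix.mul_one]
  exact_mod_cast this

lemma isCompact_sqN_le {Y : Type*} [Fintype Y] (R : ℝ) : IsCompact {v : Y → ℂ | sqN v ≤ R} := by
  refine Metric.isCompact_of_isClosed_isBounded (isClosed_le continuous_sqN continuous_const) ?_
  refine (Metric.isBounded_closedBall (x := (0 : Y → ℂ)) (r := Real.sqrt R)).subset fun ψ hψ => ?_
  rw [mem_closedBall_zero_iff, pi_norm_le_iff_of_nonneg (Real.sqrt_nonneg _)]
  intro p
  have h1 : ‖ψ p‖ ^ 2 ≤ sqN ψ :=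
    Finset.single_le_sum (f := fun p => ‖ψ p‖ ^ 2) (fun _ _ => by positivity) (Finset.mem_univ p)
  exact Real.le_sqrt_of_sq_le (h1.trans hψ)

lemma exists_unique_min_sqN {Y : Type*} [Fintype Y] {K : Set (Y → ℂ)} (hK : IsClosed K)
    (hne : K.Nonempty) (hmid : ∀ u ∈ K, ∀ v ∈ K, (1 / 2 : ℂ) • (u + v) ∈ K) :
    ∃ u ∈ K, ∀ v ∈ K, sqN v ≤ sqN u → v = u := by
  obtain ⟨w, hw⟩ := hne
  obtain ⟨u, ⟨hu, huw⟩, hmin⟩ := ((isCompact_sqN_le (sqN w)).inter_left hK).exists_isMinOn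
    ⟨w, hw, le_refl (sqN w)⟩ continuous_sqN.continuousOn
  have hmin' : ∀ v ∈ K, sqN u ≤ sqN v := by
    intro v hv
    by_cases h : sqN v ≤ sqN w
    · exact hmin ⟨hv, h⟩
    · exact le_trans huw (le_of_not_ge h)
  refine ⟨u, hu, fun v hv hvu => ?_⟩
  have h1 := hmin' _ (hmid u hu v hv)
  have h2 : sqN (u + v) + sqN (u - v) = 2 * sqN u + 2 * sqN v := by
    rw [sub_eq_add_neg, sqN_add, sqN_add]
    have : sqN (-v) = sqN v := by simp [sqN]
    rw [this, dotProduct_neg, Complex.neg_re]; ring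
  rw [sqN_smul] at h1
  norm_num at h1
  have h3 : sqN (u - v) = 0 := by
    have := sqN_nonneg (u - v)
    linarith
  exact (sub_eq_zero.1 (sqN_eq_zero.1 h3)).symm

lemma exists_invariant_submodule {X : Type*} [Fintype X] [DecidableEq X]
    {G : Set (Matrix X X ℂ)} (hun : ∀ k ∈ G, kᴴ * k = 1)
    (hone : 1 ∈ G) (hmul : ∀ k ∈ G, ∀ l ∈ G, k * l ∈ G)
    {φ : X → ℂ} (hφ : sqN φ = 1) {S : Submodule ℂ (X → ℂ)} (hφS : φ ∈ S)
    (hS : ∀ k ∈ G, ∀ v ∈ S, k *ᵥ v ∈ S) :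
    ∃ V : Submodule ℂ (X → ℂ), V ≠ ⊥ ∧ (∀ k ∈ G, ∀ v ∈ V, k *ᵥ v ∈ V) ∧
      ∀ P ∈ V, P ≠ 0 → ∃ k ∈ G,
        sqN P / (2 * Module.finrank ℂ S) ≤ ‖star P ⬝ᵥ (k *ᵥ φ)‖ ^ 2 := by
  let toM : (X × X → ℂ) → Matrix X X ℂ := fun T => of fun x y => T (x, y)
  have toM_add : ∀ u v, toM (u + v) = toM u + toM v := fun u v => rfl
  have toM_smul : ∀ (r : ℂ) u, toM (r • u) = r • toM u := fun r u => rfl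
  have hcont : Continuous toM := by
    refine continuous_matrix fun x y => ?_
    exact continuous_apply (x, y)
  let K : Set (X × X → ℂ) := {T | (toM T)ᴴ = toM T ∧ (toM T).trace = 1 ∧
    (∀ v, toM T *ᵥ v ∈ S) ∧
    ∀ (P : X → ℂ) (m : ℝ), (∀ k ∈ G, ‖star P ⬝ᵥ (k *ᵥ φ)‖ ^ 2 ≤ m) →
      (star P ⬝ᵥ (toM T *ᵥ P)).re ≤ m}
  have hclosed : IsClosed K := by
    have c1 : IsClosed {T | ∀ v, toM T *ᵥ v ∈ S} := by
      simp only [Set.ofPred_forall]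
      exact isClosed_iInter fun v => (Submodule.closed_of_finiteDimensional S).preimage
        (hcont.matrix_mulVec continuous_const)
    have c2 : IsClosed {T | ∀ (P : X → ℂ) (m : ℝ), (∀ k ∈ G, ‖star P ⬝ᵥ (k *ᵥ φ)‖ ^ 2 ≤ m) →
        (star P ⬝ᵥ (toM T *ᵥ P)).re ≤ m} := by
      simp only [Set.ofPred_forall]
      refine isClosed_iInter fun P => isClosed_iInter fun m => isClosed_iInter fun _ =>
        isClosed_le (Complex.continuous_re.comp ?_) continuous_const
      exact Continuous.dotProduct continuous_const (hcont.matrix_mulVec continuous_const)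
    exact (isClosed_eq hcont.matrix_conjTranspose hcont).inter
      ((isClosed_eq hcont.matrix_trace continuous_const).inter (c1.inter c2))
  have hne : K.Nonempty := by
    refine ⟨fun p => φ p.1 * star (φ p.2), ?_, ?_, ?_, ?_⟩
    · ext x y; simp [toM, mul_comm]
    · have h := ofReal_sqN φ
      rw [hφ] at h
      simp only [toM, trace, diag, of_apply]
      rw [dotProduct] at h
      simpa [mul_comm] using h.symm
    · intro v
      have : toM (fun p => φ p.1 * star (φ p.2)) *ᵥ v = (star φ ⬝ᵥ v) • φ := by
        ext x
        simp only [toM, mulVec, dotProduct, of_apply, Pi.smul_apply, smul_eq_mul, Pi.star_apply,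
          Finset.sum_mul]
        exact Finset.sum_congr rfl fun _ _ => by ring
      rw [this]
      exact S.smul_mem _ hφS
    · intro P m hm
      have : toM (fun p => φ p.1 * star (φ p.2)) *ᵥ P = (star φ ⬝ᵥ P) • φ := by
        ext x
        simp only [toM, mulVec, dotProduct, of_apply, Pi.smul_apply, smul_eq_mul, Pi.star_apply,
          Finset.sum_mul]
        exact Finset.sum_congr rfl fun _ _ => by ring
      have h2 : star φ ⬝ᵥ P = star (star P ⬝ᵥ φ) := by rw [star_dotProduct]
      rw [this, dotProduct_smul, h2, smul_eq_mul, RCLike.star_def, Complex.conj_mul',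
        ← Complex.ofReal_pow, Complex.ofReal_re]
      simpa using hm 1 hone
  have hmid : ∀ u ∈ K, ∀ v ∈ K, (1 / 2 : ℂ) • (u + v) ∈ K := by
    rintro u ⟨hu1, hu2, hu3, hu4⟩ v ⟨hv1, hv2, hv3, hv4⟩
    refine ⟨?_, ?_, fun w => ?_, fun P m hm => ?_⟩
    · rw [toM_smul, toM_add, conjTranspose_smul, conjTranspose_add, hu1, hv1]; simp
    · rw [toM_smul, toM_add, trace_smul, trace_add, hu2, hv2]; norm_num
    · rw [toM_smul, toM_add, smul_mulVec, add_mulVec]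
      exact S.smul_mem _ (S.add_mem (hu3 w) (hv3 w))
    · rw [toM_smul, toM_add, smul_mulVec, add_mulVec, dotProduct_smul, dotProduct_add]
      have h1 := hu4 P m hm
      have h2 := hv4 P m hm
      have : (1 / 2 : ℂ) = ((1 / 2 : ℝ) : ℂ) := by norm_num
      rw [this, smul_eq_mul, Complex.re_ofReal_mul, Complex.add_re]
      linarith
  obtain ⟨u, ⟨hu1, hu2, hu3, hu4⟩, huniq⟩ := exists_unique_min_sqN hclosed hne hmid
  set T := toM u with hT
  have hcomm : ∀ k ∈ G, T * k = k * T := by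
    intro k hk
    have h1 : (fun p : X × X => (k * T * kᴴ) p.1 p.2) = u := by
      refine huniq _ ⟨?_, ?_, fun v => ?_, fun P m hm => ?_⟩ (sqN_uncurry_conj (hun k hk) T).le
      · change (k * T * kᴴ)ᴴ = k * T * kᴴ
        simp only [conjTranspose_mul, conjTranspose_conjTranspose, hu1, Matrix.mul_assoc]
      · change (k * T * kᴴ).trace = 1
        rw [trace_mul_comm, ← Matrix.mul_assoc, hun k hk, Matrix.one_mul, hu2]
      · change (k * T * kᴴ) *ᵥ v ∈ S
        rw [← mulVec_mulVec, ← mulVec_mulVec]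
        exact hS k hk _ (hu3 _)
      · change (star P ⬝ᵥ ((k * T * kᴴ) *ᵥ P)).re ≤ m
        have e := expect_conj T kᴴ P
        rw [conjTranspose_conjTranspose] at e
        rw [← e]
        refine hu4 _ m fun l hl => ?_
        rw [star_mulVec, conjTranspose_conjTranspose, ← dotProduct_mulVec, mulVec_mulVec]
        exact hm _ (hmul k hk l hl)
    have h2 : k * T * kᴴ = T := by
      ext x y; exact congrFun h1 (x, y)
    calc T * k = k * T * kᴴ * k := by rw [h2]
      _ = k * T := by rw [Matrix.mul_assoc, hun k hk, Matrix.mul_one]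
  have hH : T.IsHermitian := hu1
  have hrank : T.rank ≤ Module.finrank ℂ S := by
    refine Submodule.finrank_mono ?_
    rintro _ ⟨v, rfl⟩
    exact hu3 v
  have hsum : ∑ i, hH.eigenvalues i = 1 := by
    have := hH.trace_eq_sum_eigenvalues
    rw [hu2] at this
    simpa using (congrArg Complex.re this).symm
  set D := Module.finrank ℂ S with hD
  have hex : ∃ i, 1 / (D : ℝ) ≤ hH.eigenvalues i ∧ 0 < hH.eigenvalues i := by
    by_contra! hcon
    have hc : T.rank = (Finset.univ.filter fun i => hH.eigenvalues i ≠ 0).card := by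
      rw [hH.rank_eq_card_non_zero_eigs, Fintype.card_subtype]
    have hs : ∑ i ∈ Finset.univ.filter (fun i => hH.eigenvalues i ≠ 0), hH.eigenvalues i = 1 := by
      rw [Finset.sum_filter_ne_zero, hsum]
    have hne' : (Finset.univ.filter fun i => hH.eigenvalues i ≠ 0).Nonempty := by
      by_contra h0
      rw [Finset.not_nonempty_iff_eq_empty] at h0
      rw [h0] at hs; simp at hs
    have hD0 : 0 < D := by
      have := Finset.card_pos.2 hne'
      omega
    have hlt : ∀ i ∈ Finset.univ.filter (fun i => hH.eigenvalues i ≠ 0),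
        hH.eigenvalues i < 1 / (D : ℝ) := by
      intro i _
      by_contra h1
      push Not at h1
      have h2 := hcon i h1
      have : 0 < 1 / (D : ℝ) := by positivity
      linarith
    have h3 := Finset.sum_lt_sum_of_nonempty hne' hlt
    rw [hs, Finset.sum_const, ← hc, nsmul_eq_mul, mul_one_div, lt_div_iff₀ (by positivity),
      one_mul] at h3
    have : (T.rank : ℝ) ≤ D := by exact_mod_cast hrank
    linarith
  obtain ⟨i, hi, hi0⟩ := hex
  set θ := hH.eigenvalues i with hθ
  refine ⟨Module.End.eigenspace (toLin' T) (θ : ℂ), ?_, ?_, ?_⟩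
  · intro hbot
    have hv := hH.mulVec_eigenvectorBasis i
    have : (hH.eigenvectorBasis i).ofLp ∈ Module.End.eigenspace (toLin' T) (θ : ℂ) := by
      rw [Module.End.mem_eigenspace_iff, toLin'_apply]
      exact hv
    rw [hbot, Submodule.mem_bot] at this
    have h2 := hH.eigenvectorBasis.toBasis.ne_zero i
    rw [OrthonormalBasis.coe_toBasis] at h2
    exact h2 (by ext x; exact congrFun this x)
  · intro k hk v hv
    rw [Module.End.mem_eigenspace_iff, toLin'_apply] at hv ⊢
    rw [mulVec_mulVec, hcomm k hk, ← mulVec_mulVec, hv, mulVec_smul]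
  · intro P hP hP0
    rw [Module.End.mem_eigenspace_iff, toLin'_apply] at hP
    by_contra! hcon
    have h1 := hu4 P _ fun k hk => (hcon k hk).le
    rw [hP, dotProduct_smul, ← ofReal_sqN, smul_eq_mul, ← Complex.ofReal_mul,
      Complex.ofReal_re] at h1
    have hp := sqN_pos hP0
    have h2 : 1 / (D : ℝ) * sqN P ≤ θ * sqN P := by gcongr
    have h3 : sqN P / (2 * D) = 1 / (D : ℝ) * sqN P / 2 := by ring
    have h4 : 0 < θ * sqN P := by positivity
    rw [h3] at h1
    linarith

end InvariantSubspace

section TensorPowers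

open Matrix

variable {ι : Type*}

/-- The `n`-th Kronecker power of a matrix. -/
def pw (n : ℕ) (M : Matrix ι ι ℂ) : Matrix (Fin n → ι) (Fin n → ι) ℂ :=
  of fun x y => ∏ t, M (x t) (y t)

/-- The `n`-th tensor power of a vector. -/
def tp (n : ℕ) (ψ : ι → ℂ) : (Fin n → ι) → ℂ := fun x => ∏ t, ψ (x t)

lemma pw_apply (n : ℕ) (M : Matrix ι ι ℂ) (x y : Fin n → ι) :
    pw n M x y = ∏ t, M (x t) (y t) := rfl

lemma pw_diagonal [DecidableEq ι] (n : ℕ) (z : ι → ℂ) :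
    pw n (diagonal z) = diagonal (tp n z) := by
  ext x y
  by_cases h : x = y
  · subst h; simp [pw_apply, tp]
  · obtain ⟨t, ht⟩ := Function.ne_iff.1 h
    rw [diagonal_apply_ne _ h, pw_apply]
    exact Finset.prod_eq_zero (Finset.mem_univ t) (diagonal_apply_ne _ ht)

lemma pw_one [DecidableEq ι] (n : ℕ) : pw n (1 : Matrix ι ι ℂ) = 1 := by
  rw [← diagonal_one, pw_diagonal, ← diagonal_one]
  congr 1
  ext x; simp [tp]

lemma pw_conjTranspose (n : ℕ) (M : Matrix ι ι ℂ) : (pw n M)ᴴ = pw n Mᴴ := by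
  ext x y
  simp [pw_apply, conjTranspose_apply]

variable [Fintype ι]

lemma sum_prod_pi {R : Type*} [CommRing R] (n : ℕ) (f : Fin n → ι → R) :
    ∑ y : Fin n → ι, ∏ t, f t (y t) = ∏ t, ∑ i, f t i := by
  classical
  rw [Finset.prod_univ_sum, Fintype.piFinset_univ]

lemma pw_mul (n : ℕ) (M N : Matrix ι ι ℂ) : pw n M * pw n N = pw n (M * N) := by
  ext x z
  simp only [mul_apply, pw_apply, ← Finset.prod_mul_distrib]
  exact sum_prod_pi n fun t i => M (x t) i * N i (z t)

lemma pw_mulVec_tp (n : ℕ) (M : Matrix ι ι ℂ) (ψ : ι → ℂ) :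
    pw n M *ᵥ tp n ψ = tp n (M *ᵥ ψ) := by
  ext x
  simp only [mulVec, dotProduct, pw_apply, tp, ← Finset.prod_mul_distrib]
  exact sum_prod_pi n fun t i => M (x t) i * ψ i

lemma sqN_tp (n : ℕ) (ψ : ι → ℂ) : sqN (tp n ψ) = sqN ψ ^ n := by
  simp only [sqN, tp, norm_prod, ← Finset.prod_pow]
  rw [sum_prod_pi n fun _ i => ‖ψ i‖ ^ 2]
  simp

/-- The number of positions at which `x` has the value `i`. -/
def cnt {n : ℕ} {κ : Type*} [DecidableEq κ] (x : Fin n → κ) (i : κ) : ℕ :=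
  (Finset.univ.filter fun t => x t = i).card

lemma cnt_le {n : ℕ} {κ : Type*} [DecidableEq κ] (x : Fin n → κ) (i : κ) : cnt x i ≤ n :=
  (Finset.card_le_univ _).trans_eq (Fintype.card_fin n)

lemma prod_comp_eq_prod_pow_cnt {n : ℕ} {κ : Type*} [Fintype κ] [DecidableEq κ] {R : Type*}
    [CommMonoid R] (z : κ → R) (x : Fin n → κ) : ∏ t, z (x t) = ∏ i, z i ^ cnt x i := by
  rw [← Finset.prod_fiberwise (s := Finset.univ) (g := x)]
  refine Finset.prod_congr rfl fun i _ => ?_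
  rw [Finset.prod_congr rfl (g := fun _ => z i) fun t ht => by rw [(Finset.mem_filter.1 ht).2],
    Finset.prod_const, cnt]

lemma sum_comp_eq_sum_mul_cnt {n : ℕ} {κ : Type*} [Fintype κ] [DecidableEq κ] (z : κ → ℕ)
    (x : Fin n → κ) : ∑ t, z (x t) = ∑ i, cnt x i * z i := by
  rw [← Finset.sum_fiberwise (s := Finset.univ) (g := x)]
  refine Finset.sum_congr rfl fun i _ => ?_
  rw [Finset.sum_congr rfl (g := fun _ => z i) fun t ht => by rw [(Finset.mem_filter.1 ht).2],
    Finset.sum_const, cnt, smul_eq_mul]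

lemma finrank_span_tp_le (n : ℕ) :
    Module.finrank ℂ (Submodule.span ℂ (Set.range (tp (ι := ι) n))) ≤
      (n + 1) ^ Fintype.card ι := by
  classical
  let f : (Fin n → ι) → (ι → Fin (n + 1)) := fun x i => ⟨cnt x i, Nat.lt_succ_of_le (cnt_le x i)⟩
  have h : Submodule.span ℂ (Set.range (tp (ι := ι) n)) ≤
      LinearMap.range (LinearMap.funLeft ℂ ℂ f) := by
    rw [Submodule.span_le]
    rintro _ ⟨ψ, rfl⟩
    refine ⟨fun k => ∏ i, ψ i ^ (k i : ℕ), ?_⟩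
    ext x
    simp only [LinearMap.funLeft_apply, tp, prod_comp_eq_prod_pow_cnt, f]
  refine (Submodule.finrank_mono h).trans ((LinearMap.finrank_range_le _).trans_eq ?_)
  simp

lemma pw_mulVec_mem_span_tp (n : ℕ) (M : Matrix ι ι ℂ) {v : (Fin n → ι) → ℂ}
    (hv : v ∈ Submodule.span ℂ (Set.range (tp (ι := ι) n))) :
    pw n M *ᵥ v ∈ Submodule.span ℂ (Set.range (tp (ι := ι) n)) := by
  induction hv using Submodule.span_induction with
  | mem x hx =>
    obtain ⟨ψ, rfl⟩ := hx
    rw [pw_mulVec_tp]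
    exact Submodule.subset_span ⟨_, rfl⟩
  | zero => rw [mulVec_zero]; exact Submodule.zero_mem _
  | add x y _ _ hx hy => rw [mulVec_add]; exact Submodule.add_mem _ hx hy
  | smul r x _ hx => rw [mulVec_smul]; exact Submodule.smul_mem _ _ hx

end TensorPowers

section Complexification

open Matrix

variable {ι : Type*} [Fintype ι] [DecidableEq ι] {n d : ℕ}

/-- A multiplicative family of matrices acting through one tensor factor, whose index is read off
by `idx`. -/
structure IsLeg (F : Matrix (Fin d) (Fin d) ℂ → Matrix ι ι ℂ) (idx : ι → Fin d) : Prop where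
  map_mul : ∀ A B, F (A * B) = F A * F B
  map_diagonal : ∀ z : Fin d → ℂ, F (diagonal z) = diagonal (z ∘ idx)

lemma IsLeg.restrict_mem {F : Matrix (Fin d) (Fin d) ℂ → Matrix ι ι ℂ} {idx : ι → Fin d}
    (hF : IsLeg F idx) {V : Submodule ℂ ((Fin n → ι) → ℂ)}
    (hV : ∀ U : Matrix (Fin d) (Fin d) ℂ, Uᴴ * U = 1 → ∀ v ∈ V, pw n (F U) *ᵥ v ∈ V)
    {v : (Fin n → ι) → ℂ} (hv : v ∈ V) (k : Fin d → ℕ) :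
    (fun x => if cnt (idx ∘ x) = k then v x else 0) ∈ V := by
  by_contra hcon
  obtain ⟨f, hf, hfV⟩ := Submodule.exists_le_ker_of_notMem hcon
  let e : (Fin n → ι) → (Fin d →₀ ℕ) := fun x => Finsupp.equivFunOnFinite.symm (cnt (idx ∘ x))
  let p : MvPolynomial (Fin d) ℂ :=
    ∑ x, MvPolynomial.monomial (e x) (v x * f (Pi.single x 1))
  have heval : ∀ z : Fin d → ℂ, MvPolynomial.eval z p = f (pw n (F (diagonal z)) *ᵥ v) := by
    intro z
    have h1 : pw n (F (diagonal z)) *ᵥ v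
        = ∑ x, (tp n (z ∘ idx) x * v x) • Pi.single (M := fun _ => ℂ) x (1 : ℂ) := by
      rw [hF.map_diagonal, pw_diagonal]
      ext y
      rw [mulVec_diagonal, Finset.sum_apply, Finset.sum_eq_single y]
      · simp
      · intro x _ hxy; simp [Pi.single_eq_of_ne (Ne.symm hxy)]
      · simp
    rw [h1, map_sum, map_sum]
    refine Finset.sum_congr rfl fun x _ => ?_
    rw [map_smul, MvPolynomial.eval_monomial, smul_eq_mul]
    have : tp n (z ∘ idx) x = ∏ i, z i ^ cnt (idx ∘ x) i :=
      prod_comp_eq_prod_pow_cnt z (idx ∘ x)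
    rw [this, Finsupp.prod_fintype _ _ (by simp)]
    simp only [e, Finsupp.equivFunOnFinite_symm_apply_apply]
    ring
  have hp : p = 0 := by
    refine MvPolynomial.funext_set (fun _ => Metric.sphere (0 : ℂ) 1) (fun _ => ?_) fun z hz => ?_
    · exact (isConnected_sphere (by simp [Complex.rank_real_complex]) 0
        zero_le_one).isPreconnected.infinite_of_nontrivial
          ⟨1, by simp, -1, by simp, by norm_num⟩
    · rw [heval, map_zero]
      refine hfV (hV _ ?_ v hv)
      rw [diagonal_conjTranspose, diagonal_mul_diagonal, ← diagonal_one]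
      congr 1
      ext i
      have hzi : ‖z i‖ = 1 := by simpa using hz i (Set.mem_univ i)
      simp [Complex.conj_mul', hzi]
  have hc : MvPolynomial.coeff (Finsupp.equivFunOnFinite.symm k) p = 0 := by rw [hp]; simp
  rw [MvPolynomial.coeff_sum] at hc
  simp only [MvPolynomial.coeff_monomial] at hc
  apply hf
  have h2 : (fun x => if cnt (idx ∘ x) = k then v x else 0)
      = ∑ x, (if cnt (idx ∘ x) = k then v x else 0) • Pi.single (M := fun _ => ℂ) x (1 : ℂ) := by
    ext y
    rw [Finset.sum_apply, Finset.sum_eq_single y]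
    · simp
    · intro x _ hxy; simp [Pi.single_eq_of_ne (Ne.symm hxy)]
    · simp
  rw [h2, map_sum]
  refine Eq.trans ?_ hc
  refine Finset.sum_congr rfl fun x _ => ?_
  rw [map_smul, smul_eq_mul]
  by_cases h : cnt (idx ∘ x) = k
  · simp [e, h]
  · simp [e, h]

lemma IsLeg.diagonal_mem {F : Matrix (Fin d) (Fin d) ℂ → Matrix ι ι ℂ} {idx : ι → Fin d}
    (hF : IsLeg F idx) {V : Submodule ℂ ((Fin n → ι) → ℂ)}
    (hV : ∀ U : Matrix (Fin d) (Fin d) ℂ, Uᴴ * U = 1 → ∀ v ∈ V, pw n (F U) *ᵥ v ∈ V)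
    {v : (Fin n → ι) → ℂ} (hv : v ∈ V) (z : Fin d → ℂ) : pw n (F (diagonal z)) *ᵥ v ∈ V := by
  have h : pw n (F (diagonal z)) *ᵥ v
      = ∑ k ∈ Finset.univ.image (fun x : Fin n → ι => cnt (idx ∘ x)),
        (∏ i, z i ^ k i) • (fun x => if cnt (idx ∘ x) = k then v x else 0) := by
    ext x
    rw [hF.map_diagonal, pw_diagonal, mulVec_diagonal, Finset.sum_apply,
      Finset.sum_eq_single (cnt (idx ∘ x))]
    · rw [← prod_comp_eq_prod_pow_cnt]
      simp [tp]
    · intro k _ hk; simp [hk.symm]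
    · intro h
      exact absurd (Finset.mem_image_of_mem _ (Finset.mem_univ x)) h
  rw [h]
  exact Submodule.sum_mem _ fun k _ => Submodule.smul_mem _ _ (hF.restrict_mem hV hv k)

open scoped ComplexOrder in
lemma exists_unitary_diagonal_unitary {A : Matrix (Fin d) (Fin d) ℂ} (hA : IsUnit A) :
    ∃ (U W : Matrix (Fin d) (Fin d) ℂ) (z : Fin d → ℂ),
      Uᴴ * U = 1 ∧ Wᴴ * W = 1 ∧ A = U * diagonal z * W := by
  have hpd : (Aᴴ * A).PosDef := by
    exact Matrix.PosDef.conjTranspose_mul_self A (mulVec_injective_of_isUnit hA)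
  have hH := hpd.isHermitian
  let E : Matrix (Fin d) (Fin d) ℂ := hH.eigenvectorUnitary
  have hE : Eᴴ * E = 1 := Unitary.coe_star_mul_self hH.eigenvectorUnitary
  have hE' : E * Eᴴ = 1 := Unitary.coe_mul_star_self hH.eigenvectorUnitary
  have hs : Aᴴ * A = E * rdiag hH.eigenvalues * Eᴴ := by
    conv_lhs => rw [hH.spectral_theorem, Unitary.conjStarAlgAut_apply]
    rfl
  have hs' : Eᴴ * (Aᴴ * A) * E = rdiag hH.eigenvalues := by
    refine (congrArg (fun M => Eᴴ * M * E) hs).trans ?_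
    simp only [Matrix.mul_assoc]
    rw [hE, Matrix.mul_one, ← Matrix.mul_assoc, hE, Matrix.one_mul]
  have hpos : ∀ i, 0 < hH.eigenvalues i := hpd.eigenvalues_pos
  let q : Fin d → ℝ := fun i => Real.sqrt (hH.eigenvalues i)
  have hq : ∀ i, q i ≠ 0 := fun i => (Real.sqrt_pos.2 (hpos i)).ne'
  refine ⟨A * E * rdiag (fun i => (q i)⁻¹), Eᴴ, fun i => (q i : ℂ), ?_, by
    rwa [conjTranspose_conjTranspose], ?_⟩
  · have h1 : (rdiag fun i => (q i)⁻¹)ᴴ = rdiag fun i => (q i)⁻¹ := by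
      simp only [rdiag, diagonal_conjTranspose]; congr 1; ext i; simp
    rw [conjTranspose_mul, conjTranspose_mul, h1]
    calc _ = (rdiag fun i => (q i)⁻¹) * (Eᴴ * (Aᴴ * A) * E) * rdiag fun i => (q i)⁻¹ := by
          simp only [Matrix.mul_assoc]
      _ = 1 := by
          rw [hs', rdiag, rdiag, diagonal_mul_diagonal, diagonal_mul_diagonal, ← diagonal_one]
          congr 1
          ext i
          rw [← Complex.ofReal_mul, ← Complex.ofReal_mul, ← Complex.ofReal_one]
          congr 1
          have : hH.eigenvalues i = q i * q i := (Real.mul_self_sqrt (hpos i).le).symm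
          rw [this]
          field_simp [hq i]
  · have h2 : (rdiag fun i => (q i)⁻¹) * diagonal (fun i => (q i : ℂ)) = 1 := by
      rw [rdiag, diagonal_mul_diagonal, ← diagonal_one]
      congr 1
      ext i
      rw [← Complex.ofReal_mul, inv_mul_cancel₀ (hq i), Complex.ofReal_one]
    rw [Matrix.mul_assoc (A * E), h2, Matrix.mul_one, Matrix.mul_assoc, hE', Matrix.mul_one]

lemma IsLeg.mulVec_mem {F : Matrix (Fin d) (Fin d) ℂ → Matrix ι ι ℂ} {idx : ι → Fin d}
    (hF : IsLeg F idx) {V : Submodule ℂ ((Fin n → ι) → ℂ)}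
    (hV : ∀ U : Matrix (Fin d) (Fin d) ℂ, Uᴴ * U = 1 → ∀ v ∈ V, pw n (F U) *ᵥ v ∈ V)
    {A : Matrix (Fin d) (Fin d) ℂ} (hA : IsUnit A) {v : (Fin n → ι) → ℂ} (hv : v ∈ V) :
    pw n (F A) *ᵥ v ∈ V := by
  obtain ⟨U, W, z, hU, hW, rfl⟩ := exists_unitary_diagonal_unitary hA
  rw [hF.map_mul, hF.map_mul, ← pw_mul, ← pw_mul, ← mulVec_mulVec, ← mulVec_mulVec]
  exact hV U hU _ (hF.diagonal_mem hV (hV W hW _ hv) z)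

end Complexification

section Covariants

open Matrix

variable {a b c n : ℕ}

lemma isLeg_fst : IsLeg (fun U : Matrix (Fin a) (Fin a) ℂ =>
    tri U (1 : Matrix (Fin b) (Fin b) ℂ) (1 : Matrix (Fin c) (Fin c) ℂ)) (fun p => p.1) := by
  refine ⟨fun A B => by simp [tri_mul], fun z => ?_⟩
  ext ⟨i, j, k⟩ ⟨i', j', k'⟩
  by_cases h1 : i = i' <;> by_cases h2 : j = j' <;> by_cases h3 : k = k' <;>
    simp [tri_apply, one_apply, h1, h2, h3]

lemma isLeg_snd : IsLeg (fun U : Matrix (Fin b) (Fin b) ℂ =>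
    tri (1 : Matrix (Fin a) (Fin a) ℂ) U (1 : Matrix (Fin c) (Fin c) ℂ)) (fun p => p.2.1) := by
  refine ⟨fun A B => by simp [tri_mul], fun z => ?_⟩
  ext ⟨i, j, k⟩ ⟨i', j', k'⟩
  by_cases h1 : i = i' <;> by_cases h2 : j = j' <;> by_cases h3 : k = k' <;>
    simp [tri_apply, one_apply, h1, h2, h3]

lemma isLeg_trd : IsLeg (fun U : Matrix (Fin c) (Fin c) ℂ =>
    tri (1 : Matrix (Fin a) (Fin a) ℂ) (1 : Matrix (Fin b) (Fin b) ℂ) U) (fun p => p.2.2) := by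
  refine ⟨fun A B => by simp [tri_mul], fun z => ?_⟩
  ext ⟨i, j, k⟩ ⟨i', j', k'⟩
  by_cases h1 : i = i' <;> by_cases h2 : j = j' <;> by_cases h3 : k = k' <;>
    simp [tri_apply, one_apply, h1, h2, h3]

lemma antitone_cnt_of_min {ι : Type*} {d : ℕ} {τ : Equiv.Perm (Fin d) → ι → ι} {idx : ι → Fin d}
    {rest : ι → ℕ} (hτ : ∀ σ p, idx (τ σ p) = σ (idx p)) (hrest : ∀ σ p, rest (τ σ p) = rest p)
    (hinv : ∀ i j p, τ (Equiv.swap i j) (τ (Equiv.swap i j) p) = p)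
    {V : Submodule ℂ ((Fin n → ι) → ℂ)} (hV : ∀ σ, ∀ v ∈ V, (fun x => v (τ σ ∘ x)) ∈ V)
    {v₀ : (Fin n → ι) → ℂ} (hv₀ : v₀ ∈ V) {x₀ : Fin n → ι} (hx₀ : v₀ x₀ ≠ 0)
    (hmin : ∀ v ∈ V, ∀ x, v x ≠ 0 →
      ∑ t, ((idx (x₀ t) : ℕ) + rest (x₀ t)) ≤ ∑ t, ((idx (x t) : ℕ) + rest (x t))) :
    Antitone (cnt (idx ∘ x₀)) := by
  intro i j hij
  rcases hij.eq_or_lt with rfl | hij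
  · exact le_rfl
  have h := hmin _ (hV (Equiv.swap i j) v₀ hv₀) (τ (Equiv.swap i j) ∘ x₀) (by
    have : τ (Equiv.swap i j) ∘ τ (Equiv.swap i j) ∘ x₀ = x₀ := by
      ext t; simp [hinv]
    rwa [this])
  simp only [Function.comp, hτ, hrest, Finset.sum_add_distrib] at h
  have h1 := sum_comp_eq_sum_mul_cnt (fun k : Fin d => (k : ℕ)) (idx ∘ x₀)
  have h2 := sum_comp_eq_sum_mul_cnt (fun k : Fin d => (Equiv.swap i j k : ℕ)) (idx ∘ x₀)
  simp only [Function.comp_apply] at h1 h2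
  rw [h1, h2] at h
  have h3 : ∑ k, cnt (idx ∘ x₀) k * (k : ℕ) ≤ ∑ k, cnt (idx ∘ x₀) k * (Equiv.swap i j k : ℕ) :=
    Nat.le_of_add_le_add_right h
  have h4 : (0 : ℤ) ≤ ∑ k, (cnt (idx ∘ x₀) k : ℤ) * ((Equiv.swap i j k : ℕ) - (k : ℕ)) := by
    simp only [mul_sub, Finset.sum_sub_distrib, sub_nonneg]
    exact_mod_cast h3
  rw [Finset.sum_eq_add i j hij.ne (fun k _ hk => by
    rw [Equiv.swap_apply_of_ne_of_ne hk.1 hk.2, sub_self, mul_zero]) (by simp) (by simp),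
    Equiv.swap_apply_left, Equiv.swap_apply_right] at h4
  have h5 : ((i : ℕ) : ℤ) < (j : ℕ) := by exact_mod_cast hij
  have h6 : (cnt (idx ∘ x₀) j : ℤ) ≤ cnt (idx ∘ x₀) i := by
    by_contra hc
    push Not at hc
    nlinarith
  exact_mod_cast h6

lemma pw_submatrix_one_mulVec {ι : Type*} [Fintype ι] [DecidableEq ι] (τ : ι → ι)
    (v : (Fin n → ι) → ℂ) :
    pw n ((1 : Matrix ι ι ℂ).submatrix τ id) *ᵥ v = fun x => v (τ ∘ x) := by
  have : pw n ((1 : Matrix ι ι ℂ).submatrix τ id)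
      = (pw n (1 : Matrix ι ι ℂ)).submatrix (fun x => τ ∘ x) id := rfl
  rw [this, pw_one]
  ext x
  exact congrFun (one_mulVec v) (τ ∘ x)

lemma conjTranspose_mul_self_perm {d : ℕ} (σ : Equiv.Perm (Fin d)) :
    ((1 : Matrix (Fin d) (Fin d) ℂ).submatrix σ id)ᴴ * (1 : Matrix (Fin d) (Fin d) ℂ).submatrix σ id
      = 1 := by
  rw [conjTranspose_submatrix, submatrix_mul_equiv]; simp

lemma pw_mulVec_highest {ι : Type*} [Fintype ι] {M : Matrix ι ι ℂ} {L : ι → ℕ}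
    (hM : ∀ p q, p ≠ q → M p q ≠ 0 → L p < L q) {Φ : (Fin n → ι) → ℂ} {m : ℕ}
    (hsupp : ∀ x, Φ x ≠ 0 → ∑ t, L (x t) = m)
    (hmin : ∀ x, (pw n M *ᵥ Φ) x ≠ 0 → m ≤ ∑ t, L (x t)) (x : Fin n → ι) :
    (pw n M *ᵥ Φ) x = (∏ t, M (x t) (x t)) * Φ x := by
  classical
  by_cases hx : m ≤ ∑ t, L (x t)
  · rw [mulVec, dotProduct, Finset.sum_eq_single x]
    · rfl
    · intro y _ hyx
      by_contra hne
      have h1 : pw n M x y ≠ 0 := left_ne_zero_of_mul hne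
      have h2 := hsupp y (right_ne_zero_of_mul hne)
      rw [pw_apply, Finset.prod_ne_zero_iff] at h1
      have hle : ∀ t, L (x t) ≤ L (y t) := fun t => by
        by_cases h : x t = y t
        · rw [h]
        · exact (hM _ _ h (h1 t (Finset.mem_univ t))).le
      obtain ⟨t, ht⟩ := Function.ne_iff.1 hyx
      have : ∑ t, L (x t) < ∑ t, L (y t) := Finset.sum_lt_sum (fun t _ => hle t)
        ⟨t, Finset.mem_univ t, hM _ _ (Ne.symm ht) (h1 t (Finset.mem_univ t))⟩
      omega
    · simp
  · have h1 : (pw n M *ᵥ Φ) x = 0 := by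
      by_contra h; exact hx (hmin x h)
    have h2 : Φ x = 0 := by
      by_contra h; exact hx (hsupp x h).ge
    rw [h1, h2, mul_zero]

lemma Low.isUnit_conjTranspose {d : ℕ} {r : Fin d → ℝ} {A : Matrix (Fin d) (Fin d) ℂ}
    (h : Low r A) : IsUnit Aᴴ := by
  rw [isUnit_iff_isUnit_det, det_of_isUpperTriangular (M := Aᴴ) fun i j (hij : j < i) => by
    simp [h.1 j i hij], isUnit_iff_ne_zero, Finset.prod_ne_zero_iff]
  intro i _
  simp [h.2 i]

/-- A nonzero tensor whose associated covariant has weight `w` under the lower triangular group. -/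
def IsCovariant (n : ℕ) (w : (Fin a → ℕ) × (Fin b → ℕ) × (Fin c → ℕ))
    (Φ : (Fin n → Fin a × Fin b × Fin c) → ℂ) : Prop :=
  ∀ r s t A B C, Low r A → Low s B → Low t C → ∀ ψ : Fin a × Fin b × Fin c → ℂ,
    star Φ ⬝ᵥ tp n (tri A B C *ᵥ ψ) =
      (Real.exp (pair3 (fun i => (w.1 i : ℝ), fun i => (w.2.1 i : ℝ), fun i => (w.2.2 i : ℝ)) r s t)
        : ℂ) * (star Φ ⬝ᵥ tp n ψ)

lemma prod_pow_exp {d : ℕ} (w : Fin d → ℕ) (r : Fin d → ℝ) :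
    ∏ i, (Real.exp (r i) : ℂ) ^ w i = (Real.exp ((fun i => (w i : ℝ)) ⬝ᵥ r) : ℂ) := by
  rw [dotProduct, Real.exp_sum, Complex.ofReal_prod]
  refine Finset.prod_congr rfl fun i _ => ?_
  rw [Real.exp_nat_mul, Complex.ofReal_pow]

lemma exists_isCovariant {V : Submodule ℂ ((Fin n → Fin a × Fin b × Fin c) → ℂ)} (hbot : V ≠ ⊥)
    (hV : ∀ (A : Matrix (Fin a) (Fin a) ℂ) (B : Matrix (Fin b) (Fin b) ℂ)
      (C : Matrix (Fin c) (Fin c) ℂ), Aᴴ * A = 1 → Bᴴ * B = 1 → Cᴴ * C = 1 →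
      ∀ v ∈ V, pw n (tri A B C) *ᵥ v ∈ V) :
    ∃ Φ ∈ V, Φ ≠ 0 ∧ ∃ w : (Fin a → ℕ) × (Fin b → ℕ) × (Fin c → ℕ), IsCovariant n w Φ ∧
      (Antitone w.1 ∧ Antitone w.2.1 ∧ Antitone w.2.2) ∧
      (∀ i, w.1 i ≤ n) ∧ (∀ i, w.2.1 i ≤ n) ∧ ∀ i, w.2.2 i ≤ n := by
  classical
  have h1 : ∀ d : ℕ, (1 : Matrix (Fin d) (Fin d) ℂ)ᴴ * 1 = 1 := fun d => by simp
  have hVA : ∀ A : Matrix (Fin a) (Fin a) ℂ, Aᴴ * A = 1 → ∀ v ∈ V, pw n (tri A 1 1) *ᵥ v ∈ V :=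
    fun A hA => hV A 1 1 hA (h1 b) (h1 c)
  have hVB : ∀ B : Matrix (Fin b) (Fin b) ℂ, Bᴴ * B = 1 → ∀ v ∈ V, pw n (tri 1 B 1) *ᵥ v ∈ V :=
    fun B hB => hV 1 B 1 (h1 a) hB (h1 c)
  have hVC : ∀ C : Matrix (Fin c) (Fin c) ℂ, Cᴴ * C = 1 → ∀ v ∈ V, pw n (tri 1 1 C) *ᵥ v ∈ V :=
    fun C hC => hV 1 1 C (h1 a) (h1 b) hC
  have hVU : ∀ (A : Matrix (Fin a) (Fin a) ℂ) (B : Matrix (Fin b) (Fin b) ℂ)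
      (C : Matrix (Fin c) (Fin c) ℂ), IsUnit A → IsUnit B → IsUnit C →
      ∀ v ∈ V, pw n (tri A B C) *ᵥ v ∈ V := by
    intro A B C hA hB hC v hv
    have : tri A B C = tri A 1 1 * (tri 1 B 1 * tri 1 1 C) := by simp [tri_mul]
    rw [this, ← pw_mul, ← pw_mul, ← mulVec_mulVec, ← mulVec_mulVec]
    exact isLeg_fst.mulVec_mem hVA hA (isLeg_snd.mulVec_mem hVB hB (isLeg_trd.mulVec_mem hVC hC hv))
  let L : Fin a × Fin b × Fin c → ℕ := fun p => p.1 + (p.2.1 + p.2.2)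
  have hex : ∃ m, ∃ v ∈ V, ∃ x, v x ≠ 0 ∧ ∑ t, L (x t) = m := by
    obtain ⟨v, hv, hv0⟩ := Submodule.exists_mem_ne_zero_of_ne_bot hbot
    obtain ⟨x, hx⟩ := Function.ne_iff.1 hv0
    exact ⟨_, v, hv, x, hx, rfl⟩
  obtain ⟨v, hv, x₀, hvx, hm⟩ := Nat.find_spec hex
  set m := Nat.find hex with hm_def
  have hmin : ∀ v ∈ V, ∀ x, v x ≠ 0 → m ≤ ∑ t, L (x t) := fun v hv x hx =>
    Nat.find_min' hex ⟨v, hv, x, hx, rfl⟩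
  let wA := cnt ((fun p : Fin a × Fin b × Fin c => p.1) ∘ x₀)
  let wB := cnt ((fun p : Fin a × Fin b × Fin c => p.2.1) ∘ x₀)
  let wC := cnt ((fun p : Fin a × Fin b × Fin c => p.2.2) ∘ x₀)
  obtain ⟨Φ, hΦV, hΦ0, hΦ⟩ : ∃ Φ ∈ V, Φ x₀ ≠ 0 ∧ ∀ x, Φ x ≠ 0 →
      cnt ((fun p : Fin a × Fin b × Fin c => p.1) ∘ x) = wA ∧
      cnt ((fun p : Fin a × Fin b × Fin c => p.2.1) ∘ x) = wB ∧
      cnt ((fun p : Fin a × Fin b × Fin c => p.2.2) ∘ x) = wC := by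
    refine ⟨_, isLeg_fst.restrict_mem hVA (isLeg_snd.restrict_mem hVB
      (isLeg_trd.restrict_mem hVC hv wC) wB) wA, ?_, fun x hx => ?_⟩
    · simpa [wA, wB, wC] using hvx
    · simp only [ne_eq, ite_eq_right_iff, Classical.not_imp] at hx
      exact ⟨hx.1, hx.2.1, hx.2.2.1⟩
  have hsupp : ∀ x, Φ x ≠ 0 → ∑ t, L (x t) = m := by
    intro x hx
    obtain ⟨eA, eB, eC⟩ := hΦ x hx
    rw [← hm]
    simp only [L, Finset.sum_add_distrib]
    have sA := fun y : Fin n → Fin a × Fin b × Fin c =>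
      sum_comp_eq_sum_mul_cnt (fun k : Fin a => (k : ℕ)) ((fun p => p.1) ∘ y)
    have sB := fun y : Fin n → Fin a × Fin b × Fin c =>
      sum_comp_eq_sum_mul_cnt (fun k : Fin b => (k : ℕ)) ((fun p => p.2.1) ∘ y)
    have sC := fun y : Fin n → Fin a × Fin b × Fin c =>
      sum_comp_eq_sum_mul_cnt (fun k : Fin c => (k : ℕ)) ((fun p => p.2.2) ∘ y)
    simp only [Function.comp_apply] at sA sB sC
    rw [sA, sA, sB, sB, sC, sC, eA, eB, eC]
  refine ⟨Φ, hΦV, fun h => hΦ0 (by rw [h]; rfl), (wA, wB, wC), ?_, ⟨?_, ?_, ?_⟩,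
    fun i => cnt_le _ i, fun i => cnt_le _ i, fun i => cnt_le _ i⟩
  · intro r s t A B C hA hB hC ψ
    have key : pw n (tri Aᴴ Bᴴ Cᴴ) *ᵥ Φ = (Real.exp (pair3 (fun i => (wA i : ℝ),
        fun i => (wB i : ℝ), fun i => (wC i : ℝ)) r s t) : ℂ) • Φ := by
      ext x
      rw [pw_mulVec_highest (L := L) ?_ hsupp (hmin _ (hVU _ _ _ hA.isUnit_conjTranspose
        hB.isUnit_conjTranspose hC.isUnit_conjTranspose _ hΦV))]
      · rw [Pi.smul_apply, smul_eq_mul]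
        by_cases hx : Φ x = 0
        · rw [hx, mul_zero, mul_zero]
        obtain ⟨eA, eB, eC⟩ := hΦ x hx
        congr 1
        simp only [tri_apply, conjTranspose_apply, hA.2, hB.2, hC.2, Finset.prod_mul_distrib,
          RCLike.star_def, Complex.conj_ofReal]
        have sA := prod_comp_eq_prod_pow_cnt (fun k => (Real.exp (r k) : ℂ)) ((fun p => p.1) ∘ x)
        have sB := prod_comp_eq_prod_pow_cnt (fun k => (Real.exp (s k) : ℂ)) ((fun p => p.2.1) ∘ x)
        have sC := prod_comp_eq_prod_pow_cnt (fun k => (Real.exp (t k) : ℂ)) ((fun p => p.2.2) ∘ x)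
        rw [eA] at sA
        rw [eB] at sB
        rw [eC] at sC
        simp only [Function.comp_apply] at sA sB sC
        rw [sA, sB, sC, prod_pow_exp, prod_pow_exp, prod_pow_exp, pair3, Real.exp_add, Real.exp_add]
        push_cast; ring
      · rintro ⟨i, j, k⟩ ⟨i', j', k'⟩ hne hM
        simp only [tri_apply, conjTranspose_apply, ne_eq, mul_eq_zero, star_eq_zero, not_or] at hM
        have l1 : i ≤ i' := by
          by_contra h; exact hM.1 (hA.1 _ _ (lt_of_not_ge h))
        have l2 : j ≤ j' := by
          by_contra h; exact hM.2.1 (hB.1 _ _ (lt_of_not_ge h))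
        have l3 : k ≤ k' := by
          by_contra h; exact hM.2.2 (hC.1 _ _ (lt_of_not_ge h))
        simp only [ne_eq, Prod.mk.injEq, Fin.ext_iff] at hne
        simp only [L]
        rw [Fin.le_def] at l1 l2 l3
        omega
    have : star Φ ⬝ᵥ tp n (tri A B C *ᵥ ψ) = star (pw n (tri Aᴴ Bᴴ Cᴴ) *ᵥ Φ) ⬝ᵥ tp n ψ := by
      rw [star_mulVec, pw_conjTranspose, tri_conjTranspose, conjTranspose_conjTranspose,
        conjTranspose_conjTranspose, conjTranspose_conjTranspose, ← dotProduct_mulVec,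
        pw_mulVec_tp]
    rw [this, key, star_smul, smul_dotProduct, RCLike.star_def, Complex.conj_ofReal, smul_eq_mul]
  · refine antitone_cnt_of_min (ι := Fin a × Fin b × Fin c) (n := n) (V := V) (v₀ := Φ) (x₀ := x₀)
      (τ := fun σ p => (σ p.1, p.2)) (idx := fun p => p.1)
      (rest := fun p => p.2.1 + p.2.2)
      (fun σ p => rfl) (fun σ p => rfl) (fun i j p => by simp) (fun σ v hv => ?_) hΦV hΦ0
      (fun v hv x hx => ?_)
    · have := hVA _ (conjTranspose_mul_self_perm σ) v hv
      rwa [show tri ((1 : Matrix (Fin a) (Fin a) ℂ).submatrix σ id) (1 : Matrix (Fin b) (Fin b) ℂ)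
        (1 : Matrix (Fin c) (Fin c) ℂ) = (tri 1 1 1).submatrix (fun p => (σ p.1, p.2)) id from rfl,
        tri_one, pw_submatrix_one_mulVec] at this
    · exact hm.le.trans (hmin v hv x hx)
  · refine antitone_cnt_of_min (ι := Fin a × Fin b × Fin c) (n := n) (V := V) (v₀ := Φ) (x₀ := x₀)
      (τ := fun σ p => (p.1, σ p.2.1, p.2.2))
      (idx := fun p => p.2.1) (rest := fun p => p.1 + p.2.2)
      (fun σ p => rfl) (fun σ p => rfl) (fun i j p => by simp) (fun σ v hv => ?_) hΦV hΦ0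
      (fun v hv x hx => ?_)
    · have := hVB _ (conjTranspose_mul_self_perm σ) v hv
      rwa [show tri (1 : Matrix (Fin a) (Fin a) ℂ) ((1 : Matrix (Fin b) (Fin b) ℂ).submatrix σ id)
        (1 : Matrix (Fin c) (Fin c) ℂ)
        = (tri 1 1 1).submatrix (fun p => (p.1, σ p.2.1, p.2.2)) id from rfl,
        tri_one, pw_submatrix_one_mulVec] at this
    · have e : ∀ y : Fin n → Fin a × Fin b × Fin c,
          ∑ t, (((y t).2.1 : ℕ) + ((y t).1 + (y t).2.2)) = ∑ t, L (y t) := fun y =>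
        Finset.sum_congr rfl fun t _ => by simp only [L]; omega
      rw [e, e]
      exact hm.le.trans (hmin v hv x hx)
  · refine antitone_cnt_of_min (ι := Fin a × Fin b × Fin c) (n := n) (V := V) (v₀ := Φ) (x₀ := x₀)
      (τ := fun σ p => (p.1, p.2.1, σ p.2.2))
      (idx := fun p => p.2.2) (rest := fun p => p.1 + p.2.1)
      (fun σ p => rfl) (fun σ p => rfl) (fun i j p => by simp) (fun σ v hv => ?_) hΦV hΦ0
      (fun v hv x hx => ?_)
    · have := hVC _ (conjTranspose_mul_self_perm σ) v hv
      rwa [show tri (1 : Matrix (Fin a) (Fin a) ℂ) (1 : Matrix (Fin b) (Fin b) ℂ)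
        ((1 : Matrix (Fin c) (Fin c) ℂ).submatrix σ id)
        = (tri 1 1 1).submatrix (fun p => (p.1, p.2.1, σ p.2.2)) id from rfl,
        tri_one, pw_submatrix_one_mulVec] at this
    · have e : ∀ y : Fin n → Fin a × Fin b × Fin c,
          ∑ t, (((y t).2.2 : ℕ) + ((y t).1 + (y t).2.1)) = ∑ t, L (y t) := fun y =>
        Finset.sum_congr rfl fun t _ => by simp only [L]; omega
      rw [e, e]
      exact hm.le.trans (hmin v hv x hx)

/-- For every unit vector and every degree there is a covariant that is not too small somewhere on
the unitary orbit. -/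
lemma exists_isCovariant_large (n : ℕ) {ψ : Fin a × Fin b × Fin c → ℂ} (hψ : sqN ψ = 1) :
    ∃ (Φ : (Fin n → Fin a × Fin b × Fin c) → ℂ)
      (w : (Fin a → ℕ) × (Fin b → ℕ) × (Fin c → ℕ))
      (U : Matrix (Fin a) (Fin a) ℂ) (V : Matrix (Fin b) (Fin b) ℂ) (W : Matrix (Fin c) (Fin c) ℂ),
      Φ ≠ 0 ∧ IsCovariant n w Φ ∧ (Antitone w.1 ∧ Antitone w.2.1 ∧ Antitone w.2.2) ∧
      ((∀ i, w.1 i ≤ n) ∧ (∀ i, w.2.1 i ≤ n) ∧ ∀ i, w.2.2 i ≤ n) ∧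
      Uᴴ * U = 1 ∧ Vᴴ * V = 1 ∧ Wᴴ * W = 1 ∧
      sqN Φ / (2 * ((n : ℝ) + 1) ^ (a * (b * c))) ≤
        ‖star Φ ⬝ᵥ tp n (tri U V W *ᵥ ψ)‖ ^ 2 := by
  let G : Set (Matrix (Fin n → Fin a × Fin b × Fin c) (Fin n → Fin a × Fin b × Fin c) ℂ) :=
    {k | ∃ (U : Matrix (Fin a) (Fin a) ℂ) (V : Matrix (Fin b) (Fin b) ℂ)
      (W : Matrix (Fin c) (Fin c) ℂ), Uᴴ * U = 1 ∧ Vᴴ * V = 1 ∧ Wᴴ * W = 1 ∧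
        k = pw n (tri U V W)}
  have h1 : ∀ d : ℕ, (1 : Matrix (Fin d) (Fin d) ℂ)ᴴ * 1 = 1 := fun d => by simp
  have hmul1 : ∀ {d : ℕ} {A B : Matrix (Fin d) (Fin d) ℂ}, Aᴴ * A = 1 → Bᴴ * B = 1 →
      (A * B)ᴴ * (A * B) = 1 := by
    intro d A B hA hB
    rw [conjTranspose_mul, Matrix.mul_assoc, ← Matrix.mul_assoc Aᴴ, hA, Matrix.one_mul, hB]
  set S := Submodule.span ℂ (Set.range (tp (ι := Fin a × Fin b × Fin c) n)) with hS
  have hφS : tp n ψ ∈ S := Submodule.subset_span ⟨ψ, rfl⟩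
  have hφ : sqN (tp n ψ) = 1 := by rw [sqN_tp, hψ, one_pow]
  obtain ⟨V, hVbot, hVinv, hV⟩ := exists_invariant_submodule (G := G) (φ := tp n ψ) (S := S)
    (by
      rintro _ ⟨U, V, W, hU, hV, hW, rfl⟩
      rw [pw_conjTranspose, pw_mul, tri_conjTranspose, tri_mul, hU, hV, hW, tri_one, pw_one])
    ⟨1, 1, 1, h1 a, h1 b, h1 c, by rw [tri_one, pw_one]⟩
    (by
      rintro _ ⟨U, V, W, hU, hV, hW, rfl⟩ _ ⟨U', V', W', hU', hV', hW', rfl⟩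
      exact ⟨_, _, _, hmul1 hU hU', hmul1 hV hV', hmul1 hW hW', by rw [pw_mul, tri_mul]⟩)
    hφ hφS
    (by
      rintro _ ⟨U, V, W, -, -, -, rfl⟩ v hv
      exact pw_mulVec_mem_span_tp n _ hv)
  obtain ⟨Φ, hΦV, hΦ0, w, hw, hanti, hwn⟩ := exists_isCovariant hVbot
    fun A B C hA hB hC v hv => hVinv _ ⟨A, B, C, hA, hB, hC, rfl⟩ v hv
  obtain ⟨_, ⟨A, B, C, hA, hB, hC, rfl⟩, hk⟩ := hV Φ hΦV hΦ0
  refine ⟨Φ, w, A, B, C, hΦ0, hw, hanti, hwn, hA, hB, hC, ?_⟩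
  rw [pw_mulVec_tp] at hk
  refine le_trans ?_ hk
  have hD : 0 < Module.finrank ℂ S := by
    have : Nontrivial S := ⟨⟨⟨_, hφS⟩, 0, fun h => by
      have h0 : tp n ψ = 0 := congrArg Subtype.val h
      rw [h0, sqN_eq_zero.2 rfl] at hφ
      exact zero_ne_one hφ⟩⟩
    exact Module.finrank_pos
  have hle : (Module.finrank ℂ S : ℝ) ≤ ((n : ℝ) + 1) ^ (a * (b * c)) := by
    have := finrank_span_tp_le (ι := Fin a × Fin b × Fin c) n
    simp only [Fintype.card_prod, Fintype.card_fin] at this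
    exact_mod_cast this
  have hD' : (0 : ℝ) < Module.finrank ℂ S := by exact_mod_cast hD
  have := sqN_nonneg Φ
  gcongr

end Covariants

section Convexity

open Matrix Filter

variable {a b c : ℕ}

/-- The weight of a covariant of degree `n`, divided by the degree. -/
def normWt (n : ℕ) (w : (Fin a → ℕ) × (Fin b → ℕ) × (Fin c → ℕ)) :
    (Fin a → ℝ) × (Fin b → ℝ) × (Fin c → ℝ) :=
  (fun i => (w.1 i : ℝ) / n, fun j => (w.2.1 j : ℝ) / n, fun k => (w.2.2 k : ℝ) / n)

lemma pair3_normWt (n : ℕ) (w : (Fin a → ℕ) × (Fin b → ℕ) × (Fin c → ℕ)) (r : Fin a → ℝ)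
    (s : Fin b → ℝ) (t : Fin c → ℝ) :
    pair3 (normWt n w) r s t =
      pair3 (fun i => (w.1 i : ℝ), fun i => (w.2.1 i : ℝ), fun i => (w.2.2 i : ℝ)) r s t / n := by
  simp only [pair3, normWt, dotProduct, add_div, Finset.sum_div, div_mul_eq_mul_div]

lemma IsCovariant.semi {n : ℕ} (hn : 0 < n) {w : (Fin a → ℕ) × (Fin b → ℕ) × (Fin c → ℕ)}
    {Φ : (Fin n → Fin a × Fin b × Fin c) → ℂ} (h : IsCovariant n w Φ) (hΦ : Φ ≠ 0) {δ : ℝ}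
    (hδ : 0 < δ) {ψ : Fin a × Fin b × Fin c → ℂ}
    (hψ : δ * sqN Φ ≤ ‖star Φ ⬝ᵥ tp n ψ‖ ^ 2) : Semi (normWt n w) (Real.log δ / n) ψ := by
  intro r s t A B C hA hB hC
  have h1 := norm_sq_star_dotProduct_le Φ (tp n (tri A B C *ᵥ ψ))
  rw [h r s t A B C hA hB hC, norm_mul, mul_pow, sqN_tp, Complex.norm_real, Real.norm_eq_abs,
    Real.abs_exp, ← Real.exp_nat_mul] at h1
  rw [pair3_normWt]
  set P := pair3 (fun i => (w.1 i : ℝ), fun i => (w.2.1 i : ℝ), fun i => (w.2.2 i : ℝ)) r s t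
  have hpos := sqN_pos hΦ
  have hn' : (n : ℝ) ≠ 0 := by positivity
  have h2 : Real.exp (Real.log δ + 2 * P) ≤ sqN (tri A B C *ᵥ ψ) ^ n := by
    rw [Real.exp_add, Real.exp_log hδ]
    have h3 : Real.exp (2 * P) * (δ * sqN Φ) ≤ sqN Φ * sqN (tri A B C *ᵥ ψ) ^ n :=
      (mul_le_mul_of_nonneg_left hψ (Real.exp_pos _).le).trans (by exact_mod_cast h1)
    nlinarith
  rw [← pow_le_pow_iff_left₀ (Real.exp_pos _).le (sqN_nonneg _) hn.ne', ← Real.exp_nat_mul]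
  rwa [show (n : ℝ) * (Real.log δ / n + 2 * (P / n)) = Real.log δ + 2 * P by field_simp]

lemma Semi.convex {ω ω' : (Fin a → ℝ) × (Fin b → ℝ) × (Fin c → ℝ)} {κ κ' : ℝ}
    {ψ : Fin a × Fin b × Fin c → ℂ} (h : Semi ω κ ψ) (h' : Semi ω' κ' ψ) {s s' : ℝ} (hs : 0 ≤ s)
    (hs' : 0 ≤ s') (hss : s + s' = 1) : Semi (s • ω + s' • ω') (s * κ + s' * κ') ψ := by
  intro r t u A B C hA hB hC
  have h1 := h r t u A B C hA hB hC
  have h2 := h' r t u A B C hA hB hC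
  have e : s * κ + s' * κ' + 2 * pair3 (s • ω + s' • ω') r t u
      = s * (κ + 2 * pair3 ω r t u) + s' * (κ' + 2 * pair3 ω' r t u) := by
    simp only [pair3, Prod.fst_add, Prod.snd_add, Prod.smul_fst, Prod.smul_snd, add_dotProduct,
      smul_dotProduct, smul_eq_mul]
    ring
  rw [e]
  have h3 := convexOn_exp.2 (Set.mem_univ (κ + 2 * pair3 ω r t u))
    (Set.mem_univ (κ' + 2 * pair3 ω' r t u)) hs hs' hss
  simp only [smul_eq_mul] at h3
  refine h3.trans ((add_le_add (mul_le_mul_of_nonneg_left h1 hs)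
    (mul_le_mul_of_nonneg_left h2 hs')).trans_eq ?_)
  rw [← add_mul, hss, one_mul]

/-- Normalized weights of nonvanishing covariants of positive degree. -/
def IsCovWt (ω : (Fin a → ℝ) × (Fin b → ℝ) × (Fin c → ℝ)) : Prop :=
  ∃ (n : ℕ) (Φ : (Fin n → Fin a × Fin b × Fin c) → ℂ)
    (w : (Fin a → ℕ) × (Fin b → ℕ) × (Fin c → ℕ)), 0 < n ∧ IsCovariant n w Φ ∧
    (∃ ψ, star Φ ⬝ᵥ tp n ψ ≠ 0) ∧ ω = normWt n w

lemma exists_semi_of_ne_zero {n : ℕ} (hn : 0 < n) {w : (Fin a → ℕ) × (Fin b → ℕ) × (Fin c → ℕ)}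
    {Φ : (Fin n → Fin a × Fin b × Fin c) → ℂ} (h : IsCovariant n w Φ)
    {ψ : Fin a × Fin b × Fin c → ℂ} (hψ : star Φ ⬝ᵥ tp n ψ ≠ 0) :
    ∃ κ, Semi (normWt n w) κ ψ := by
  have hΦ : Φ ≠ 0 := by rintro rfl; simp at hψ
  have hpos := sqN_pos hΦ
  have hψ' : 0 < ‖star Φ ⬝ᵥ tp n ψ‖ ^ 2 := by positivity
  exact ⟨_, h.semi hn hΦ (div_pos hψ' hpos) (div_mul_cancel₀ _ hpos.ne').le⟩

lemma exists_eval_eq_dotProduct_tp {n : ℕ} {ι : Type*} [Fintype ι] (Φ : (Fin n → ι) → ℂ) :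
    ∃ P : MvPolynomial ι ℂ, ∀ ψ, MvPolynomial.eval ψ P = star Φ ⬝ᵥ tp n ψ :=
  ⟨∑ x, MvPolynomial.C (star (Φ x)) * ∏ t, MvPolynomial.X (x t), fun ψ => by
    simp [dotProduct, tp]⟩

lemma exists_common_ne_zero {n m : ℕ} {ι : Type*} [Fintype ι] {Φ : (Fin n → ι) → ℂ}
    {Ψ : (Fin m → ι) → ℂ} (h : ∃ ψ, star Φ ⬝ᵥ tp n ψ ≠ 0) (h' : ∃ ψ, star Ψ ⬝ᵥ tp m ψ ≠ 0) :
    ∃ ψ, star Φ ⬝ᵥ tp n ψ ≠ 0 ∧ star Ψ ⬝ᵥ tp m ψ ≠ 0 := by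
  obtain ⟨P, hP⟩ := exists_eval_eq_dotProduct_tp Φ
  obtain ⟨Q, hQ⟩ := exists_eval_eq_dotProduct_tp Ψ
  have hP0 : P ≠ 0 := by
    rintro rfl
    obtain ⟨ψ, hψ⟩ := h
    exact hψ (by rw [← hP, map_zero])
  have hQ0 : Q ≠ 0 := by
    rintro rfl
    obtain ⟨ψ, hψ⟩ := h'
    exact hψ (by rw [← hQ, map_zero])
  by_contra hc
  push Not at hc
  refine mul_ne_zero hP0 hQ0 (MvPolynomial.funext fun ψ => ?_)
  rw [map_mul, map_zero, hP, hQ]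
  by_cases h : star Φ ⬝ᵥ tp n ψ = 0
  · rw [h, zero_mul]
  · rw [hc ψ h, mul_zero]

lemma IsCovWt.exists_semi {ω ω' : (Fin a → ℝ) × (Fin b → ℝ) × (Fin c → ℝ)} (h : IsCovWt ω)
    (h' : IsCovWt ω') {s s' : ℝ} (hs : 0 ≤ s) (hs' : 0 ≤ s') (hss : s + s' = 1) :
    ∃ ψ, sqN ψ = 1 ∧ Semi (s • ω + s' • ω') 0 ψ := by
  obtain ⟨n, Φ, w, hn, hΦ, hΦ0, rfl⟩ := h
  obtain ⟨m, Ψ, v, hm, hΨ, hΨ0, rfl⟩ := h'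
  obtain ⟨ψ, h1, h2⟩ := exists_common_ne_zero hΦ0 hΨ0
  obtain ⟨κ, hκ⟩ := exists_semi_of_ne_zero hn hΦ h1
  obtain ⟨κ', hκ'⟩ := exists_semi_of_ne_zero hm hΨ h2
  exact (hκ.convex hκ' hs hs' hss).exists_unit

lemma isCompact_unitary_matrices (d : ℕ) :
    IsCompact {U : Matrix (Fin d) (Fin d) ℂ | Uᴴ * U = 1} := by
  refine IsCompact.of_isClosed_subset (s := Set.pi Set.univ fun _ : Fin d =>
    Set.pi Set.univ fun _ : Fin d => Metric.closedBall (0 : ℂ) 1)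
    (isCompact_univ_pi fun _ => isCompact_univ_pi fun _ => isCompact_closedBall _ _)
    (isClosed_eq (by fun_prop) continuous_const) ?_
  intro U hU i _ j _
  rw [mem_closedBall_zero_iff]
  exact entry_norm_bound_of_unitary (mem_unitaryGroup_iff'.2 hU) i j

lemma eq_of_conj_rdiag_eq {d : ℕ} {U : Matrix (Fin d) (Fin d) ℂ} {l m : Fin d → ℝ}
    (hU : Uᴴ * U = 1) (h : U * rdiag l * Uᴴ = rdiag m) (hl : Antitone l) (hm : Antitone m) :
    m = l := by
  have hh : (rdiag l).IsHermitian := by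
    ext i j
    by_cases hij : i = j
    · subst hij; simp [rdiag]
    · simp [rdiag, diagonal_apply_ne _ hij, diagonal_apply_ne _ (Ne.symm hij)]
  refine antitone_comp_perm_eq hm hl ?_
  rw [← multiset_eigenvalues_of_conj hU hh h,
    ← multiset_eigenvalues_of_conj (U := 1) (l := l) (by simp) hh (by simp)]

lemma antitone_of_tendsto {d : ℕ} {l : ℕ → Fin d → ℝ} {m : Fin d → ℝ} (h : ∀ j, Antitone (l j))
    (hm : Tendsto l atTop (nhds m)) : Antitone m := fun i i' hi =>
  le_of_tendsto_of_tendsto' (b := atTop) (tendsto_pi_nhds.1 hm i') (tendsto_pi_nhds.1 hm i)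
    fun j => h j hi

lemma tendsto_log_degree (N : ℕ) :
    Tendsto (fun j : ℕ => Real.log (1 / (2 * (((j + 1 : ℕ) : ℝ) + 1) ^ N)) / ((j + 1 : ℕ) : ℝ)) atTop
      (nhds 0) := by
  have h1 : Tendsto (fun j : ℕ => (j : ℝ) + 2) atTop atTop :=
    tendsto_atTop_add_const_right _ _ tendsto_natCast_atTop_atTop
  have h2 := (Real.tendsto_pow_log_div_mul_add_atTop 1 (-1) 1 one_ne_zero).comp h1
  have h3 : Tendsto (fun j : ℕ => Real.log 2 / ((j : ℝ) + 1)) atTop (nhds 0) :=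
    tendsto_const_nhds.div_atTop
      (tendsto_atTop_add_const_right _ _ tendsto_natCast_atTop_atTop)
  have h4 := (h3.add (h2.const_mul (N : ℝ))).neg
  simp only [mul_zero, add_zero, neg_zero] at h4
  refine h4.congr fun j => ?_
  have e1 : ((j + 1 : ℕ) : ℝ) + 1 = (j : ℝ) + 2 := by push_cast; ring
  have hj : (0 : ℝ) < (j : ℝ) + 2 := by positivity
  rw [e1, one_div, Real.log_inv, Real.log_mul two_ne_zero (by positivity), Real.log_pow]
  simp only [Function.comp_apply, pow_one]
  have e2 : (1 : ℝ) * ((j : ℝ) + 2) + -1 = j + 1 := by ring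
  rw [e2]
  push_cast
  ring

lemma mem_Icc_normWt {n : ℕ} {w : (Fin a → ℕ) × (Fin b → ℕ) × (Fin c → ℕ)}
    (h : (∀ i, w.1 i ≤ n) ∧ (∀ i, w.2.1 i ≤ n) ∧ ∀ i, w.2.2 i ≤ n) :
    normWt n w ∈ Set.Icc (0 : (Fin a → ℝ) × (Fin b → ℝ) × (Fin c → ℝ)) 1 := by
  have h0 : ∀ m : ℕ, (0 : ℝ) ≤ (m : ℝ) / n := fun m => by positivity
  have h1 : ∀ m : ℕ, m ≤ n → (m : ℝ) / n ≤ 1 := fun m hm =>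
    div_le_one_of_le₀ (by exact_mod_cast hm) (by positivity)
  exact ⟨⟨fun i => h0 _, fun i => h0 _, fun i => h0 _⟩,
    ⟨fun i => h1 _ (h.1 i), fun i => h1 _ (h.2.1 i), fun i => h1 _ (h.2.2 i)⟩⟩

lemma antitone_normWt {n d : ℕ} {w : Fin d → ℕ} (h : Antitone w) :
    Antitone fun i => (w i : ℝ) / n := fun i j hij =>
  div_le_div_of_nonneg_right (by exact_mod_cast h hij) (by positivity)

lemma continuous_tri_mulVec (ψ : Fin a × Fin b × Fin c → ℂ) :
    Continuous fun x : Matrix (Fin a) (Fin a) ℂ × Matrix (Fin b) (Fin b) ℂ ×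
      Matrix (Fin c) (Fin c) ℂ => tri x.1 x.2.1 x.2.2 *ᵥ ψ := by
  have h (p q : Fin a × Fin b × Fin c) : Continuous fun x : Matrix (Fin a) (Fin a) ℂ ×
      Matrix (Fin b) (Fin b) ℂ × Matrix (Fin c) (Fin c) ℂ => tri x.1 x.2.1 x.2.2 p q :=
    (continuous_fst.matrix_elem p.1 q.1).mul
      (((continuous_fst.comp continuous_snd).matrix_elem p.2.1 q.2.1).mul
        ((continuous_snd.comp continuous_snd).matrix_elem p.2.2 q.2.2))
  exact continuous_pi fun p => continuous_finsetSum _ fun q _ => (h p q).mul continuous_const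

/-- Every normalized point of the Kronecker cone is a limit of weights of covariants. -/
lemma exists_tendsto_isCovWt {ψ : Fin a × Fin b × Fin c → ℂ} (hψ : sqN ψ = 1)
    {lam : (Fin a → ℝ) × (Fin b → ℝ) × (Fin c → ℝ)} (h : DiagMarg ψ lam)
    (hA : Antitone lam.1) (hB : Antitone lam.2.1) (hC : Antitone lam.2.2) :
    ∃ ω : ℕ → (Fin a → ℝ) × (Fin b → ℝ) × (Fin c → ℝ), (∀ j, IsCovWt (ω j)) ∧
      Tendsto ω atTop (nhds lam) := by
  choose Φ w U V W hΦ0 hcov hanti hwn hU hV hW hbd using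
    fun j : ℕ => exists_isCovariant_large (j + 1) hψ
  have hsemi : ∀ j, Semi (normWt (j + 1) (w j))
      (Real.log (1 / (2 * (((j + 1 : ℕ) : ℝ) + 1) ^ (a * (b * c)))) / ((j + 1 : ℕ) : ℝ))
      (tri (U j) (V j) (W j) *ᵥ ψ) := fun j =>
    (hcov j).semi j.succ_pos (hΦ0 j) (by positivity) (by
      have := hbd j
      rwa [div_eq_mul_one_div, mul_comm] at this)
  have hfc : ∀ d : ℕ, FirstCountableTopology (Matrix (Fin d) (Fin d) ℂ) := fun d =>
    inferInstanceAs (FirstCountableTopology (Fin d → Fin d → ℂ))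
  have hK := (isCompact_Icc (a := (0 : (Fin a → ℝ) × (Fin b → ℝ) × (Fin c → ℝ))) (b := 1)).prod
    ((isCompact_unitary_matrices a).prod
      ((isCompact_unitary_matrices b).prod (isCompact_unitary_matrices c)))
  obtain ⟨⟨ω', U', V', W'⟩, ⟨-, hU', hV', hW'⟩, φ, hφ, hlim⟩ := hK.tendsto_subseq
    (x := fun j => (normWt (j + 1) (w j), U j, V j, W j))
    fun j => ⟨mem_Icc_normWt (hwn j), hU j, hV j, hW j⟩
  have hω : Tendsto (fun j => normWt (φ j + 1) (w (φ j))) atTop (nhds ω') :=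
    (continuous_fst.tendsto _).comp hlim
  have hlimψ := ((continuous_tri_mulVec ψ).tendsto (U', V', W')).comp hlim.snd_nhds
  have hS : Semi ω' 0 (tri U' V' W' *ᵥ ψ) := Semi.of_tendsto (fun j => hsemi (φ j)) hω
    ((tendsto_log_degree _).comp hφ.tendsto_atTop) hlimψ
  have htri : (tri U' V' W')ᴴ * tri U' V' W' = 1 := by
    rw [tri_conjTranspose, tri_mul]
    rw [show U'ᴴ * U' = 1 from hU', show V'ᴴ * V' = 1 from hV', show W'ᴴ * W' = 1 from hW', tri_one]
  obtain ⟨dA, dB, dC⟩ := hS.diagMarg (by rw [sqN_mulVec_of_unitary htri, hψ])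
  rw [rhoA_tri hV' hW', h.1] at dA
  rw [rhoB_tri hU' hW', h.2.1] at dB
  rw [rhoC_tri hU' hV', h.2.2] at dC
  have hωlam : ω' = lam := by
    refine Prod.ext (eq_of_conj_rdiag_eq hU' dA hA ?_)
      (Prod.ext (eq_of_conj_rdiag_eq hV' dB hB ?_) (eq_of_conj_rdiag_eq hW' dC hC ?_))
    · exact antitone_of_tendsto (fun j => antitone_normWt (hanti (φ j)).1)
        ((continuous_fst.tendsto _).comp hω)
    · exact antitone_of_tendsto (fun j => antitone_normWt (hanti (φ j)).2.1)
        (((continuous_fst.comp continuous_snd).tendsto _).comp hω)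
    · exact antitone_of_tendsto (fun j => antitone_normWt (hanti (φ j)).2.2)
        (((continuous_snd.comp continuous_snd).tendsto _).comp hω)
  refine ⟨fun j => normWt (φ j + 1) (w (φ j)), fun j => ⟨φ j + 1, Φ (φ j), w (φ j), Nat.succ_pos _,
    hcov _, ⟨tri (U (φ j)) (V (φ j)) (W (φ j)) *ᵥ ψ, fun h0 => ?_⟩, rfl⟩, hωlam ▸ hω⟩
  have h1 := hbd (φ j)
  rw [h0, norm_zero, zero_pow two_ne_zero] at h1
  have h2 := sqN_pos (hΦ0 (φ j))
  have h3 : 0 < sqN (Φ (φ j)) / (2 * (((φ j + 1 : ℕ) : ℝ) + 1) ^ (a * (b * c))) := by positivity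
  exact h1.not_gt h3

lemma rdiag_injective {d : ℕ} : Function.Injective (rdiag (d := d)) := fun l m h => by
  funext i
  have := congrFun (congrFun h i) i
  simpa [rdiag] using this

lemma antitone_of_mem_kronCone {lam : (Fin a → ℝ) × (Fin b → ℝ) × (Fin c → ℝ)}
    (h : lam ∈ KronCone a b c) : Antitone lam.1 ∧ Antitone lam.2.1 ∧ Antitone lam.2.2 := by
  obtain ⟨ψ, hA, hB, hC⟩ := h
  exact ⟨hA.1, hB.1, hC.1⟩

lemma DiagMarg.sum_eq {ψ : Fin a × Fin b × Fin c → ℂ}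
    {lam : (Fin a → ℝ) × (Fin b → ℝ) × (Fin c → ℝ)} (h : DiagMarg ψ lam) :
    ∑ i, lam.1 i = sqN ψ ∧ ∑ j, lam.2.1 j = sqN ψ ∧ ∑ k, lam.2.2 k = sqN ψ := by
  have hA := trace_rhoA ψ
  have hB := trace_rhoB ψ
  have hC := trace_rhoC ψ
  rw [h.1, rdiag, trace_diagonal] at hA
  rw [h.2.1, rdiag, trace_diagonal] at hB
  rw [h.2.2, rdiag, trace_diagonal] at hC
  exact ⟨by exact_mod_cast hA, by exact_mod_cast hB, by exact_mod_cast hC⟩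

lemma smul_mem_kronCone {lam : (Fin a → ℝ) × (Fin b → ℝ) × (Fin c → ℝ)}
    (h : lam ∈ KronCone a b c) {t : ℝ} (ht : 0 ≤ t) : t • lam ∈ KronCone a b c := by
  obtain ⟨ψ, hψ⟩ := exists_diagMarg_of_mem_kronCone h
  obtain ⟨hA, hB, hC⟩ := antitone_of_mem_kronCone h
  have e : ((Real.sqrt t : ℝ) : ℂ) * (starRingEnd ℂ) ((Real.sqrt t : ℝ) : ℂ) = (t : ℂ) := by
    rw [Complex.conj_ofReal, ← Complex.ofReal_mul, Real.mul_self_sqrt ht]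
  have key : ∀ x y : ℂ, ((Real.sqrt t : ℝ) : ℂ) * x * (starRingEnd ℂ) (((Real.sqrt t : ℝ) : ℂ) * y)
      = (t : ℂ) * (x * (starRingEnd ℂ) y) := fun x y => by
    rw [← e, map_mul]; ring
  have hr : ∀ {d : ℕ} (l : Fin d → ℝ), rdiag (t • l) = (t : ℂ) • rdiag l := fun l => by
    rw [rdiag, rdiag, ← diagonal_smul]
    congr 1
    ext i
    simp
  refine mem_kronCone_of_diagMarg (ψ := ((Real.sqrt t : ℝ) : ℂ) • ψ) ⟨?_, ?_, ?_⟩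
    (fun i j hij => mul_le_mul_of_nonneg_left (hA hij) ht)
    (fun i j hij => mul_le_mul_of_nonneg_left (hB hij) ht)
    (fun i j hij => mul_le_mul_of_nonneg_left (hC hij) ht)
  · rw [Prod.smul_fst, hr, ← hψ.1]
    ext i i'
    simp only [rhoA, of_apply, Pi.smul_apply, smul_eq_mul, key, Matrix.smul_apply, Finset.mul_sum]
  · rw [Prod.smul_snd, Prod.smul_fst, hr, ← hψ.2.1]
    ext i i'
    simp only [rhoB, of_apply, Pi.smul_apply, smul_eq_mul, key, Matrix.smul_apply, Finset.mul_sum]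
  · rw [Prod.smul_snd, Prod.smul_snd, hr, ← hψ.2.2]
    ext i i'
    simp only [rhoC, of_apply, Pi.smul_apply, smul_eq_mul, key, Matrix.smul_apply, Finset.mul_sum]

lemma convex_comb_mem_kronCone {lam mu : (Fin a → ℝ) × (Fin b → ℝ) × (Fin c → ℝ)}
    (h : lam ∈ KronCone a b c) (h' : mu ∈ KronCone a b c) (h1 : ∑ i, lam.1 i = 1)
    (h1' : ∑ i, mu.1 i = 1) {s s' : ℝ} (hs : 0 ≤ s) (hs' : 0 ≤ s') (hss : s + s' = 1) :
    s • lam + s' • mu ∈ KronCone a b c := by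
  obtain ⟨hA, hB, hC⟩ := antitone_of_mem_kronCone h
  obtain ⟨hA', hB', hC'⟩ := antitone_of_mem_kronCone h'
  obtain ⟨ψ, hψ⟩ := exists_diagMarg_of_mem_kronCone h
  obtain ⟨ψ', hψ'⟩ := exists_diagMarg_of_mem_kronCone h'
  obtain ⟨ω, hω, hωl⟩ := exists_tendsto_isCovWt (hψ.sum_eq.1.symm.trans h1) hψ hA hB hC
  obtain ⟨ω', hω', hωl'⟩ := exists_tendsto_isCovWt (hψ'.sum_eq.1.symm.trans h1') hψ' hA' hB' hC'
  choose χ hχ1 hχ using fun j => (hω j).exists_semi (hω' j) hs hs' hss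
  obtain ⟨χ', hχ1', φ, hφ, hlim⟩ := (isCompact_sqN_eq_one (X := Fin a × Fin b × Fin c)).tendsto_subseq
    hχ1
  have hS : Semi (s • lam + s' • mu) 0 χ' := Semi.of_tendsto (fun j => hχ (φ j))
    (((hωl.const_smul s).add (hωl'.const_smul s')).comp hφ.tendsto_atTop) tendsto_const_nhds hlim
  exact mem_kronCone_of_diagMarg (hS.diagMarg hχ1')
    (fun i j hij => add_le_add (mul_le_mul_of_nonneg_left (hA hij) hs)
      (mul_le_mul_of_nonneg_left (hA' hij) hs'))
    (fun i j hij => add_le_add (mul_le_mul_of_nonneg_left (hB hij) hs)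
      (mul_le_mul_of_nonneg_left (hB' hij) hs'))
    (fun i j hij => add_le_add (mul_le_mul_of_nonneg_left (hC hij) hs)
      (mul_le_mul_of_nonneg_left (hC' hij) hs'))

lemma eq_zero_of_mem_kronCone {lam : (Fin a → ℝ) × (Fin b → ℝ) × (Fin c → ℝ)}
    (h : lam ∈ KronCone a b c) (h0 : ∑ i, lam.1 i = 0) : lam = 0 := by
  obtain ⟨ψ, hψ⟩ := exists_diagMarg_of_mem_kronCone h
  have : ψ = 0 := sqN_eq_zero.1 (hψ.sum_eq.1.symm.trans h0)
  subst this
  have hr : ∀ d : ℕ, rdiag (0 : Fin d → ℝ) = 0 := fun d => by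
    ext i j; simp [rdiag, diagonal_apply]
  refine Prod.ext (rdiag_injective ?_) (Prod.ext (rdiag_injective ?_) (rdiag_injective ?_))
  · rw [← hψ.1, Prod.fst_zero, hr]; ext; simp [rhoA]
  · rw [← hψ.2.1, Prod.snd_zero, Prod.fst_zero, hr]; ext; simp [rhoB]
  · rw [← hψ.2.2, Prod.snd_zero, Prod.snd_zero, hr]; ext; simp [rhoC]

lemma sum_nonneg_of_mem_kronCone {lam : (Fin a → ℝ) × (Fin b → ℝ) × (Fin c → ℝ)}
    (h : lam ∈ KronCone a b c) : 0 ≤ ∑ i, lam.1 i := by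
  obtain ⟨ψ, hψ⟩ := exists_diagMarg_of_mem_kronCone h
  rw [hψ.sum_eq.1]
  exact sqN_nonneg ψ

/-- The Kronecker cone is closed under addition. -/
lemma add_mem_kronCone {lam mu : (Fin a → ℝ) × (Fin b → ℝ) × (Fin c → ℝ)}
    (h : lam ∈ KronCone a b c) (h' : mu ∈ KronCone a b c) : lam + mu ∈ KronCone a b c := by
  rcases (sum_nonneg_of_mem_kronCone h).eq_or_lt with h0 | hp
  · rwa [eq_zero_of_mem_kronCone h h0.symm, zero_add]
  rcases (sum_nonneg_of_mem_kronCone h').eq_or_lt with h0 | hp'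
  · rwa [eq_zero_of_mem_kronCone h' h0.symm, add_zero]
  set x := ∑ i, lam.1 i with hx
  set y := ∑ i, mu.1 i with hy
  have hxy : 0 < x + y := add_pos hp hp'
  have h1 := convex_comb_mem_kronCone (smul_mem_kronCone h (inv_nonneg.2 hp.le))
    (smul_mem_kronCone h' (inv_nonneg.2 hp'.le))
    (by
      simp only [Prod.smul_fst, Pi.smul_apply, smul_eq_mul, ← Finset.mul_sum, ← hx]
      exact inv_mul_cancel₀ hp.ne')
    (by
      simp only [Prod.smul_fst, Pi.smul_apply, smul_eq_mul, ← Finset.mul_sum, ← hy]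
      exact inv_mul_cancel₀ hp'.ne')
    (div_nonneg hp.le hxy.le) (div_nonneg hp'.le hxy.le) (by field_simp)
  have h2 := smul_mem_kronCone h1 hxy.le
  rw [smul_add, smul_smul, smul_smul, smul_smul, smul_smul] at h2
  have e1 : (x + y) * (x / (x + y) * x⁻¹) = 1 := by field_simp
  have e2 : (x + y) * (y / (x + y) * y⁻¹) = 1 := by field_simp
  simpa only [← mul_assoc, e1, e2, one_smul, mul_assoc] using h2

lemma zero_mem_kronCone : (0 : (Fin a → ℝ) × (Fin b → ℝ) × (Fin c → ℝ)) ∈ KronCone a b c := by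
  refine mem_kronCone_of_diagMarg (ψ := 0) ⟨?_, ?_, ?_⟩ antitone_const antitone_const
    antitone_const
  · ext i j; simp [rhoA, rdiag, diagonal_apply]
  · ext i j; simp [rhoB, rdiag, diagonal_apply]
  · ext i j; simp [rhoC, rdiag, diagonal_apply]

end Convexity

section Perturbation

open Matrix Filter

lemma exists_isSpecDown {d : ℕ} {ρ : Matrix (Fin d) (Fin d) ℂ} (hρ : ρ.IsHermitian) :
    ∃ l, IsSpecDown ρ l := by
  refine ⟨hρ.eigenvalues ∘ Tuple.sort (fun i => -hρ.eigenvalues i), fun i j hij => ?_, hρ, _, rfl⟩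
  exact neg_le_neg_iff.1 (Tuple.monotone_sort (fun i => -hρ.eigenvalues i) hij)

/-- An approximate eigenvector lies close to an eigenvalue. -/
lemma IsSpecDown.exists_abs_sub_le {d : ℕ} {ρ : Matrix (Fin d) (Fin d) ℂ} {l : Fin d → ℝ}
    (h : IsSpecDown ρ l) {v : Fin d → ℂ} (hv : 1 ≤ sqN v) {x ε : ℝ} (hε : 0 ≤ ε)
    (hres : sqN (ρ *ᵥ v - (x : ℂ) • v) ≤ ε ^ 2) : ∃ k, |l k - x| ≤ ε := by
  obtain ⟨U, hU, hUρ⟩ := h.exists_conj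
  have h1 : U *ᵥ (ρ *ᵥ v - (x : ℂ) • v) = fun k => ((l k - x : ℝ) : ℂ) * (U *ᵥ v) k := by
    have h2 : U *ᵥ (ρ *ᵥ v) = rdiag l *ᵥ (U *ᵥ v) := by
      rw [← hUρ, mulVec_mulVec, mulVec_mulVec, Matrix.mul_assoc, hU, Matrix.mul_one]
    rw [mulVec_sub, h2, mulVec_smul]
    ext k
    rw [rdiag, Pi.sub_apply, mulVec_diagonal, Pi.smul_apply, smul_eq_mul, Complex.ofReal_sub,
      sub_mul]
  rw [← sqN_mulVec_of_unitary hU, h1] at hres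
  by_contra hc
  push Not at hc
  have h3 : sqN (U *ᵥ v) = sqN v := sqN_mulVec_of_unitary hU v
  have h4 : ∃ k, (U *ᵥ v) k ≠ 0 := by
    by_contra h0
    push Not at h0
    rw [sqN_eq_zero.2 (funext h0)] at h3
    linarith
  obtain ⟨k, hk⟩ := h4
  have hsq : ∀ k, ε ^ 2 < |l k - x| ^ 2 := fun k => by
    have := hc k
    gcongr
  have h5 : ∑ k, ε ^ 2 * ‖(U *ᵥ v) k‖ ^ 2 < ∑ k, |l k - x| ^ 2 * ‖(U *ᵥ v) k‖ ^ 2 := by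
    refine Finset.sum_lt_sum (fun j _ => ?_) ⟨k, Finset.mem_univ k, ?_⟩
    · exact mul_le_mul_of_nonneg_right (hsq j).le (by positivity)
    · exact mul_lt_mul_of_pos_right (hsq k) (by positivity)
  rw [← Finset.mul_sum] at h5
  simp only [sqN, norm_mul, mul_pow, Complex.norm_real, Real.norm_eq_abs] at hres
  change ε ^ 2 * sqN (U *ᵥ v) < _ at h5
  rw [h3] at h5
  nlinarith [sq_nonneg ε]

lemma strictMono_fin_eq_id {d : ℕ} {k : Fin d → Fin d} (hk : StrictMono k) : k = id := by
  have : Set.range k = Set.range (id : Fin d → Fin d) := by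
    rw [Set.range_id, (Finite.injective_iff_surjective.1 hk.injective).range_eq]
  exact (hk.range_inj strictMono_id).1 this

lemma perturb_residual {d : ℕ} {l : Fin d → ℝ} (hl : StrictAnti l)
    (S R : Matrix (Fin d) (Fin d) ℂ) {s : Fin d → ℝ} (hs : ∀ i, S i i = (s i : ℂ)) (i : Fin d) :
    ∃ y q q' : Fin d → ℂ, y i = 0 ∧ ∀ t : ℝ,
      (rdiag l + (t : ℂ) • S + ((t : ℂ) ^ 2) • R) *ᵥ (Pi.single i 1 + (t : ℂ) • y)
        - ((l i + t * s i : ℝ) : ℂ) • (Pi.single i 1 + (t : ℂ) • y)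
      = ((t : ℂ) ^ 2) • (q + (t : ℂ) • q') := by
  refine ⟨fun j => if j = i then 0 else S j i / ((l i : ℂ) - l j),
    S *ᵥ (fun j => if j = i then 0 else S j i / ((l i : ℂ) - l j)) + R *ᵥ Pi.single i 1
      - (s i : ℂ) • (fun j => if j = i then 0 else S j i / ((l i : ℂ) - l j)),
    R *ᵥ (fun j => if j = i then 0 else S j i / ((l i : ℂ) - l j)), by simp, fun t => ?_⟩
  set y : Fin d → ℂ := fun j => if j = i then 0 else S j i / ((l i : ℂ) - l j) with hy
  have h1 : rdiag l *ᵥ y + S *ᵥ Pi.single i 1 = (l i : ℂ) • y + (s i : ℂ) • Pi.single i 1 := by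
    ext j
    simp only [Pi.add_apply, rdiag, mulVec_diagonal, mulVec_single_one, col_apply, Pi.smul_apply,
      smul_eq_mul]
    by_cases hj : j = i
    · subst hj; simp [hy, hs]
    · have hne : (l i : ℂ) - l j ≠ 0 := by
        rw [sub_ne_zero]
        exact_mod_cast hl.injective.ne (Ne.symm hj)
      simp only [hy, if_neg hj, Pi.single_eq_of_ne hj, mul_zero, add_zero]
      field_simp
      ring
  have h2 : rdiag l *ᵥ Pi.single i 1 = (l i : ℂ) • (Pi.single i 1 : Fin d → ℂ) := by
    ext j
    by_cases hj : j = i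
    · subst hj; simp [rdiag]
    · simp [rdiag, Pi.single_eq_of_ne hj]
  have h1' : rdiag l *ᵥ y = (l i : ℂ) • y + (s i : ℂ) • Pi.single i 1 - S *ᵥ Pi.single i 1 :=
    eq_sub_of_add_eq h1
  simp only [add_mulVec, mulVec_add, smul_mulVec, mulVec_smul, h1', h2]
  push_cast
  module

/-- First order perturbation theory for simple spectra. -/
lemma exists_abs_spec_sub_le {d : ℕ} {l : Fin d → ℝ} (hl : StrictAnti l)
    (S R : Matrix (Fin d) (Fin d) ℂ) {s : Fin d → ℝ} (hs : ∀ i, S i i = (s i : ℂ))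
    {μ : ℝ → Fin d → ℝ}
    (hμ : ∀ t : ℝ, IsSpecDown (rdiag l + (t : ℂ) • S + ((t : ℂ) ^ 2) • R) (μ t)) :
    ∃ C, ∀ᶠ t : ℝ in nhds 0, ∀ i, |μ t i - (l i + t * s i)| ≤ C * t ^ 2 := by
  choose y q q' hy hres using perturb_residual hl S R hs
  have hcont : ∀ i, Continuous fun t : ℝ => sqN (q i + (t : ℂ) • q' i) := fun i =>
    continuous_sqN.comp (by fun_prop)
  let C : ℝ := 1 + ∑ i, sqN (q i)
  have hsum : 0 ≤ ∑ i, sqN (q i) := Finset.sum_nonneg fun i _ => sqN_nonneg _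
  have hC : 1 ≤ C := le_add_of_nonneg_right hsum
  have hev : ∀ᶠ t : ℝ in nhds 0, ∀ i, sqN (q i + (t : ℂ) • q' i) < C ^ 2 := by
    refine eventually_all.2 fun i => (hcont i).continuousAt.eventually_lt continuousAt_const ?_
    have : sqN (q i) ≤ ∑ i, sqN (q i) :=
      Finset.single_le_sum (f := fun i => sqN (q i)) (fun i _ => sqN_nonneg _) (Finset.mem_univ i)
    simp only [Complex.ofReal_zero, zero_smul, add_zero]
    nlinarith
  have hgap : ∀ᶠ t : ℝ in nhds 0, ∀ i j, i < j →
      l j + t * s j + C * t ^ 2 < l i + t * s i - C * t ^ 2 := by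
    refine eventually_all.2 fun i => eventually_all.2 fun j => ?_
    by_cases hij : i < j
    · have h1 : ContinuousAt (fun t : ℝ => l j + t * s j + C * t ^ 2) 0 := by fun_prop
      have h2 : ContinuousAt (fun t : ℝ => l i + t * s i - C * t ^ 2) 0 := by fun_prop
      filter_upwards [h1.eventually_lt h2 (by simpa using hl hij)] with t ht _ using ht
    · exact Eventually.of_forall fun t h => absurd h hij
  refine ⟨C, ?_⟩
  filter_upwards [hev, hgap] with t ht hg
  have hex : ∀ i, ∃ k, |μ t k - (l i + t * s i)| ≤ C * t ^ 2 := fun i => by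
    refine (hμ t).exists_abs_sub_le (v := Pi.single i 1 + (t : ℂ) • y i) ?_ (by positivity) ?_
    · have : ‖(Pi.single i 1 + (t : ℂ) • y i : Fin d → ℂ) i‖ ^ 2 ≤
          sqN (Pi.single i 1 + (t : ℂ) • y i) :=
        Finset.single_le_sum (f := fun p => ‖(Pi.single i 1 + (t : ℂ) • y i : Fin d → ℂ) p‖ ^ 2)
          (fun _ _ => by positivity) (Finset.mem_univ i)
      simpa [hy] using this
    · rw [hres i t, sqN_smul, mul_pow, norm_pow, Complex.norm_real, Real.norm_eq_abs, sq_abs,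
        mul_comm]
      exact mul_le_mul_of_nonneg_right (ht i).le (by positivity)
  choose k hk using hex
  have hkm : StrictMono k := fun i j hij => by
    by_contra hc
    have h1 := (hμ t).1 (not_lt.1 hc)
    have h2 := abs_le.1 (hk i)
    have h3 := abs_le.1 (hk j)
    have h4 := hg i j hij
    linarith
  intro i
  have := hk i
  rwa [strictMono_fin_eq_id hkm] at this

end Perturbation

section ZeroWeights

open Matrix Filter

variable {a b c : ℕ}

/-- The three one-body marginals of a function of three variables. -/
def marg (f : Fin a × Fin b × Fin c → ℝ) : (Fin a → ℝ) × (Fin b → ℝ) × (Fin c → ℝ) :=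
  (fun i => ∑ j, ∑ k, f (i, j, k), fun j => ∑ i, ∑ k, f (i, j, k), fun k => ∑ i, ∑ j, f (i, j, k))

/-- The linear functional on triples of vectors with coefficients `x`, `y`, `w`. -/
def fnl (x : Fin a → ℝ) (y : Fin b → ℝ) (w : Fin c → ℝ) :
    ((Fin a → ℝ) × (Fin b → ℝ) × (Fin c → ℝ)) →ₗ[ℝ] ℝ where
  toFun lam := ∑ i, x i * lam.1 i + ∑ j, y j * lam.2.1 j + ∑ k, w k * lam.2.2 k
  map_add' l m := by
    simp only [Prod.fst_add, Prod.snd_add, Pi.add_apply, mul_add, Finset.sum_add_distrib]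
    ring
  map_smul' t l := by
    simp only [Prod.smul_fst, Prod.smul_snd, Pi.smul_apply, smul_eq_mul, RingHom.id_apply, mul_add,
      Finset.mul_sum, mul_left_comm]

lemma fnl_apply (x : Fin a → ℝ) (y : Fin b → ℝ) (w : Fin c → ℝ)
    (lam : (Fin a → ℝ) × (Fin b → ℝ) × (Fin c → ℝ)) :
    fnl x y w lam = ∑ i, x i * lam.1 i + ∑ j, y j * lam.2.1 j + ∑ k, w k * lam.2.2 k := rfl

lemma wtPair_eq_fnl (HA : Fin a → ℝ) (HB : Fin b → ℝ) (HC : Fin c → ℝ) (z : ℝ)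
    (lam : (Fin a → ℝ) × (Fin b → ℝ) × (Fin c → ℝ)) :
    wtPair HA HB HC z lam = fnl (fun i => HA i + z) HB HC lam := by
  simp only [wtPair, fnl_apply, add_mul, Finset.sum_add_distrib, Finset.mul_sum]
  ring

lemma fnl_marg (x : Fin a → ℝ) (y : Fin b → ℝ) (w : Fin c → ℝ)
    (f : Fin a × Fin b × Fin c → ℝ) :
    fnl x y w (marg f) = ∑ p, (x p.1 + y p.2.1 + w p.2.2) * f p := by
  simp only [fnl_apply, marg, Fintype.sum_prod_type, add_mul, Finset.sum_add_distrib,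
    Finset.mul_sum]
  congr 1
  · congr 1
    exact Finset.sum_comm
  · rw [Finset.sum_comm]
    exact Finset.sum_congr rfl fun i _ => Finset.sum_comm

lemma DiagMarg.eq_marg {ψ : Fin a × Fin b × Fin c → ℂ}
    {lam : (Fin a → ℝ) × (Fin b → ℝ) × (Fin c → ℝ)} (h : DiagMarg ψ lam) :
    lam = marg fun p => ‖ψ p‖ ^ 2 := by
  refine Prod.ext (funext fun i => ?_) (Prod.ext (funext fun i => ?_) (funext fun i => ?_))
  · have := congrFun (congrFun h.1 i) i
    simp only [rhoA, of_apply, rdiag, diagonal_apply_eq, Complex.mul_conj'] at this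
    exact_mod_cast this.symm
  · have := congrFun (congrFun h.2.1 i) i
    simp only [rhoB, of_apply, rdiag, diagonal_apply_eq, Complex.mul_conj'] at this
    exact_mod_cast this.symm
  · have := congrFun (congrFun h.2.2 i) i
    simp only [rhoC, of_apply, rdiag, diagonal_apply_eq, Complex.mul_conj'] at this
    exact_mod_cast this.symm

lemma sum_mul_le_of_abs_sub_le {d : ℕ} (H : Fin d → ℝ) {μ m : Fin d → ℝ} {δ : ℝ}
    (h : ∀ i, |μ i - m i| ≤ δ) : ∑ i, H i * μ i ≤ ∑ i, H i * m i + (∑ i, |H i|) * δ := by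
  rw [Finset.sum_mul, ← Finset.sum_add_distrib]
  refine Finset.sum_le_sum fun i _ => ?_
  have h1 : H i * (μ i - m i) ≤ |H i| * δ :=
    (le_abs_self _).trans ((abs_mul _ _).trans_le (mul_le_mul_of_nonneg_left (h i) (abs_nonneg _)))
  linarith

lemma mul_conj_expand (x y u v : ℂ) (t : ℝ) :
    (x + (t : ℂ) * u) * (starRingEnd ℂ) (y + (t : ℂ) * v) = x * (starRingEnd ℂ) y +
      (t : ℂ) * (x * (starRingEnd ℂ) v + u * (starRingEnd ℂ) y) +
      (t : ℂ) ^ 2 * (u * (starRingEnd ℂ) v) := by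
  rw [map_add, map_mul, Complex.conj_ofReal]; ring

lemma mul_conj_cross (x : ℂ) (κ : ℝ) :
    x * (starRingEnd ℂ) ((κ : ℂ) * x) + (κ : ℂ) * x * (starRingEnd ℂ) x
      = ((2 * (κ * ‖x‖ ^ 2) : ℝ) : ℂ) := by
  rw [map_mul, Complex.conj_ofReal, mul_left_comm, mul_assoc, Complex.mul_conj']
  push_cast; ring

lemma exists_spectra_path (ψ : Fin a × Fin b × Fin c → ℂ)
    {lam : (Fin a → ℝ) × (Fin b → ℝ) × (Fin c → ℝ)} (h : DiagMarg ψ lam)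
    (hA : StrictAnti lam.1) (hB : StrictAnti lam.2.1) (hC : StrictAnti lam.2.2)
    (κ : Fin a × Fin b × Fin c → ℝ) :
    ∃ (μ : ℝ → (Fin a → ℝ) × (Fin b → ℝ) × (Fin c → ℝ)) (C : ℝ), (∀ t, μ t ∈ KronCone a b c) ∧
      ∀ᶠ t : ℝ in nhds 0,
        (∀ i, |(μ t).1 i - (lam + t • marg fun p => 2 * (κ p * ‖ψ p‖ ^ 2)).1 i| ≤ C * t ^ 2) ∧
        (∀ i, |(μ t).2.1 i - (lam + t • marg fun p => 2 * (κ p * ‖ψ p‖ ^ 2)).2.1 i| ≤ C * t ^ 2) ∧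
        ∀ i, |(μ t).2.2 i - (lam + t • marg fun p => 2 * (κ p * ‖ψ p‖ ^ 2)).2.2 i| ≤ C * t ^ 2 := by
  set X : Fin a × Fin b × Fin c → ℂ := fun p => (κ p : ℂ) * ψ p with hX
  choose μA hμA using fun t : ℝ => exists_isSpecDown (rhoA_isHermitian (ψ + (t : ℂ) • X))
  choose μB hμB using fun t : ℝ => exists_isSpecDown (rhoB_isHermitian (ψ + (t : ℂ) • X))
  choose μC hμC using fun t : ℝ => exists_isSpecDown (rhoC_isHermitian (ψ + (t : ℂ) • X))
  obtain ⟨CA, hCA⟩ := exists_abs_spec_sub_le hA (Matrix.of fun i i' => ∑ j, ∑ k,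
      (ψ (i, j, k) * (starRingEnd ℂ) (X (i', j, k)) + X (i, j, k) * (starRingEnd ℂ) (ψ (i', j, k))))
      (rhoA X) (s := (marg fun p => 2 * (κ p * ‖ψ p‖ ^ 2)).1) (fun i => by
        simp only [of_apply, hX, mul_conj_cross, marg]
        push_cast; rfl) (μ := μA) (fun t => by
        convert hμA t using 1
        rw [← h.1]
        ext i i'
        simp only [rhoA, of_apply, Matrix.add_apply, Matrix.smul_apply, Pi.add_apply, Pi.smul_apply,
          smul_eq_mul, mul_conj_expand, Finset.sum_add_distrib, Finset.mul_sum, mul_add])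
  obtain ⟨CB, hCB⟩ := exists_abs_spec_sub_le hB (Matrix.of fun j j' => ∑ i, ∑ k,
      (ψ (i, j, k) * (starRingEnd ℂ) (X (i, j', k)) + X (i, j, k) * (starRingEnd ℂ) (ψ (i, j', k))))
      (rhoB X) (s := (marg fun p => 2 * (κ p * ‖ψ p‖ ^ 2)).2.1) (fun i => by
        simp only [of_apply, hX, mul_conj_cross, marg]
        push_cast; rfl) (μ := μB) (fun t => by
        convert hμB t using 1
        rw [← h.2.1]
        ext i i'
        simp only [rhoB, of_apply, Matrix.add_apply, Matrix.smul_apply, Pi.add_apply, Pi.smul_apply,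
          smul_eq_mul, mul_conj_expand, Finset.sum_add_distrib, Finset.mul_sum, mul_add])
  obtain ⟨CC, hCC⟩ := exists_abs_spec_sub_le hC (Matrix.of fun k k' => ∑ i, ∑ j,
      (ψ (i, j, k) * (starRingEnd ℂ) (X (i, j, k')) + X (i, j, k) * (starRingEnd ℂ) (ψ (i, j, k'))))
      (rhoC X) (s := (marg fun p => 2 * (κ p * ‖ψ p‖ ^ 2)).2.2) (fun i => by
        simp only [of_apply, hX, mul_conj_cross, marg]
        push_cast; rfl) (μ := μC) (fun t => by
        convert hμC t using 1
        rw [← h.2.2]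
        ext i i'
        simp only [rhoC, of_apply, Matrix.add_apply, Matrix.smul_apply, Pi.add_apply, Pi.smul_apply,
          smul_eq_mul, mul_conj_expand, Finset.sum_add_distrib, Finset.mul_sum, mul_add])
  refine ⟨fun t => (μA t, μB t, μC t), max CA (max CB CC),
    fun t => ⟨_, hμA t, hμB t, hμC t⟩, ?_⟩
  filter_upwards [hCA, hCB, hCC] with t h1 h2 h3
  exact ⟨fun i => (h1 i).trans (mul_le_mul_of_nonneg_right (le_max_left _ _) (sq_nonneg t)),
    fun i => (h2 i).trans (mul_le_mul_of_nonneg_right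
      ((le_max_left _ _).trans (le_max_right _ _)) (sq_nonneg t)),
    fun i => (h3 i).trans (mul_le_mul_of_nonneg_right
      ((le_max_right _ _).trans (le_max_right _ _)) (sq_nonneg t))⟩

/-- A state over a regular boundary point is supported on the zero weights. -/
lemma weight_eq_zero_of_regular {ψ : Fin a × Fin b × Fin c → ℂ}
    {lam : (Fin a → ℝ) × (Fin b → ℝ) × (Fin c → ℝ)} (h : DiagMarg ψ lam)
    (hA : StrictAnti lam.1) (hB : StrictAnti lam.2.1) (hC : StrictAnti lam.2.2)
    {x : Fin a → ℝ} {y : Fin b → ℝ} {w : Fin c → ℝ}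
    (hnn : ∀ mu ∈ KronCone a b c, 0 ≤ fnl x y w mu) (h0 : fnl x y w lam = 0)
    {p : Fin a × Fin b × Fin c} (hp : ψ p ≠ 0) : x p.1 + y p.2.1 + w p.2.2 = 0 := by
  set κ : Fin a × Fin b × Fin c → ℝ := fun p => x p.1 + y p.2.1 + w p.2.2 with hκ
  obtain ⟨μ, C, hμ, hev⟩ := exists_spectra_path ψ h hA hB hC κ
  set Q := ∑ p, κ p * (2 * (κ p * ‖ψ p‖ ^ 2)) with hQ
  set K := (∑ i, |x i| + ∑ j, |y j| + ∑ k, |w k|) * C with hK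
  have hev' : ∀ᶠ t : ℝ in nhds 0, 0 ≤ t * (Q + K * t) := by
    filter_upwards [hev] with t ht
    have h1 := hnn _ (hμ t)
    have h2 : fnl x y w (lam + t • marg fun p => 2 * (κ p * ‖ψ p‖ ^ 2)) = t * Q := by
      rw [map_add, map_smul, h0, zero_add, fnl_marg, smul_eq_mul]
    have h3 := sum_mul_le_of_abs_sub_le x ht.1
    have h4 := sum_mul_le_of_abs_sub_le y ht.2.1
    have h5 := sum_mul_le_of_abs_sub_le w ht.2.2
    rw [fnl_apply] at h1 h2
    have e : t * (Q + K * t) = t * Q + (∑ i, |x i|) * (C * t ^ 2) + (∑ j, |y j|) * (C * t ^ 2)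
        + (∑ k, |w k|) * (C * t ^ 2) := by rw [hK]; ring
    rw [e]
    linarith
  have hterm : ∀ p, 0 ≤ κ p * (2 * (κ p * ‖ψ p‖ ^ 2)) := fun p => by
    have : κ p * (2 * (κ p * ‖ψ p‖ ^ 2)) = 2 * (κ p ^ 2 * ‖ψ p‖ ^ 2) := by ring
    rw [this]; positivity
  have hQ0 : Q = 0 := by
    refine le_antisymm ?_ (Finset.sum_nonneg fun p _ => hterm p)
    by_contra hc
    push Not at hc
    have hcont : ContinuousAt (fun t : ℝ => Q + K * t) 0 := by fun_prop
    have hpos : ∀ᶠ t : ℝ in nhds 0, 0 < Q + K * t :=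
      continuousAt_const.eventually_lt hcont (by simpa using hc)
    obtain ⟨t, ⟨h1, h2⟩, h3⟩ := (((hev'.and hpos).filter_mono
      (nhdsWithin_le_nhds (s := Set.Iio 0))).and self_mem_nhdsWithin).exists
    have h3' : t < 0 := h3
    nlinarith
  have h1 := (Finset.sum_eq_zero_iff_of_nonneg fun p _ => hterm p).1 hQ0 p (Finset.mem_univ p)
  have hn : ‖ψ p‖ ^ 2 ≠ 0 := by positivity
  have h2 : κ p = 0 := by
    simp only [mul_eq_zero, hn, or_false, two_ne_zero, false_or, or_self] at h1
    exact h1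
  exact h2

end ZeroWeights

section Facet

open Matrix

variable {a b c : ℕ}

/-- The points of the Kronecker cone at which `(H, z)` vanishes. -/
def face (HA : Fin a → ℝ) (HB : Fin b → ℝ) (HC : Fin c → ℝ) (z : ℝ) :
    Set ((Fin a → ℝ) × (Fin b → ℝ) × (Fin c → ℝ)) :=
  {lam ∈ KronCone a b c | wtPair HA HB HC z lam = 0}

lemma fnl_comb (x : Fin a → ℝ) (y : Fin b → ℝ) (w : Fin c → ℝ) (t p q : ℝ) :
    t • fnl x y w + p • fnl 1 (-1) 0 + q • fnl 1 0 (-1) =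
      fnl (fun i => t * x i + p + q) (fun j => t * y j - p) (fun k => t * w k - q) := by
  refine LinearMap.ext fun lam => ?_
  simp only [LinearMap.add_apply, LinearMap.smul_apply, fnl_apply, smul_eq_mul, Pi.one_apply,
    Pi.neg_apply, Pi.zero_apply, one_mul, neg_mul, zero_mul, Finset.sum_const_zero,
    Finset.sum_neg_distrib, add_mul, sub_mul, Finset.sum_add_distrib, Finset.sum_sub_distrib,
    mul_add, Finset.mul_sum, mul_neg, mul_assoc, mul_zero]
  ring

lemma fnl_injective {x x' : Fin a → ℝ} {y y' : Fin b → ℝ} {w w' : Fin c → ℝ}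
    (h : fnl x y w = fnl x' y' w') : x = x' ∧ y = y' ∧ w = w' := by
  refine ⟨funext fun i => ?_, funext fun j => ?_, funext fun k => ?_⟩
  · simpa [fnl_apply, Pi.single_apply] using LinearMap.congr_fun h (Pi.single i 1, 0, 0)
  · simpa [fnl_apply, Pi.single_apply] using LinearMap.congr_fun h (0, Pi.single j 1, 0)
  · simpa [fnl_apply, Pi.single_apply] using LinearMap.congr_fun h (0, 0, Pi.single k 1)

lemma sum_eq_of_mem_kronCone {lam : (Fin a → ℝ) × (Fin b → ℝ) × (Fin c → ℝ)}
    (h : lam ∈ KronCone a b c) :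
    ∑ i, lam.1 i = ∑ j, lam.2.1 j ∧ ∑ i, lam.1 i = ∑ k, lam.2.2 k := by
  obtain ⟨ψ, hψ⟩ := exists_diagMarg_of_mem_kronCone h
  obtain ⟨h1, h2, h3⟩ := hψ.sum_eq
  exact ⟨h1.trans h2.symm, h1.trans h3.symm⟩

lemma mem_dualAnnihilator_of_face {HA : Fin a → ℝ} {HB : Fin b → ℝ} {HC : Fin c → ℝ} {z : ℝ}
    {f : Module.Dual ℝ ((Fin a → ℝ) × (Fin b → ℝ) × (Fin c → ℝ))}
    (h : ∀ lam ∈ face HA HB HC z, f lam = 0) :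
    f ∈ (affineSpan ℝ (face HA HB HC z)).direction.dualAnnihilator := by
  rw [Submodule.mem_dualAnnihilator]
  suffices (affineSpan ℝ (face HA HB HC z)).direction ≤ LinearMap.ker f from
    fun w hw => LinearMap.mem_ker.1 (this hw)
  rw [direction_affineSpan, vectorSpan_def, Submodule.span_le]
  rintro _ ⟨l, hl, m, hm, rfl⟩
  simp [h l hl, h m hm]

/-- Functionals vanishing on a facet are combinations of its normal and of the trace
relations. -/
lemma IsFacetNormal.exists_coeff {HA : Fin a → ℝ} {HB : Fin b → ℝ} {HC : Fin c → ℝ} {z : ℝ}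
    (hf : IsFacetNormal a b c HA HB HC z) (ha : 0 < a) (hb : 0 < b) (hc : 0 < c)
    {x : Fin a → ℝ} {y : Fin b → ℝ} {w : Fin c → ℝ}
    (h : ∀ lam ∈ face HA HB HC z, fnl x y w lam = 0) :
    ∃ t p q : ℝ, (∀ i, x i = t * (HA i + z) + p + q) ∧ (∀ j, y j = t * HB j - p) ∧
      ∀ k, w k = t * HC k - q := by
  obtain ⟨⟨hA, hB, hC⟩, hne, -, hdim⟩ := hf
  change Module.finrank ℝ (affineSpan ℝ (face HA HB HC z)).direction = _ at hdim
  set W := (affineSpan ℝ (face HA HB HC z)).direction with hW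
  set v : Fin 3 → Module.Dual ℝ ((Fin a → ℝ) × (Fin b → ℝ) × (Fin c → ℝ)) :=
    ![fnl (fun i => HA i + z) HB HC, fnl 1 (-1) 0, fnl 1 0 (-1)] with hv
  have hvW : ∀ m, v m ∈ W.dualAnnihilator := by
    intro m
    refine mem_dualAnnihilator_of_face fun lam hl => ?_
    have h1 := sum_eq_of_mem_kronCone hl.1
    have h2 : wtPair HA HB HC z lam = 0 := hl.2
    rw [wtPair_eq_fnl] at h2
    fin_cases m
    · exact h2
    · simp [hv, fnl_apply, h1.1]
    · simp [hv, fnl_apply, h1.2]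
  have hsum : ∀ t p q : ℝ, ∑ m, ![t, p, q] m • v m = fnl (fun i => t * (HA i + z) + p + q)
      (fun j => t * HB j - p) (fun k => t * HC k - q) := by
    intro t p q
    rw [← fnl_comb, Fin.sum_univ_three]
    rfl
  have hli : LinearIndependent ℝ v := by
    rw [Fintype.linearIndependent_iff]
    intro g hg
    have e : g = ![g 0, g 1, g 2] := by
      ext m; fin_cases m <;> rfl
    have h0 : (0 : Module.Dual ℝ ((Fin a → ℝ) × (Fin b → ℝ) × (Fin c → ℝ))) = fnl 0 0 0 :=
      LinearMap.ext fun lam => by simp [fnl_apply]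
    rw [e, hsum, h0] at hg
    obtain ⟨h1, h2, h3⟩ := fnl_injective hg
    have hp : g 1 = 0 := by
      have := congrArg (fun f => ∑ j, f j) h2
      simpa [← Finset.mul_sum, hB, hb.ne'] using this
    have hq : g 2 = 0 := by
      have := congrArg (fun f => ∑ j, f j) h3
      simpa [← Finset.mul_sum, hC, hc.ne'] using this
    have ht : g 0 = 0 := by
      by_contra ht
      have hz : z = 0 := by
        have := congrArg (fun f => ∑ j, f j) h1
        simpa [← Finset.mul_sum, Finset.sum_add_distrib, hA, ha.ne', hp, hq, ht] using this
      refine hne ⟨funext fun i => ?_, funext fun i => ?_, funext fun i => ?_, hz⟩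
      · simpa [hp, hq, hz, ht] using congrFun h1 i
      · simpa [hp, hq, hz, ht] using congrFun h2 i
      · simpa [hp, hq, hz, ht] using congrFun h3 i
    intro m
    fin_cases m
    · exact ht
    · exact hp
    · exact hq
  have hfin : Module.finrank ℝ W.dualAnnihilator = 3 := by
    have h1 := Subspace.finrank_add_finrank_dualAnnihilator_eq W
    rw [hdim] at h1
    simp only [Module.finrank_prod, Module.finrank_fintype_fun_eq_card, Fintype.card_fin] at h1
    omega
  have hspan : Submodule.span ℝ (Set.range v) = W.dualAnnihilator := by
    refine Submodule.eq_of_le_of_finrank_eq (Submodule.span_le.2 ?_) ?_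
    · rintro _ ⟨m, rfl⟩
      exact hvW m
    · rw [finrank_span_eq_card hli, hfin, Fintype.card_fin]
  have hmem := mem_dualAnnihilator_of_face h
  rw [← hW, ← hspan, Submodule.mem_span_range_iff_exists_fun] at hmem
  obtain ⟨g, hg⟩ := hmem
  have e : g = ![g 0, g 1, g 2] := by
    ext m; fin_cases m <;> rfl
  rw [e, hsum] at hg
  obtain ⟨h1, h2, h3⟩ := fnl_injective hg
  exact ⟨g 0, g 1, g 2, fun i => (congrFun h1 i).symm, fun i => (congrFun h2 i).symm,
    fun i => (congrFun h3 i).symm⟩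

lemma IsFacetNormal.exists_smul {HA : Fin a → ℝ} {HB : Fin b → ℝ} {HC : Fin c → ℝ} {z : ℝ}
    (hf : IsFacetNormal a b c HA HB HC z) (ha : 0 < a) (hb : 0 < b) (hc : 0 < c)
    {x : Fin a → ℝ} {y : Fin b → ℝ} {w : Fin c → ℝ} (hx : ∑ i, x i = 0) (hy : ∑ j, y j = 0)
    (hw : ∑ k, w k = 0) (h : ∀ lam ∈ face HA HB HC z, fnl x y w lam = 0) :
    ∃ t : ℝ, x = t • HA ∧ y = t • HB ∧ w = t • HC ∧ t * z = 0 := by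
  obtain ⟨t, p, q, h1, h2, h3⟩ := hf.exists_coeff ha hb hc h
  obtain ⟨⟨hA, hB, hC⟩, -⟩ := hf
  have hp : p = 0 := by
    simp only [h2, Finset.sum_sub_distrib, ← Finset.mul_sum, hB] at hy
    simpa [hb.ne'] using hy
  have hq : q = 0 := by
    simp only [h3, Finset.sum_sub_distrib, ← Finset.mul_sum, hC] at hw
    simpa [hc.ne'] using hw
  have hz : t * z = 0 := by
    simp only [h1, hp, hq, add_zero, ← Finset.mul_sum, Finset.sum_add_distrib, hA] at hx
    simpa [ha.ne'] using hx
  refine ⟨t, funext fun i => ?_, funext fun i => ?_, funext fun i => ?_, hz⟩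
  · rw [h1, hp, hq, Pi.smul_apply, smul_eq_mul]; linarith
  · rw [h2, hp, Pi.smul_apply, smul_eq_mul]; ring
  · rw [h3, hq, Pi.smul_apply, smul_eq_mul]; ring

end Facet

section RegularPoints

open Matrix

variable {a b c : ℕ}

lemma exists_mem_kronCone_strictAnti_fst (hb : 0 < b) (hac : a ≤ c) :
    ∃ lam ∈ KronCone a b c, StrictAnti lam.1 := by
  set f : Fin a → Fin b × Fin c := fun i => (⟨0, hb⟩, Fin.castLE hac i) with hf
  have hinj : Function.Injective f := fun i i' h => by simpa [hf] using h
  set r : Fin a → ℝ := fun i => (a : ℝ) - i with hr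
  have hanti : StrictAnti r := fun i i' h => by
    have : ((i : ℕ) : ℝ) < (i' : ℕ) := by exact_mod_cast h
    simp only [hr]; linarith
  have hr0 : ∀ i, 0 ≤ r i := fun i => by
    have : ((i : ℕ) : ℝ) < a := by exact_mod_cast i.2
    simp only [hr]; linarith
  set ψ : Fin a × Fin b × Fin c → ℂ :=
    fun p => if p.2 = f p.1 then ((Real.sqrt (r p.1) : ℝ) : ℂ) else 0 with hψ
  have hA : rhoA ψ = rdiag r := by
    ext i i'
    simp only [rhoA, of_apply, rdiag, diagonal_apply]
    rw [← Fintype.sum_prod_type' (fun j k => ψ (i, j, k) * (starRingEnd ℂ) (ψ (i', j, k))),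
      Finset.sum_eq_single (f i) (fun q _ hq => by simp [hψ, hq]) (by simp)]
    by_cases h : i = i'
    · subst h
      simp only [hψ, Prod.mk.eta, if_true, Complex.conj_ofReal]
      exact_mod_cast Real.mul_self_sqrt (hr0 i)
    · have h' : f i ≠ f i' := fun e => h (hinj e)
      simp [hψ, h, h']
  obtain ⟨m, hm⟩ := exists_isSpecDown (rhoB_isHermitian ψ)
  obtain ⟨n, hn⟩ := exists_isSpecDown (rhoC_isHermitian ψ)
  exact ⟨(r, m, n), ⟨ψ, isSpecDown_of_conj (U := 1) (by simp) (rhoA_isHermitian ψ) (by simp [hA])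
    hanti.antitone, hm, hn⟩, hanti⟩

lemma exists_mem_kronCone_strictAnti_snd (ha : 0 < a) (hbc : b ≤ c) :
    ∃ lam ∈ KronCone a b c, StrictAnti lam.2.1 := by
  set f : Fin b → Fin a × Fin c := fun i => (⟨0, ha⟩, Fin.castLE hbc i) with hf
  have hinj : Function.Injective f := fun i i' h => by simpa [hf] using h
  set r : Fin b → ℝ := fun i => (b : ℝ) - i with hr
  have hanti : StrictAnti r := fun i i' h => by
    have : ((i : ℕ) : ℝ) < (i' : ℕ) := by exact_mod_cast h
    simp only [hr]; linarith
  have hr0 : ∀ i, 0 ≤ r i := fun i => by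
    have : ((i : ℕ) : ℝ) < b := by exact_mod_cast i.2
    simp only [hr]; linarith
  set ψ : Fin a × Fin b × Fin c → ℂ :=
    fun p => if (p.1, p.2.2) = f p.2.1 then ((Real.sqrt (r p.2.1) : ℝ) : ℂ) else 0 with hψ
  have hB : rhoB ψ = rdiag r := by
    ext i i'
    simp only [rhoB, of_apply, rdiag, diagonal_apply]
    rw [← Fintype.sum_prod_type' (fun j k => ψ (j, i, k) * (starRingEnd ℂ) (ψ (j, i', k))),
      Finset.sum_eq_single (f i) (fun q _ hq => by simp [hψ, hq]) (by simp)]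
    by_cases h : i = i'
    · subst h
      simp only [hψ, Prod.mk.eta, if_true, Complex.conj_ofReal]
      exact_mod_cast Real.mul_self_sqrt (hr0 i)
    · have h' : f i ≠ f i' := fun e => h (hinj e)
      simp [hψ, h, h']
  obtain ⟨m, hm⟩ := exists_isSpecDown (rhoA_isHermitian ψ)
  obtain ⟨n, hn⟩ := exists_isSpecDown (rhoC_isHermitian ψ)
  exact ⟨(m, r, n), ⟨ψ, hm, isSpecDown_of_conj (U := 1) (by simp) (rhoB_isHermitian ψ)
    (by simp [hB]) hanti.antitone, hn⟩, hanti⟩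

lemma fnl_wall_fst (i i' : Fin a) (lam : (Fin a → ℝ) × (Fin b → ℝ) × (Fin c → ℝ)) :
    fnl (Pi.single i 1 - Pi.single i' 1) 0 0 lam = lam.1 i - lam.1 i' := by
  simp [fnl_apply, sub_mul, Pi.single_apply]

lemma fnl_wall_snd (i i' : Fin b) (lam : (Fin a → ℝ) × (Fin b → ℝ) × (Fin c → ℝ)) :
    fnl 0 (Pi.single i 1 - Pi.single i' 1) 0 lam = lam.2.1 i - lam.2.1 i' := by
  simp [fnl_apply, sub_mul, Pi.single_apply]

lemma fnl_wall_thd (i i' : Fin c) (lam : (Fin a → ℝ) × (Fin b → ℝ) × (Fin c → ℝ)) :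
    fnl 0 0 (Pi.single i 1 - Pi.single i' 1) lam = lam.2.2 i - lam.2.2 i' := by
  simp [fnl_apply, sub_mul, Pi.single_apply]

lemma fnl_single_thd (k : Fin c) (lam : (Fin a → ℝ) × (Fin b → ℝ) × (Fin c → ℝ)) :
    fnl 0 0 (Pi.single k 1) lam = lam.2.2 k := by
  simp [fnl_apply, Pi.single_apply]

lemma sum_single_sub_single {d : ℕ} (i i' : Fin d) :
    ∑ j, (Pi.single i 1 - Pi.single i' 1 : Fin d → ℝ) j = 0 := by
  simp

lemma single_sub_single_ne_zero {d : ℕ} {i i' : Fin d} (h : i < i') :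
    (Pi.single i 1 - Pi.single i' 1 : Fin d → ℝ) ≠ 0 := fun e => by
  simpa [h.ne] using congrFun e i

lemma zero_mem_face (HA : Fin a → ℝ) (HB : Fin b → ℝ) (HC : Fin c → ℝ) (z : ℝ) :
    0 ∈ face HA HB HC z := ⟨zero_mem_kronCone, by rw [wtPair_eq_fnl, map_zero]⟩

variable {HA : Fin a → ℝ} {HB : Fin b → ℝ} {HC : Fin c → ℝ} {z : ℝ}

lemma add_mem_face {lam mu : (Fin a → ℝ) × (Fin b → ℝ) × (Fin c → ℝ)}
    (h : lam ∈ face HA HB HC z) (h' : mu ∈ face HA HB HC z) : lam + mu ∈ face HA HB HC z := by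
  refine ⟨add_mem_kronCone h.1 h'.1, ?_⟩
  have h1 := h.2
  have h2 := h'.2
  rw [wtPair_eq_fnl] at *
  rw [map_add, h1, h2, add_zero]

lemma exists_mem_face_forall_pos {ι : Type*} [Fintype ι]
    (g : ι → ((Fin a → ℝ) × (Fin b → ℝ) × (Fin c → ℝ)) →ₗ[ℝ] ℝ)
    (hnn : ∀ m, ∀ lam ∈ KronCone a b c, 0 ≤ g m lam)
    (h : ∀ m, ¬ ∀ lam ∈ face HA HB HC z, g m lam = 0) :
    ∃ lam ∈ face HA HB HC z, ∀ m, 0 < g m lam := by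
  classical
  push Not at h
  choose l hl hg using h
  have hpos : ∀ m, 0 < g m (l m) := fun m => (hnn m _ (hl m).1).lt_of_ne (hg m).symm
  have hmem : ∀ s : Finset ι, ∑ m ∈ s, l m ∈ face HA HB HC z := fun s => by
    induction s using Finset.induction_on with
    | empty => exact zero_mem_face ..
    | insert m s hm ih => rw [Finset.sum_insert hm]; exact add_mem_face (hl m) ih
  refine ⟨∑ m, l m, hmem _, fun m => ?_⟩
  rw [map_sum]
  exact Finset.sum_pos' (fun n _ => hnn m _ (hl n).1) ⟨m, Finset.mem_univ m, hpos m⟩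

lemma exists_regular_mem_face (ha : 0 < a) (hb : 0 < b) (hac : a ≤ c) (hbc : b ≤ c)
    (hf : IsFacetNormal a b c HA HB HC z) (hnt : ¬ IsTrivialNormal HA HB HC z)
    (hne : ¬ (HA = 0 ∧ HB = 0)) :
    ∃ lam ∈ face HA HB HC z, StrictAnti lam.1 ∧ StrictAnti lam.2.1 ∧ StrictAnti lam.2.2 ∧
      ∀ k, 0 < lam.2.2 k := by
  have hc : 0 < c := ha.trans_le hac
  have hnn := hf.2.2.1
  obtain ⟨l₁, hl₁, h₁⟩ := exists_mem_face_forall_pos (HA := HA) (HB := HB) (HC := HC) (z := z)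
    (fun m : {p : Fin a × Fin a // p.1 < p.2} =>
      fnl (Pi.single m.1.1 1 - Pi.single m.1.2 1) (0 : Fin b → ℝ) (0 : Fin c → ℝ))
    (fun m lam hl => by
      rw [fnl_wall_fst]; exact sub_nonneg.2 ((antitone_of_mem_kronCone hl).1 m.2.le))
    (by
      rintro ⟨⟨i, i'⟩, hi⟩ hv
      obtain ⟨t, hx, hy, hw, hz⟩ := hf.exists_smul ha hb hc (sum_single_sub_single i i')
        (by simp) (by simp) hv
      have ht : t ≠ 0 := by
        rintro rfl
        exact single_sub_single_ne_zero hi (by simpa using hx)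
      have hA : HA = t⁻¹ • (Pi.single i 1 - Pi.single i' 1) := by
        rw [hx, smul_smul, inv_mul_cancel₀ ht, one_smul]
      have hB : HB = 0 := (smul_eq_zero.1 hy.symm).resolve_left ht
      have hC : HC = 0 := (smul_eq_zero.1 hw.symm).resolve_left ht
      have hz0 : z = 0 := (mul_eq_zero.1 hz).resolve_left ht
      rcases lt_or_gt_of_ne ht with h | h
      · obtain ⟨lam, hlam, hanti⟩ := exists_mem_kronCone_strictAnti_fst hb hac
        have h1 := hnn lam hlam
        have h2 := hanti hi
        have h3 : wtPair HA HB HC z lam = t⁻¹ * (lam.1 i - lam.1 i') := by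
          simp [wtPair, hA, hB, hC, hz0, sub_mul, mul_sub, Pi.single_apply]
        rw [h3] at h1
        nlinarith [inv_lt_zero.2 h]
      · exact hnt ⟨t⁻¹, inv_pos.2 h, Or.inl ⟨i, i', hi, hA, hB, hC, hz0⟩⟩)
  obtain ⟨l₂, hl₂, h₂⟩ := exists_mem_face_forall_pos (HA := HA) (HB := HB) (HC := HC) (z := z)
    (fun m : {p : Fin b × Fin b // p.1 < p.2} =>
      fnl (0 : Fin a → ℝ) (Pi.single m.1.1 1 - Pi.single m.1.2 1) (0 : Fin c → ℝ))
    (fun m lam hl => by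
      rw [fnl_wall_snd]; exact sub_nonneg.2 ((antitone_of_mem_kronCone hl).2.1 m.2.le))
    (by
      rintro ⟨⟨i, i'⟩, hi⟩ hv
      obtain ⟨t, hx, hy, hw, hz⟩ := hf.exists_smul ha hb hc (by simp) (sum_single_sub_single i i')
        (by simp) hv
      have ht : t ≠ 0 := by
        rintro rfl
        exact single_sub_single_ne_zero hi (by simpa using hy)
      have hB : HB = t⁻¹ • (Pi.single i 1 - Pi.single i' 1) := by
        rw [hy, smul_smul, inv_mul_cancel₀ ht, one_smul]
      have hA : HA = 0 := (smul_eq_zero.1 hx.symm).resolve_left ht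
      have hC : HC = 0 := (smul_eq_zero.1 hw.symm).resolve_left ht
      have hz0 : z = 0 := (mul_eq_zero.1 hz).resolve_left ht
      rcases lt_or_gt_of_ne ht with h | h
      · obtain ⟨lam, hlam, hanti⟩ := exists_mem_kronCone_strictAnti_snd ha hbc
        have h1 := hnn lam hlam
        have h2 := hanti hi
        have h3 : wtPair HA HB HC z lam = t⁻¹ * (lam.2.1 i - lam.2.1 i') := by
          simp [wtPair, hA, hB, hC, hz0, sub_mul, mul_sub, Pi.single_apply]
        rw [h3] at h1
        nlinarith [inv_lt_zero.2 h]
      · exact hnt ⟨t⁻¹, inv_pos.2 h, Or.inr (Or.inl ⟨i, i', hi, hB, hA, hC, hz0⟩)⟩)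
  obtain ⟨l₃, hl₃, h₃⟩ := exists_mem_face_forall_pos (HA := HA) (HB := HB) (HC := HC) (z := z)
    (fun m : {p : Fin c × Fin c // p.1 < p.2} =>
      fnl (0 : Fin a → ℝ) (0 : Fin b → ℝ) (Pi.single m.1.1 1 - Pi.single m.1.2 1))
    (fun m lam hl => by
      rw [fnl_wall_thd]; exact sub_nonneg.2 ((antitone_of_mem_kronCone hl).2.2 m.2.le))
    (by
      rintro ⟨⟨i, i'⟩, hi⟩ hv
      obtain ⟨t, hx, hy, hw, hz⟩ := hf.exists_smul ha hb hc (by simp) (by simp)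
        (sum_single_sub_single i i') hv
      have ht : t ≠ 0 := by
        rintro rfl
        exact single_sub_single_ne_zero hi (by simpa using hw)
      exact hne ⟨(smul_eq_zero.1 hx.symm).resolve_left ht,
        (smul_eq_zero.1 hy.symm).resolve_left ht⟩)
  have hpos : ∀ lam ∈ KronCone a b c, ∀ k, 0 ≤ lam.2.2 k := fun lam hl k => by
    obtain ⟨ψ, hψ⟩ := exists_diagMarg_of_mem_kronCone hl
    rw [hψ.eq_marg]
    simp only [marg]
    positivity
  obtain ⟨l₄, hl₄, h₄⟩ := exists_mem_face_forall_pos (HA := HA) (HB := HB) (HC := HC) (z := z)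
    (fun k : Fin c => fnl (0 : Fin a → ℝ) (0 : Fin b → ℝ) (Pi.single k 1))
    (fun k lam hl => by rw [fnl_single_thd]; exact hpos lam hl k)
    (by
      intro k hv
      obtain ⟨t, p, q, hx, hy, hw⟩ := hf.exists_coeff ha hb hc hv
      obtain ⟨⟨hA, hB, -⟩, -⟩ := hf
      have hp : p = 0 := by
        have : ∑ j, (t * HB j - p) = 0 := Finset.sum_eq_zero fun j _ => (hy j).symm
        rw [Finset.sum_sub_distrib, ← Finset.mul_sum, hB] at this
        simpa [hb.ne'] using this
      by_cases ht : t = 0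
      · have h1 := hx ⟨0, ha⟩
        have h2 := hw k
        simp only [ht, hp, zero_mul, zero_add, zero_sub, Pi.zero_apply, Pi.single_eq_same] at h1 h2
        linarith
      · have hsum : t * z + q = 0 := by
          have : ∑ i, (t * (HA i + z) + p + q) = 0 := Finset.sum_eq_zero fun i _ => (hx i).symm
          simp only [hp, add_zero, mul_add, Finset.sum_add_distrib, ← Finset.mul_sum, hA] at this
          simp only [mul_zero, zero_add, Finset.sum_const, Finset.card_univ, Fintype.card_fin,
            nsmul_eq_mul] at this
          have ha' : (a : ℝ) ≠ 0 := by exact_mod_cast ha.ne'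
          refine mul_left_cancel₀ ha' ?_
          linarith
        refine hne ⟨funext fun i => ?_, funext fun j => ?_⟩
        · have h1 := hx i
          have h2 : t * HA i = 0 := by
            simp only [Pi.zero_apply] at h1
            linarith
          exact (mul_eq_zero.1 h2).resolve_left ht
        · have h1 := hy j
          simp only [hp, sub_zero, Pi.zero_apply] at h1
          exact (mul_eq_zero.1 h1.symm).resolve_left ht)
  have hA := fun {l} (hl : l ∈ face HA HB HC z) => antitone_of_mem_kronCone hl.1
  refine ⟨l₁ + l₂ + l₃ + l₄,
    add_mem_face (add_mem_face (add_mem_face hl₁ hl₂) hl₃) hl₄, fun i i' h => ?_,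
    fun i i' h => ?_, fun i i' h => ?_, fun k => ?_⟩
  · have := h₁ ⟨(i, i'), h⟩
    rw [fnl_wall_fst] at this
    have e₂ := (hA hl₂).1 h.le
    have e₃ := (hA hl₃).1 h.le
    have e₄ := (hA hl₄).1 h.le
    simp only [Prod.fst_add, Pi.add_apply]
    linarith
  · have := h₂ ⟨(i, i'), h⟩
    rw [fnl_wall_snd] at this
    have e₁ := (hA hl₁).2.1 h.le
    have e₃ := (hA hl₃).2.1 h.le
    have e₄ := (hA hl₄).2.1 h.le
    simp only [Prod.fst_add, Prod.snd_add, Pi.add_apply]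
    linarith
  · have := h₃ ⟨(i, i'), h⟩
    rw [fnl_wall_thd] at this
    have e₁ := (hA hl₁).2.2 h.le
    have e₂ := (hA hl₂).2.2 h.le
    have e₄ := (hA hl₄).2.2 h.le
    simp only [Prod.snd_add, Pi.add_apply]
    linarith
  · have := h₄ k
    rw [fnl_single_thd] at this
    have e₁ := hpos _ hl₁.1 k
    have e₂ := hpos _ hl₂.1 k
    have e₃ := hpos _ hl₃.1 k
    simp only [Prod.snd_add, Pi.add_apply]
    linarith

/-- A functional vanishing on all zero weights vanishes on a facet that has a regular point. -/
lemma fnl_eq_zero_of_zero_weights {lam : (Fin a → ℝ) × (Fin b → ℝ) × (Fin c → ℝ)}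
    (hnn : ∀ mu ∈ KronCone a b c, 0 ≤ wtPair HA HB HC z mu) (hl : lam ∈ face HA HB HC z)
    (hA : StrictAnti lam.1) (hB : StrictAnti lam.2.1) (hC : StrictAnti lam.2.2)
    {x : Fin a → ℝ} {y : Fin b → ℝ} {w : Fin c → ℝ}
    (h : ∀ i j k, HA i + z + HB j + HC k = 0 → x i + y j + w k = 0)
    {mu : (Fin a → ℝ) × (Fin b → ℝ) × (Fin c → ℝ)} (hmu : mu ∈ face HA HB HC z) :
    fnl x y w mu = 0 := by
  have key : ∀ nu ∈ face HA HB HC z, StrictAnti nu.1 → StrictAnti nu.2.1 → StrictAnti nu.2.2 →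
      fnl x y w nu = 0 := by
    intro nu hnu h1 h2 h3
    obtain ⟨ψ, hψ⟩ := exists_diagMarg_of_mem_kronCone hnu.1
    rw [hψ.eq_marg, fnl_marg]
    refine Finset.sum_eq_zero fun p _ => ?_
    by_cases hp : ψ p = 0
    · simp [hp]
    · rw [h _ _ _ (weight_eq_zero_of_regular hψ h1 h2 h3
        (fun mu hmu => (wtPair_eq_fnl HA HB HC z mu) ▸ hnn mu hmu)
        ((wtPair_eq_fnl HA HB HC z nu) ▸ hnu.2) hp), zero_mul]
  have hm := antitone_of_mem_kronCone hmu.1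
  have h1 := key (mu + lam) (add_mem_face hmu hl) (fun i i' hi => add_lt_add_of_le_of_lt
    (hm.1 hi.le) (hA hi)) (fun i i' hi => add_lt_add_of_le_of_lt (hm.2.1 hi.le) (hB hi))
    (fun i i' hi => add_lt_add_of_le_of_lt (hm.2.2 hi.le) (hC hi))
  rwa [map_add, key lam hl hA hB hC, add_zero] at h1

/-- A state whose last marginal is an invertible diagonal matrix has a nonvanishing transversal. -/
lemma exists_equiv_forall_ne_zero {ψ : Fin a × Fin b × Fin (a * b) → ℂ} {m : Fin (a * b) → ℝ}
    (h : rhoC ψ = rdiag m) (hm : ∀ k, m k ≠ 0) :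
    ∃ φ : Fin (a * b) ≃ Fin a × Fin b, ∀ k, ψ ((φ k).1, (φ k).2, k) ≠ 0 := by
  set e : Fin (a * b) ≃ Fin a × Fin b := finProdFinEquiv.symm with he
  set N : Matrix (Fin (a * b)) (Fin (a * b)) ℂ :=
    Matrix.of fun l k => ψ ((e l).1, (e l).2, k) with hN
  have hNN : Nᵀ * N.map (starRingEnd ℂ) = rdiag m := by
    rw [← h]
    ext k k'
    simp only [mul_apply, transpose_apply, map_apply, hN, of_apply, rhoC]
    rw [e.sum_comp fun q => ψ (q.1, q.2, k) * (starRingEnd ℂ) (ψ (q.1, q.2, k')),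
      Fintype.sum_prod_type]
  have hdet : N.det ≠ 0 := by
    intro h0
    have h1 := congrArg det hNN
    rw [det_mul, det_transpose, h0, zero_mul, rdiag, det_diagonal] at h1
    exact Finset.prod_ne_zero_iff.2 (fun k _ => Complex.ofReal_ne_zero.2 (hm k)) h1.symm
  rw [det_apply] at hdet
  obtain ⟨σ, -, hσ⟩ := Finset.exists_ne_zero_of_sum_ne_zero hdet
  refine ⟨σ.trans e, fun k hk => hσ ?_⟩
  rw [Finset.prod_eq_zero (Finset.mem_univ k) (by simpa [hN] using hk), smul_zero]

end RegularPoints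

/-- non-trivial facets of `C(a,b,ab)` with `(H_A,H_B) ≠ 0`:
`(H_A,H_B)` is an extremal edge, the entries of `H_{AB}` are exactly the partial
sums `-H_{A,i} - H_{B,j}`, and `z = 0`. -/
theorem facet_of_kronCone_ab (a b : ℕ) (ha : 1 < a) (hab : a ≤ b)
    (HA : Fin a → ℝ) (HB : Fin b → ℝ) (HAB : Fin (a * b) → ℝ) (z : ℝ)
    (hfacet : IsFacetNormal a b (a * b) HA HB HAB z)
    (hnt : ¬ IsTrivialNormal HA HB HAB z)
    (hne : ¬ (HA = 0 ∧ HB = 0)) :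
    ExtremalEdge HA HB ∧
    (∃ φ : Fin (a * b) ≃ Fin a × Fin b,
      ∀ m, HAB m = -HA (φ m).1 - HB (φ m).2) ∧
    z = 0 := by
  have hc : a ≤ a * b ∧ b ≤ a * b :=
    ⟨Nat.le_mul_of_pos_right a (by omega), Nat.le_mul_of_pos_left b (by omega)⟩
  have ha0 : 0 < a := by omega
  have hb0 : 0 < b := by omega
  have hc0 : 0 < a * b := Nat.mul_pos ha0 hb0
  obtain ⟨hA0, hB0, hC0⟩ := hfacet.1
  have hnn := hfacet.2.2.1
  obtain ⟨lam, hl, hA, hB, hC, hpos⟩ := exists_regular_mem_face ha0 hb0 hc.1 hc.2 hfacet hnt hne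
  obtain ⟨ψ, hψ⟩ := exists_diagMarg_of_mem_kronCone hl.1
  obtain ⟨φ, hφ⟩ := exists_equiv_forall_ne_zero hψ.2.2 fun k => (hpos k).ne'
  have hwt : ∀ k, HA (φ k).1 + z + HB (φ k).2 + HAB k = 0 := fun k =>
    weight_eq_zero_of_regular hψ hA hB hC (x := fun i => HA i + z)
      (fun mu hmu => (wtPair_eq_fnl HA HB HAB z mu) ▸ hnn mu hmu)
      ((wtPair_eq_fnl HA HB HAB z lam) ▸ hl.2) (hφ k)
  have hsum : ∀ (x : Fin a → ℝ) (y : Fin b → ℝ), ∑ i, x i = 0 → ∑ j, y j = 0 →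
      ∑ k, (x (φ k).1 + y (φ k).2) = 0 := by
    intro x y hx hy
    rw [φ.sum_comp fun q => x q.1 + y q.2, Fintype.sum_prod_type]
    simp only [Finset.sum_add_distrib, hy, Finset.sum_const, add_zero, ← Finset.smul_sum, hx,
      smul_zero]
  have hz : z = 0 := by
    have h1 : ∑ k, ((HA (φ k).1 + HB (φ k).2) + (HAB k + z)) = 0 :=
      Finset.sum_eq_zero fun k _ => by linarith [hwt k]
    rw [Finset.sum_add_distrib, hsum HA HB hA0 hB0, Finset.sum_add_distrib, hC0] at h1
    simpa [ha0.ne', hb0.ne'] using h1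
  refine ⟨⟨hA0, hB0, hne, fun x y hx hy hxy => ?_⟩, ⟨φ, fun m => by linarith [hwt m]⟩, hz⟩
  obtain ⟨t, h1, h2, -, -⟩ := hfacet.exists_smul ha0 hb0 hc0 hx hy
    (w := fun k => -(x (φ k).1 + y (φ k).2))
    (by rw [Finset.sum_neg_distrib, hsum x y hx hy, neg_zero])
    fun mu hmu => fnl_eq_zero_of_zero_weights hnn hl hA hB hC (fun i j k hijk => by
      have := hxy i j (φ k).1 (φ k).2 (by linarith [hwt k])
      linarith) hmu
  exact ⟨t, h1, h2⟩

end
end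

section
/- Let a, b ≥ 2 and let (H_A,H_B) ∈ ℝ^a × ℝ^b with Σ_i H_{A,i} = Σ_j H_{B,j} = 0 satisfy the extremal-edge condition. Assume (H_A,H_B) is primitive in the dual of the root lattice: all differences H_{A,i} − H_{A,k} and H_{B,j} − H_{B,l} are integers, and there is no integer n ≥ 2 dividing all of these differences. Then H_A is either zero or itself primitive (i.e., no integer n ≥ 2 divides all differences H_{A,i} − H_{A,k}), and likewise H_B is either zero or primitive. -/
open scoped BigOperators

theorem ExtremalEdge.symm {a b : ℕ} {HA : Fin a → ℝ} {HB : Fin b → ℝ}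
    (h : ExtremalEdge HA HB) : ExtremalEdge HB HA := by
  obtain ⟨hA, hB, hne, hext⟩ := h
  refine ⟨hB, hA, fun h => hne h.symm, fun x y hx hy hxy => ?_⟩
  obtain ⟨t, hty, htx⟩ := hext y x hy hx fun i j k l h => by
    linarith [hxy j i l k (by linarith)]
  exact ⟨t, htx, hty⟩

/-- If the first component of an extremal edge is nonzero, every function on the indices of the
second component that respects the defining equations is constant. -/
theorem ExtremalEdge.eq_of_forall_add_eq {a b : ℕ} {HA : Fin a → ℝ} {HB : Fin b → ℝ}
    (h : ExtremalEdge HA HB) (hA : HA ≠ 0) (c : Fin b → ℝ)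
    (hc : ∀ i j k l, HA i + HB j = HA k + HB l → c j = c l) (j l : Fin b) : c j = c l := by
  have hb : (b : ℝ) ≠ 0 := Nat.cast_ne_zero.mpr j.pos.ne'
  obtain ⟨t, htA, htB⟩ := h.2.2.2 0 (fun j => c j - (∑ k, c k) / b) (by simp)
    (by simp [Finset.sum_sub_distrib, mul_div_cancel₀ _ hb])
    (fun i j k l h => by simp [hc i j k l h])
  have ht : t = 0 := (smul_eq_zero.mp htA.symm).resolve_right hA
  subst ht
  have hj := congrFun htB j
  have hl := congrFun htB l
  simp only [zero_smul, Pi.zero_apply] at hj hl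
  linarith

/-- A divisor of all differences in a nonzero first component of an extremal edge also divides all
differences in the second component. -/
theorem ExtremalEdge.exists_sub_eq_mul {a b : ℕ} {HA : Fin a → ℝ} {HB : Fin b → ℝ}
    (h : ExtremalEdge HA HB) (hA : HA ≠ 0) {n : ℝ}
    (hn : ∀ i k, ∃ m : ℤ, HA i - HA k = n * m) (j l : Fin b) :
    ∃ m : ℤ, HB j - HB l = n * m := by
  classical
  have hconst := h.eq_of_forall_add_eq hA
    (fun p => if ∃ m : ℤ, HB p - HB l = n * m then 1 else 0) (fun i p k q hpq => by
      obtain ⟨r, hr⟩ := hn k i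
      have hiff : (∃ m : ℤ, HB p - HB l = n * m) ↔ ∃ m : ℤ, HB q - HB l = n * m := by
        constructor
        · rintro ⟨m, hm⟩
          exact ⟨m - r, by push_cast; linarith⟩
        · rintro ⟨m, hm⟩
          exact ⟨m + r, by push_cast; linarith⟩
      simp only [hiff]) j l
  have hl : ∃ m : ℤ, HB l - HB l = n * m := ⟨0, by simp⟩
  by_contra hj
  simp only [if_pos hl, if_neg hj] at hconst
  exact zero_ne_one hconst

/-- if an extremal edge `(H_A, H_B)` is primitive in the dual of
the root lattice, then each of `H_A` and `H_B` is zero or primitive. -/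
theorem components_of_primitive_extremal_edge (a b : ℕ) (ha : 2 ≤ a) (hb : 2 ≤ b)
    (HA : Fin a → ℝ) (HB : Fin b → ℝ)
    (hedge : ExtremalEdge HA HB)
    (hintA : ∀ i k, ∃ m : ℤ, HA i - HA k = (m : ℝ))
    (hintB : ∀ j l, ∃ m : ℤ, HB j - HB l = (m : ℝ))
    (hprim : ¬ ∃ n : ℕ, 2 ≤ n ∧
        (∀ i k, ∃ m : ℤ, HA i - HA k = (n : ℝ) * (m : ℝ)) ∧
        (∀ j l, ∃ m : ℤ, HB j - HB l = (n : ℝ) * (m : ℝ))) :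
    (HA = 0 ∨ ¬ ∃ n : ℕ, 2 ≤ n ∧
        ∀ i k, ∃ m : ℤ, HA i - HA k = (n : ℝ) * (m : ℝ)) ∧
    (HB = 0 ∨ ¬ ∃ n : ℕ, 2 ≤ n ∧
        ∀ j l, ∃ m : ℤ, HB j - HB l = (n : ℝ) * (m : ℝ)) := by
  refine ⟨or_iff_not_imp_left.mpr ?_, or_iff_not_imp_left.mpr ?_⟩
  · rintro hA ⟨n, hn, hdvd⟩
    exact hprim ⟨n, hn, hdvd, hedge.exists_sub_eq_mul hA hdvd⟩
  · rintro hB ⟨n, hn, hdvd⟩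
    exact hprim ⟨n, hn, hedge.symm.exists_sub_eq_mul hB hdvd, hdvd⟩
end
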